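/- Let i ≠ j ∈ {1,...,6} with i + j ≢ 0 (mod 7). Then for any basepoints p ∈ M(𝔑_i) and q ∈ M(𝔑_j), the fundamental groups π₁(M(𝔑_i), p) and π₁(M(𝔑_j), q) are not isomorphic as groups. -/

import Mathlib

/- The complex projective plane `ℂℙ²`, with its quotient topology, and projective
lines given as zero loci of linear forms in the homogeneous coordinates. -/

open scoped LinearAlgebra.Projectivization
open Projectivization

noncomputable section

abbrev CP2 := ℙ ℂ (Fin 3 → ℂ)

instance : TopologicalSpace CP2 :=
  inferInstanceAs (TopologicalSpace (Quotient (projectivizationSetoid ℂ (Fin 3 → ℂ))))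

/-- The projective line `{[x:y:z] | a*x + b*y + c*z = 0}`.  (The zero locus of a linear
form is well defined on any representative, so we may use the representative `p.rep`.) -/
def projLine (a b c : ℂ) : Set CP2 :=
  {p | a * p.rep 0 + b * p.rep 1 + c * p.rep 2 = 0}

/-- The lines of the arrangement `N_i`, where `α = ξ^i`:
`L1: z=0`, `L2: αx−y+z=0`, `L3: (α²+α)x−αy+(α+1)z=0`, `L4: x=0`, `L5: x+αy−(α+1)z=0`,
`L6: (α+1)x−y=0`, `L7: x−z=0`, `L8: αx+α²y−(α³+α²+α)z=0`, `L9: y=0`, `L10: y−z=0`,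
`L11: (α²+1)y−(α²+α+1)z=0`. -/
def Nline (α : ℂ) : Fin 11 → Set CP2 :=
  ![projLine 0 0 1,
    projLine α (-1) 1,
    projLine (α^2 + α) (-α) (α + 1),
    projLine 1 0 0,
    projLine 1 α (-(α + 1)),
    projLine (α + 1) (-1) 0,
    projLine 1 0 (-1),
    projLine α (α^2) (-(α^3 + α^2 + α)),
    projLine 0 1 0,
    projLine 0 1 (-1),
    projLine 0 (α^2 + 1) (-(α^2 + α + 1))]

/-- The lines of the arrangement `𝔑_i = N_i ∪ {L12}`.  Here `L12 : αy − (α+1)²z = 0`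
is the unique line through `[1:0:0]` (the common point of `L1, L9, L10, L11`) and the
intersection point `[α : (α+1)² : α]` of `L3` and `L7`. -/
def NNline (α : ℂ) : Fin 12 → Set CP2 :=
  Fin.snoc (Nline α) (projLine 0 α (-((α + 1)^2)))


noncomputable section

open Set Topology unitInterval

/-- induction principle for paths -/
theorem path_induct {X : Type*} [TopologicalSpace X] {P : ∀ x y : X, Path x y → Prop}
    (hom : ∀ x y (γ γ' : Path x y), γ.Homotopic γ' → P x y γ → P x y γ')
    (trans : ∀ x y z (γ : Path x y) (γ' : Path y z), P x y γ → P y z γ' → P x z (γ.trans γ'))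
    (loc : ∀ y, ∃ N ∈ 𝓝 y, ∀ a b (γ : Path a b), range γ ⊆ N → P a b γ)
    {x y : X} (γ : Path x y) : P x y γ := by
  choose N hN hP using loc
  obtain ⟨t, t0, tm, ⟨n, tn⟩, ht⟩ := exists_monotone_Icc_subset_open_cover_unitInterval
    (c := fun z => γ ⁻¹' (interior (N z)))
    (fun z => isOpen_interior.preimage γ.continuous)
    (fun s _ => mem_iUnion.2 ⟨γ s, mem_interior_iff_mem_nhds.2 (hN _)⟩)
  have key : ∀ m, P _ _ (γ.subpath (t 0) (t m)) := by
    intro m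
    induction m with
    | zero =>
      obtain ⟨z, hz⟩ := ht 0
      apply hP z
      rw [Path.range_subpath_of_le _ _ _ le_rfl]
      rintro _ ⟨s, hs, rfl⟩
      exact interior_subset (hz ⟨hs.1, hs.2.trans (tm (Nat.zero_le _))⟩)
    | succ m ih =>
      obtain ⟨z, hz⟩ := ht m
      have h2 : P _ _ (γ.subpath (t m) (t (m+1))) := by
        apply hP z
        rw [Path.range_subpath_of_le _ _ _ (tm (Nat.le_succ _))]
        rintro _ ⟨s, hs, rfl⟩
        exact interior_subset (hz hs)
      exact hom _ _ _ _ ⟨Path.Homotopy.subpathTransSubpath γ _ _ _⟩ (trans _ _ _ _ _ ih h2)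
  have := key n
  rw [t0, tn n le_rfl] at this
  rw [Path.subpath_zero_one] at this
  have conv : ∀ x' y' (hx : x' = x) (hy : y' = y), P x' y' (γ.cast hx hy) → P x y γ := by
    intro x' y' hx hy h
    subst hx hy
    exact h
  exact conv _ _ _ _ this

/-- multiplicative functionals on paths -/
structure PF (X : Type*) [TopologicalSpace X] (G : Type*) [Group G] where
  val : ∀ {x y : X}, Path x y → G
  trans : ∀ {x y z : X} (γ : Path x y) (γ' : Path y z), val (γ.trans γ') = val γ * val γ'
  hom : ∀ {x y : X} (γ γ' : Path x y), γ.Homotopic γ' → val γ = val γ'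

namespace PF
variable {X : Type*} [TopologicalSpace X] {G : Type*} [Group G] (F : PF X G)

theorem refl (x : X) : F.val (Path.refl x) = 1 := by
  have := F.trans (Path.refl x) (Path.refl x)
  rw [Path.refl_trans_refl] at this
  simpa using this

theorem symm {x y : X} (γ : Path x y) : F.val γ.symm = (F.val γ)⁻¹ := by
  have := F.hom _ _ ⟨Path.Homotopy.reflTransSymm γ⟩
  rw [F.refl, F.trans] at this
  exact (inv_eq_of_mul_eq_one_right this.symm).symm

theorem cast {x y x' y' : X} (γ : Path x y) (hx : x' = x) (hy : y' = y) :
    F.val (γ.cast hx hy) = F.val γ := by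
  subst hx hy; rfl

/-- gauge equivalence is local -/
theorem ext_local (F' : PF X G) (s : X → G)
    (loc : ∀ y, ∃ N ∈ 𝓝 y, ∀ a b (γ : Path a b), range γ ⊆ N →
      s a * F.val γ = F'.val γ * s b) {x y : X} (γ : Path x y) :
    s x * F.val γ = F'.val γ * s y := by
  refine path_induct (P := fun x y γ => s x * F.val γ = F'.val γ * s y) ?_ ?_ loc γ
  · intro x y γ γ' h h1
    rw [← F.hom _ _ h, ← F'.hom _ _ h, h1]
  · intro x y z γ γ' h1 h2
    rw [F.trans, F'.trans, ← mul_assoc, h1, mul_assoc, h2, mul_assoc]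

/-- pushforward along continuous map : pull back functional -/
def comap {Y : Type*} [TopologicalSpace Y] (f : C(Y, X)) : PF Y G where
  val γ := F.val (γ.map f.continuous)
  trans γ γ' := by rw [Path.map_trans, F.trans]
  hom γ γ' h := F.hom _ _ (h.map f)

def mapG {G' : Type*} [Group G'] (f : G →* G') : PF X G' where
  val γ := f (F.val γ)
  trans γ γ' := by rw [F.trans, map_mul]
  hom γ γ' h := by rw [F.hom _ _ h]

end PF

/-- Cech cocycles give path functionals -/
theorem cech {Y : Type*} [TopologicalSpace Y] {G : Type*} [Group G] (B : Y → Set Y)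
    (hB : ∀ y, IsOpen (B y)) (hy : ∀ y, y ∈ B y) (h : Y → Y → G)
    (hc : ∀ i j k y, y ∈ B i → y ∈ B j → y ∈ B k → h i j * h j k = h i k) :
    ∃ F : PF Y G, ∀ z x y (γ : Path x y), range γ ⊆ B z → F.val γ = h x z * h z y := by
  let _ : TopologicalSpace G := ⊥
  have : DiscreteTopology G := ⟨rfl⟩
  have hself : ∀ i, h i i = 1 := fun i => by
    have := hc i i i i (hy i) (hy i) (hy i); simpa using this
  let Z : FiberBundleCore Y Y G :=
    { baseSet := B
      isOpen_baseSet := hB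
      indexAt := id
      mem_baseSet_at := hy
      coordChange := fun i j _ k => k * h i j
      coordChange_self := fun i x _ v => by simp [hself]
      continuousOn_coordChange := fun i j => by
        apply Continuous.continuousOn
        exact (continuous_of_discreteTopology (f := fun k : G => k * h i j)).comp continuous_snd
      coordChange_comp := fun i j k x hx v => by
        change v * h i j * h j k = v * h i k
        rw [mul_assoc, hc i j k x hx.1.1 hx.1.2 hx.2] }
  have cov : IsCoveringMap Z.proj := by
    have : ∀ x, DiscreteTopology (Z.Fiber x) := fun x => inferInstanceAs (DiscreteTopology G)
    exact FiberBundle.isCoveringMap (F := G) (E := Z.Fiber)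
  have loc : ∀ z x y (γ : Path x y) (hγ : range γ ⊆ B z) (k : G),
      cov.liftPath γ (⟨x, k⟩ : Z.TotalSpace) γ.source 1 = ⟨y, k * (h x z * h z y)⟩ := by
    intro z x y γ hγ k
    have hg : ∀ t, γ t ∈ B z := fun t => hγ ⟨t, rfl⟩
    let Γ : I → Z.TotalSpace := fun t => ⟨γ t, k * h x z * h z (γ t)⟩
    have hΓ : Γ = cov.liftPath γ (⟨x, k⟩ : Z.TotalSpace) γ.source := by
      rw [cov.eq_liftPath_iff]
      refine ⟨?_, ?_, ?_⟩
      · have e : Γ = fun t => (Z.localTriv z).toOpenPartialHomeomorph.symm (γ t, k * h x z) := by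
          funext t
          rfl
        rw [e]
        refine (Z.localTriv z).toOpenPartialHomeomorph.continuousOn_symm.comp_continuous
          (by fun_prop) ?_
        intro t
        rw [(Z.localTriv z).target_eq]
        exact ⟨hg t, trivial⟩
      · funext t; rfl
      · have : h x z * h z x = 1 := by
          rw [hc x z x x (hy x) (by simpa using hg 0) (hy x), hself]
        have e2 : Γ 0 = ⟨γ 0, (k * h x z * h z (γ 0) : G)⟩ := rfl
        rw [e2, γ.source]
        exact congrArg (fun g : G => (⟨x, g⟩ : Z.TotalSpace)) (by rw [mul_assoc, this, mul_one])
    rw [← hΓ]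
    have e2 : Γ 1 = ⟨γ 1, (k * h x z * h z (γ 1) : G)⟩ := rfl
    rw [e2, γ.target]
    exact congrArg (fun g : G => (⟨y, g⟩ : Z.TotalSpace)) (mul_assoc _ _ _)
  have ex : ∀ x y (γ : Path x y), ∃ f : G, ∀ k : G,
      cov.liftPath γ (⟨x, k⟩ : Z.TotalSpace) γ.source 1 = ⟨y, k * f⟩ := by
    intro x y γ
    refine path_induct (P := fun x y γ => ∃ f : G, ∀ k : G,
      cov.liftPath γ (⟨x, k⟩ : Z.TotalSpace) γ.source 1 = ⟨y, k * f⟩) ?_ ?_ ?_ γ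
    · rintro x y γ γ' hh ⟨f, hf⟩
      refine ⟨f, fun k => ?_⟩
      rw [← hf k]
      exact (cov.liftPath_apply_one_eq_of_homotopicRel hh _ _ _).symm
    · rintro x y z γ γ' ⟨f, hf⟩ ⟨f', hf'⟩
      refine ⟨f * f', fun k => ?_⟩
      have := cov.monodromy_trans_apply (Path.Homotopic.Quotient.mk γ)
        (Path.Homotopic.Quotient.mk γ') ⟨(⟨x, k⟩ : Z.TotalSpace), rfl⟩
      have h1 : cov.monodromy (Path.Homotopic.Quotient.mk γ) ⟨(⟨x, k⟩ : Z.TotalSpace), rfl⟩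
        = ⟨(⟨y, k * f⟩ : Z.TotalSpace), rfl⟩ := Subtype.ext (hf k)
      rw [h1] at this
      have h2 := congrArg Subtype.val this
      refine h2.trans ?_
      refine (hf' (k * f)).trans ?_
      exact congrArg (fun g : G => (⟨z, g⟩ : Z.TotalSpace)) (mul_assoc _ _ _)
    · intro y
      refine ⟨B y, (hB y).mem_nhds (hy y), fun a b γ hγ => ⟨_, loc y a b γ hγ⟩⟩
  choose f hf using ex
  have uniq : ∀ x y (γ : Path x y) (g : G),
      cov.liftPath γ (⟨x, (1:G)⟩ : Z.TotalSpace) γ.source 1 = ⟨y, (1:G) * g⟩ → f x y γ = g := by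
    intro x y γ g hg
    rw [hf x y γ 1] at hg
    have h3 : (1:G) * f x y γ = (1:G) * g := eq_of_heq (Bundle.TotalSpace.mk.inj hg).2
    exact mul_left_cancel h3
  refine ⟨⟨fun {x y} γ => f x y γ, ?_, ?_⟩, ?_⟩
  · intro x y z γ γ'
    apply uniq
    have := cov.monodromy_trans_apply (Path.Homotopic.Quotient.mk γ)
        (Path.Homotopic.Quotient.mk γ') ⟨(⟨x, (1:G)⟩ : Z.TotalSpace), rfl⟩
    have h1 : cov.monodromy (Path.Homotopic.Quotient.mk γ) ⟨(⟨x, (1:G)⟩ : Z.TotalSpace), rfl⟩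
        = ⟨(⟨y, (1:G) * f x y γ⟩ : Z.TotalSpace), rfl⟩ := Subtype.ext (hf x y γ 1)
    rw [h1] at this
    have h2 := congrArg Subtype.val this
    refine h2.trans ?_
    refine (hf _ _ γ' _).trans ?_
    exact congrArg (fun g : G => (⟨z, g⟩ : Z.TotalSpace)) (mul_assoc _ _ _)
  · intro x y γ γ' hh
    apply uniq
    rw [← hf]
    exact cov.liftPath_apply_one_eq_of_homotopicRel hh _ _ _
  · intro z x y γ hγ
    exact uniq _ _ _ _ (loc z x y γ hγ 1)

end

noncomputable section
open Set Topology unitInterval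

/-- the triples (a,b,r) of concurrent lines that are used -/
def tr : Fin 21 → Fin 12 × Fin 12 × Fin 12 :=
  ![(8,9,0),(8,10,0),(9,10,0),(1,5,6),(1,5,7),(1,6,7),(2,5,0),(3,6,0),(4,7,0),(1,2,8),(1,3,9),
    (1,4,10),(2,3,4),(2,7,10),(3,5,8),(4,6,9),(8,11,0),(9,11,0),(10,11,0),(5,6,7),(2,6,11)]

def uu (T : Fin 21) (x : Fin 12 → ℂ) : ℂ := x (tr T).1 - x (tr T).2.2
def vv (T : Fin 21) (x : Fin 12 → ℂ) : ℂ := x (tr T).2.1 - x (tr T).2.2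
def eta (T : Fin 21) (x y : Fin 12 → ℂ) : ℂ := uu T x * vv T y - vv T x * uu T y
def cc (c : Fin 21 → Fin 12 → ℂ) (T : Fin 21) (x : Fin 12 → ℂ) : ℂ := ∑ k, c T k * x k

def Syz (c : Fin 21 → Fin 12 → ℂ) : Prop := ∀ x y z : Fin 12 → ℂ,
  ∑ T, (cc c T x * eta T y z + cc c T y * eta T z x + cc c T z * eta T x y) = 0

theorem uu_add (T x y) : uu T (x + y) = uu T x + uu T y := by simp only [uu, Pi.add_apply]; ring
theorem vv_add (T x y) : vv T (x + y) = vv T x + vv T y := by simp only [vv, Pi.add_apply]; ring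
theorem cc_add (c T x y) : cc c T (x + y) = cc c T x + cc c T y := by
  simp only [cc, Pi.add_apply, mul_add, Finset.sum_add_distrib]
theorem cc_neg (c T x) : cc c T (-x) = - cc c T x := by
  simp only [cc, Pi.neg_apply, mul_neg, Finset.sum_neg_distrib]
theorem uu_neg (T x) : uu T (-x) = - uu T x := by simp only [uu, Pi.neg_apply]; ring
theorem vv_neg (T x) : vv T (-x) = - vv T x := by simp only [vv, Pi.neg_apply]; ring

@[ext]
structure Uni where
  L : Fin 12 → ℂ
  J : Fin 21 → ℂ
  K : {c // Syz c} → ℂ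

namespace Uni

instance : Mul Uni := ⟨fun g h =>
  { L := g.L + h.L
    J := fun T => g.J T + h.J T + 1/2 * eta T g.L h.L
    K := fun c => g.K c + h.K c + ∑ T, (g.J T * cc c.1 T h.L - 1/2 * cc c.1 T g.L * h.J T
      + 1/4 * eta T g.L h.L * cc c.1 T h.L) }⟩
instance : One Uni := ⟨⟨0, 0, 0⟩⟩
instance : Inv Uni := ⟨fun g =>
  { L := - g.L
    J := fun T => - g.J T
    K := fun c => - g.K c + ∑ T, 1/2 * g.J T * cc c.1 T g.L }⟩

theorem mul_L (g h : Uni) : (g * h).L = g.L + h.L := rfl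
theorem mul_J (g h : Uni) (T) : (g * h).J T = g.J T + h.J T + 1/2 * eta T g.L h.L := rfl
theorem mul_K (g h : Uni) (c) : (g * h).K c = g.K c + h.K c + ∑ T,
    (g.J T * cc c.1 T h.L - 1/2 * cc c.1 T g.L * h.J T
      + 1/4 * eta T g.L h.L * cc c.1 T h.L) := rfl
theorem inv_L (g : Uni) : (g⁻¹).L = - g.L := rfl
theorem inv_J (g : Uni) (T) : (g⁻¹).J T = - g.J T := rfl

instance : Group Uni := Group.ofLeftAxioms
  (by
    intro g h k
    ext i
    · simp only [mul_L, add_assoc]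
    · simp only [mul_J, mul_L, eta, uu_add, vv_add]; ring
    · have := i.2 g.L h.L k.L
      simp only [mul_K, mul_J, mul_L, eta, uu_add, vv_add, cc_add] at this ⊢
      rw [← sub_eq_zero]
      have e : ∀ a b c s1 s2 s3 s4 : ℂ, a + b + s1 + c + s2 - (a + (b + c + s3) + s4)
        = (s1 + s2) - (s3 + s4) := by intros; ring
      rw [e, ← Finset.sum_add_distrib, ← Finset.sum_add_distrib, ← Finset.sum_sub_distrib]
      have e2 : (0:ℂ) = 1/4 * 0 := by ring
      rw [e2, ← this, Finset.mul_sum]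
      refine Finset.sum_congr rfl fun T _ => ?_
      ring)
  (by
    intro g
    ext i
    · simp [mul_L, show (1:Uni).L = 0 from rfl]
    · simp [mul_J, show (1:Uni).L = 0 from rfl, show (1:Uni).J = 0 from rfl, eta, uu, vv]
    · simp [mul_K, show (1:Uni).L = 0 from rfl, show (1:Uni).J = 0 from rfl,
        show (1:Uni).K = 0 from rfl, eta, uu, vv, cc])
  (by
    intro g
    ext i
    · simp [mul_L, inv_L, show (1:Uni).L = 0 from rfl]
    · simp [mul_J, inv_J, inv_L, show (1:Uni).J = 0 from rfl, eta, uu, vv]; ring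
    · have : (g⁻¹).K i = - g.K i + ∑ T, 1/2 * g.J T * cc i.1 T g.L := rfl
      rw [mul_K, this, show (1:Uni).K = 0 from rfl]
      have e : ∀ a s t : ℂ, -a + s + a + t = s + t := by intros; ring
      rw [e, ← Finset.sum_add_distrib]
      refine Finset.sum_eq_zero fun T _ => ?_
      rw [inv_J, inv_L, cc_neg, eta, uu_neg, vv_neg]; ring)

theorem one_L : (1 : Uni).L = 0 := rfl
theorem one_J : (1 : Uni).J = 0 := rfl

theorem comm_eta {g h : Uni} (hc : g * h = h * g) (T) : eta T g.L h.L = 0 := by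
  have := congrArg (fun k => k.J T) hc
  simp only [mul_J, eta] at this ⊢
  linear_combination this

theorem comm_K {g h : Uni} (hc : g * h = h * g) (c : {c // Syz c}) :
    ∑ T, (g.J T * cc c.1 T h.L - h.J T * cc c.1 T g.L) = 0 := by
  have := congrArg (fun k => k.K c) hc
  simp only [mul_K] at this
  have e : ∀ a b s t : ℂ, a + b + s = b + a + t → s - t = 0 := by
    intro a b s t h; linear_combination h
  have h2 := e _ _ _ _ this
  rw [← Finset.sum_sub_distrib] at h2
  have h3 : ∑ T, (g.J T * cc c.1 T h.L - h.J T * cc c.1 T g.L) = 2/3 * 0 := by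
    rw [← h2, Finset.mul_sum]
    refine Finset.sum_congr rfl fun T _ => ?_
    have h5 := comm_eta hc T
    have h6 := comm_eta hc.symm T
    rw [h5, h6]
    ring
  simpa using h3

end Uni

variable {E : Type*} [NormedAddCommGroup E] [NormedSpace ℂ E]

/-- derivative of the L-part -/
def DL (L : E → Fin 12 → ℂ) (x : E) (k : Fin 12) : E →L[ℂ] ℂ := fderiv ℂ (fun y => L y k) x

/-- horizontal maps -/
structure IsSec (g : E → Uni) (U : Set E) : Prop where
  L : ∀ x ∈ U, ∀ k, DifferentiableAt ℂ (fun y => (g y).L k) x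
  J : ∀ x ∈ U, ∀ T, ∃ D : E →L[ℂ] ℂ, HasFDerivAt (fun y => (g y).J T) D x ∧ ∀ e,
    D e = 1/2 * eta T (g x).L (fun k => DL (fun y => (g y).L) x k e)
  K : ∀ x ∈ U, ∀ c, ∃ D : E →L[ℂ] ℂ, HasFDerivAt (fun y => (g y).K c) D x ∧ ∀ e,
    D e = ∑ T, (g x).J T * cc c.1 T (fun k => DL (fun y => (g y).L) x k e)

theorem IsSec.mono {g : E → Uni} {U V : Set E} (h : IsSec g U) (hV : V ⊆ U) : IsSec g V :=
  ⟨fun x hx => h.L x (hV hx), fun x hx => h.J x (hV hx), fun x hx => h.K x (hV hx)⟩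

theorem hasFDerivAt_uu {L : E → Fin 12 → ℂ} {x : E}
    (h : ∀ k, DifferentiableAt ℂ (fun y => L y k) x) (T) :
    HasFDerivAt (fun y => uu T (L y)) (DL L x (tr T).1 - DL L x (tr T).2.2) x :=
  (h _).hasFDerivAt.sub (h _).hasFDerivAt

theorem hasFDerivAt_vv {L : E → Fin 12 → ℂ} {x : E}
    (h : ∀ k, DifferentiableAt ℂ (fun y => L y k) x) (T) :
    HasFDerivAt (fun y => vv T (L y)) (DL L x (tr T).2.1 - DL L x (tr T).2.2) x :=
  (h _).hasFDerivAt.sub (h _).hasFDerivAt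

theorem hasFDerivAt_cc {L : E → Fin 12 → ℂ} {x : E}
    (h : ∀ k, DifferentiableAt ℂ (fun y => L y k) x) (c T) :
    HasFDerivAt (fun y => cc c T (L y)) (∑ k, c T k • DL L x k) x := by
  unfold cc
  exact HasFDerivAt.fun_sum fun k _ => (h k).hasFDerivAt.const_mul _

theorem IsSec.mul_left {g : E → Uni} {U : Set E} (h : IsSec g U) (k : Uni) :
    IsSec (fun x => k * g x) U := by
  have hD : ∀ x, DL (fun y => (k * g y).L) x = DL (fun y => (g y).L) x := by
    intro x
    funext i
    simp only [DL, Uni.mul_L, Pi.add_apply]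
    exact fderiv_const_add _
  refine ⟨?_, ?_, ?_⟩
  · intro x hx i
    exact (h.L x hx i).const_add _
  · intro x hx T
    obtain ⟨D, hD1, hD2⟩ := h.J x hx T
    have e1 := ((hasFDerivAt_vv (h.L x hx) T).const_mul (uu T k.L)).sub
      ((hasFDerivAt_uu (h.L x hx) T).const_mul (vv T k.L))
    refine ⟨_, (hD1.const_add (k.J T)).add (e1.const_mul (1/2)), fun e => ?_⟩
    rw [hD]
    simp [hD2, eta, uu_add, vv_add, Uni.mul_L]
    simp only [uu, vv]
    ring
  · intro x hx c
    obtain ⟨D, hD1, hD2⟩ := h.K x hx c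
    choose DJ hJ1 hJ2 using fun T => h.J x hx T
    have e1 := fun T => ((hasFDerivAt_vv (h.L x hx) T).const_mul (uu T k.L)).sub
      ((hasFDerivAt_uu (h.L x hx) T).const_mul (vv T k.L))
    have e2 := fun T => (((hasFDerivAt_cc (h.L x hx) c.1 T).const_mul (k.J T)).sub
      ((hJ1 T).const_mul (1/2 * cc c.1 T k.L))).add
      (((e1 T).const_mul (1/4)).mul (hasFDerivAt_cc (h.L x hx) c.1 T))
    have e3 := (hD1.const_add (k.K c)).add (HasFDerivAt.fun_sum (u := Finset.univ) fun T _ => e2 T)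
    refine ⟨_, e3, fun e => ?_⟩
    rw [hD]
    set d : Fin 12 → ℂ := fun k => DL (fun y => (g y).L) x k e with hd
    have hc : ∀ T, (∑ i, c.1 T i • DL (fun y => (g y).L) x i) e = cc c.1 T d := by
      intro T
      simp [cc, hd]
    have hu : ∀ T, (DL (fun y => (g y).L) x (tr T).1 - DL (fun y => (g y).L) x (tr T).2.2) e
      = uu T d := fun T => rfl
    have hv : ∀ T, (DL (fun y => (g y).L) x (tr T).2.1 - DL (fun y => (g y).L) x (tr T).2.2) e
      = vv T d := fun T => rfl
    have hs := c.2 k.L (g x).L d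
    simp only [add_apply, sum_apply, hD2,
      sub_apply, smul_apply, hc, hu, hv, hJ2, smul_eq_mul]
    rw [← Finset.sum_add_distrib, ← sub_eq_zero, ← Finset.sum_sub_distrib]
    have e2 : (0:ℂ) = -1/4 * 0 := by ring
    rw [e2, ← hs, Finset.mul_sum]
    refine Finset.sum_congr rfl fun T _ => ?_
    simp only [Uni.mul_J, eta, ← hd, Pi.sub_apply]
    ring

theorem const_of_hasFDerivAt {f g : E → ℂ} {U : Set E} (hU : Convex ℝ U)
    (hf : ∀ x ∈ U, ∃ D : E →L[ℂ] ℂ, HasFDerivAt f D x ∧ HasFDerivAt g D x) {x y : E}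
    (hx : x ∈ U) (hy : y ∈ U) : f x - g x = f y - g y := by
  have h0 : ∀ z ∈ U, HasFDerivWithinAt (fun z => f z - g z) (0 : E →L[ℂ] ℂ) U z := by
    intro z hz
    obtain ⟨D, h1, h2⟩ := hf z hz
    have := h1.sub h2
    rw [sub_self] at this
    exact this.hasFDerivWithinAt
  have := hU.norm_image_sub_le_of_norm_hasFDerivWithin_le (C := 0) h0 (by simp) hy hx
  simp only [zero_mul, norm_le_zero_iff] at this
  exact sub_eq_zero.1 this

theorem DL_congr {g g' : E → Uni} {U : Set E} (hUo : IsOpen U)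
    (hL : ∀ x ∈ U, ∀ y ∈ U, (g x).L - (g' x).L = (g y).L - (g' y).L) {x : E} (hx : x ∈ U) :
    DL (fun y => (g y).L) x = DL (fun y => (g' y).L) x := by
  funext k
  have : (fun y => (g y).L k) =ᶠ[𝓝 x] fun y => ((g x).L k - (g' x).L k) + (g' y).L k := by
    filter_upwards [hUo.mem_nhds hx] with y hy
    have := congrFun (hL x hx y hy) k
    simp only [Pi.sub_apply] at this
    rw [this]; ring
  unfold DL
  rw [this.fderiv_eq, fderiv_const_add]

theorem IsSec.unique {g g' : E → Uni} {U : Set E} (h : IsSec g U) (h' : IsSec g' U)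
    (hU : Convex ℝ U) (hUo : IsOpen U)
    (hL : ∀ x ∈ U, ∀ y ∈ U, (g x).L - (g' x).L = (g y).L - (g' y).L) {x y : E}
    (hx : x ∈ U) (hy : y ∈ U) : (g x)⁻¹ * g y = (g' x)⁻¹ * g' y := by
  set k := g x * (g' x)⁻¹ with hk
  have h2 := h'.mul_left k
  set g2 : E → Uni := fun x => k * g' x with hg2
  have e0 : g2 x = g x := by simp [hg2, hk]
  have hL1 : ∀ z ∈ U, (g z).L = (g2 z).L := by
    intro z hz
    have := hL x hx z hz
    simp only [hg2, hk, Uni.mul_L, Uni.inv_L]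
    rw [← sub_eq_add_neg, this]
    abel
  have hD : ∀ z ∈ U, DL (fun y => (g y).L) z = DL (fun y => (g2 y).L) z := fun z hz =>
    DL_congr hUo (fun a ha b hb => by rw [hL1 a ha, hL1 b hb, sub_self, sub_self]) hz
  have hJ1 : ∀ z ∈ U, (g z).J = (g2 z).J := by
    intro z hz
    funext T
    have := const_of_hasFDerivAt (f := fun y => (g y).J T) (g := fun y => (g2 y).J T) hU
      (fun w hw => by
        obtain ⟨D, d1, d2⟩ := h.J w hw T
        obtain ⟨D', d1', d2'⟩ := h2.J w hw T
        have : D = D' := by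
          ext e
          rw [d2, d2', hL1 w hw, hD w hw]
        exact ⟨D, d1, this ▸ d1'⟩) hx hz
    rw [e0, sub_self] at this
    exact sub_eq_zero.1 this.symm
  have hK1 : ∀ z ∈ U, (g z).K = (g2 z).K := by
    intro z hz
    funext c
    have := const_of_hasFDerivAt (f := fun y => (g y).K c) (g := fun y => (g2 y).K c) hU
      (fun w hw => by
        obtain ⟨D, d1, d2⟩ := h.K w hw c
        obtain ⟨D', d1', d2'⟩ := h2.K w hw c
        have : D = D' := by
          ext e
          rw [d2, d2', hJ1 w hw, hD w hw]
        exact ⟨D, d1, this ▸ d1'⟩) hx hz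
    rw [e0, sub_self] at this
    exact sub_eq_zero.1 this.symm
  have e1 : g y = g2 y := Uni.ext (hL1 y hy) (hJ1 y hy) (hK1 y hy)
  rw [e1, ← e0]
  simp only [hg2]
  group

theorem IsSec.comp {E' : Type*} [NormedAddCommGroup E'] [NormedSpace ℂ E'] {g : E → Uni}
    {U : Set E} (h : IsSec g U) {Φ : E' → E} {W : Set E'}
    (hΦ : ∀ x ∈ W, DifferentiableAt ℂ Φ x) (hW : MapsTo Φ W U) : IsSec (g ∘ Φ) W := by
  have hD : ∀ x ∈ W, ∀ k e, DL (fun y => ((g ∘ Φ) y).L) x k e =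
      DL (fun y => (g y).L) (Φ x) k (fderiv ℂ Φ x e) := by
    intro x hx k e
    have := (h.L (Φ x) (hW hx) k).hasFDerivAt.comp x (hΦ x hx).hasFDerivAt
    have h2 := this.fderiv
    unfold DL
    simp only [Function.comp_def] at h2 ⊢
    rw [h2]
    rfl
  refine ⟨?_, ?_, ?_⟩
  · intro x hx k
    exact (h.L (Φ x) (hW hx) k).comp x (hΦ x hx)
  · intro x hx T
    obtain ⟨D, d1, d2⟩ := h.J (Φ x) (hW hx) T
    refine ⟨_, d1.comp x (hΦ x hx).hasFDerivAt, fun e => ?_⟩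
    simp only [ContinuousLinearMap.comp_apply, d2, hD x hx]
    rfl
  · intro x hx T
    obtain ⟨D, d1, d2⟩ := h.K (Φ x) (hW hx) T
    refine ⟨_, d1.comp x (hΦ x hx).hasFDerivAt, fun e => ?_⟩
    simp only [ContinuousLinearMap.comp_apply, d2, hD x hx]
    rfl

end

noncomputable section
open Set Topology unitInterval

variable {E : Type*} [NormedAddCommGroup E] [NormedSpace ℂ E]

theorem prim_exists {U : Set E} (hU : Convex ℝ U) (hUo : IsOpen U) {L : E → Fin 12 → ℂ}
    (hL : ∀ k, ContDiffOn ℂ 2 (fun y => L y k) U) (a : E → Fin 12 → ℂ)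
    (Da : E → Fin 12 → (E →L[ℂ] ℂ)) (ha : ∀ x ∈ U, ∀ k, HasFDerivAt (fun y => a y k) (Da x k) x)
    (hs : ∀ x ∈ U, ∀ e f, ∑ k, Da x k e * DL L x k f = ∑ k, Da x k f * DL L x k e) :
    ∃ F : E → ℂ, ∀ x ∈ U, HasFDerivAt F (∑ k, a x k • DL L x k) x := by
  have hd : ∀ x ∈ U, ∀ k, DifferentiableAt ℂ (fun y => DL L y k) x := by
    intro x hx k
    have h1 : ContDiffAt ℂ 2 (fun y => L y k) x := (hL k).contDiffAt (hUo.mem_nhds hx)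
    exact (h1.fderiv_right (m := 1) (by norm_num)).differentiableAt (by norm_num)
  have hω : ∀ x ∈ U, HasFDerivAt (fun y => ∑ k, a y k • DL L y k)
      (∑ k, (a x k • fderiv ℂ (fun y => DL L y k) x + (Da x k).smulRight (DL L x k))) x := by
    intro x hx
    exact HasFDerivAt.fun_sum fun k _ => (ha x hx k).smul (hd x hx k).hasFDerivAt
  refine hU.exists_forall_hasFDerivAt_of_fderiv_symmetric hUo
    (fun x hx => ((hω x hx).differentiableAt.restrictScalars ℝ).differentiableWithinAt) ?_
  intro x hx e f
  rw [((hω x hx).restrictScalars ℝ).fderiv]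
  have hsym : ∀ k, fderiv ℂ (fun y => DL L y k) x e f = fderiv ℂ (fun y => DL L y k) x f e := by
    intro k
    have h1 : ContDiffAt ℂ 2 (fun y => L y k) x := (hL k).contDiffAt (hUo.mem_nhds hx)
    exact (h1.isSymmSndFDerivAt (by simp)) e f
  have := hs x hx e f
  simp only [ContinuousLinearMap.coe_restrictScalars', sum_apply, add_apply, smul_apply,
    ContinuousLinearMap.smulRight_apply, smul_eq_mul, Finset.sum_add_distrib, this, hsym]

theorem eta_single (T : Fin 21) (l d : Fin 12 → ℂ) :
    ∑ k, eta T l (Pi.single k 1) * d k = eta T l d := by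
  simp [eta, uu, vv, Pi.single_apply, sub_mul, mul_sub, Finset.sum_sub_distrib]

theorem exists_sec {U : Set E} (hU : Convex ℝ U) (hUo : IsOpen U) {L : E → Fin 12 → ℂ}
    (hL : ∀ k, ContDiffOn ℂ 2 (fun y => L y k) U)
    (hcl : ∀ x ∈ U, ∀ T, ∀ e f, eta T (fun k => DL L x k e) (fun k => DL L x k f) = 0) :
    ∃ g : E → Uni, IsSec g U ∧ ∀ x, (g x).L = L x := by
  have hd : ∀ x ∈ U, ∀ k, DifferentiableAt ℂ (fun y => L y k) x := fun x hx k =>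
    ((hL k).contDiffAt (hUo.mem_nhds hx)).differentiableAt (by norm_num)
  have hJ : ∀ T, ∃ F : E → ℂ, ∀ x ∈ U, ∃ D : E →L[ℂ] ℂ, HasFDerivAt F D x ∧ ∀ e,
      D e = 1/2 * eta T (L x) (fun k => DL L x k e) := by
    intro T
    obtain ⟨F, hF⟩ := prim_exists hU hUo hL
      (fun x k => 1/2 * eta T (L x) (Pi.single k 1))
      (fun x k => (1/2:ℂ) • ((vv T (Pi.single k 1)) • (DL L x (tr T).1 - DL L x (tr T).2.2)
        - (uu T (Pi.single k 1)) • (DL L x (tr T).2.1 - DL L x (tr T).2.2)))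
      (fun x hx k => by
        have := (((hasFDerivAt_uu (hd x hx) T).mul_const (vv T (Pi.single k 1))).sub
          ((hasFDerivAt_vv (hd x hx) T).mul_const (uu T (Pi.single k 1)))).const_mul (1/2)
        exact this)
      (fun x hx e f => by
        have h1 : ∀ e f : E, ∑ k, ((1/2:ℂ) • ((vv T (Pi.single k 1)) • (DL L x (tr T).1 - DL L x (tr T).2.2)
          - (uu T (Pi.single k 1)) • (DL L x (tr T).2.1 - DL L x (tr T).2.2))) e * DL L x k f
          = 1/2 * eta T (fun k => DL L x k e) (fun k => DL L x k f) := by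
          intro e f
          rw [← eta_single, Finset.mul_sum]
          refine Finset.sum_congr rfl fun k _ => ?_
          simp only [smul_apply, sub_apply, eta, smul_eq_mul]
          simp only [uu, vv]
          ring
        rw [h1, h1, hcl x hx, hcl x hx])
    refine ⟨F, fun x hx => ⟨_, hF x hx, fun e => ?_⟩⟩
    rw [← eta_single, Finset.mul_sum]
    simp only [sum_apply, smul_apply, smul_eq_mul, mul_assoc]
  choose J DJ hJ1 hJ2 using hJ
  have hK : ∀ c : {c // Syz c}, ∃ F : E → ℂ, ∀ x ∈ U, ∃ D : E →L[ℂ] ℂ, HasFDerivAt F D x ∧ ∀ e,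
      D e = ∑ T, J T x * cc c.1 T (fun k => DL L x k e) := by
    intro c
    classical
    have hcomm : ∀ (a : Fin 21 → ℂ) (d : Fin 12 → ℂ),
        ∑ k, (∑ T, a T * c.1 T k) * d k = ∑ T, a T * cc c.1 T d := by
      intro a d
      simp only [cc, Finset.mul_sum, Finset.sum_mul]
      rw [Finset.sum_comm]
      simp only [mul_assoc]
    obtain ⟨F, hF⟩ := prim_exists hU hUo hL (fun x k => ∑ T, J T x * c.1 T k)
      (fun x k => if hx : x ∈ U then ∑ T, c.1 T k • DJ T x hx else 0)
      (fun x hx k => by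
        simp only [hx, dite_true]
        exact HasFDerivAt.fun_sum fun T _ => (hJ1 T x hx).mul_const _)
      (fun x hx e f => by
        simp only [hx, dite_true, sum_apply, smul_apply, smul_eq_mul]
        have e1 : ∀ e f, ∑ k, (∑ T, c.1 T k * DJ T x hx e) * DL L x k f =
            ∑ T, (1/2 * eta T (L x) (fun k => DL L x k e)) * cc c.1 T (fun k => DL L x k f) := by
          intro e f
          rw [← hcomm]
          refine Finset.sum_congr rfl fun k _ => ?_
          congr 1
          refine Finset.sum_congr rfl fun T _ => ?_
          rw [hJ2, mul_comm]
        rw [e1, e1, ← sub_eq_zero, ← Finset.sum_sub_distrib]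
        have h0 := c.2 (L x) (fun k => DL L x k e) (fun k => DL L x k f)
        have h2 : (0:ℂ) = 1/2 * 0 := by ring
        rw [h2, ← h0, Finset.mul_sum]
        refine Finset.sum_congr rfl fun T _ => ?_
        rw [hcl x hx T e f]
        simp only [eta]
        ring)
    refine ⟨F, fun x hx => ⟨_, hF x hx, fun e => ?_⟩⟩
    rw [← hcomm]
    simp only [sum_apply, smul_apply, smul_eq_mul]
  choose K DK hK1 hK2 using hK
  exact ⟨fun x => ⟨L x, fun T => J T x, fun c => K c x⟩,
    ⟨hd, fun x hx T => ⟨_, hJ1 T x hx, hJ2 T x hx⟩, fun x hx c => ⟨_, hK1 c x hx, hK2 c x hx⟩⟩,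
    fun x => rfl⟩

end

noncomputable section
open Set Topology unitInterval

def lf (A : Fin 12 → Fin 3 → ℂ) (k : Fin 12) (p : ℂ × ℂ) : ℂ := A k 0 * p.1 + A k 1 * p.2 + A k 2
def ll (A : Fin 12 → Fin 3 → ℂ) (k : Fin 12) (p : ℂ × ℂ) : ℂ := A k 0 * p.1 + A k 1 * p.2
def det3 {R : Type*} [CommRing R] (a b c : Fin 3 → R) : R :=
  a 0 * (b 1 * c 2 - b 2 * c 1) - a 1 * (b 0 * c 2 - b 2 * c 0) + a 2 * (b 0 * c 1 - b 1 * c 0)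
def XA (A : Fin 12 → Fin 3 → ℂ) : Set (ℂ × ℂ) := {p | ∀ k, lf A k p ≠ 0}

def TrOK (A : Fin 12 → Fin 3 → ℂ) : Prop :=
  ∀ T, det3 (A (tr T).1) (A (tr T).2.1) (A (tr T).2.2) = 0

variable {A : Fin 12 → Fin 3 → ℂ}

theorem lf_cd (A : Fin 12 → Fin 3 → ℂ) (k : Fin 12) {n} : ContDiff ℂ n (lf A k) := by
  unfold lf; fun_prop

theorem lf_cont (A : Fin 12 → Fin 3 → ℂ) (k : Fin 12) : Continuous (lf A k) := by
  unfold lf; fun_prop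

theorem isOpen_XA : IsOpen (XA A) := by
  have : XA A = ⋂ k, (lf A k) ⁻¹' {0}ᶜ := by ext p; simp [XA]
  rw [this]
  exact isOpen_iInter_of_finite fun k => isOpen_compl_singleton.preimage (lf_cont A k)

section
variable {E : Type*} [NormedAddCommGroup E] [NormedSpace ℂ E]

def IsLog (A : Fin 12 → Fin 3 → ℂ) (Φ : E → ℂ × ℂ) (U : Set E) (L : E → Fin 12 → ℂ) : Prop :=
  ∀ k, ∃ C : ℂ, ∀ x ∈ U, Complex.exp (L x k) = C * lf A k (Φ x)

theorem IsLog.deriv {Φ : E → ℂ × ℂ} {U : Set E} {L : E → Fin 12 → ℂ} (h : IsLog A Φ U L)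
    (hU : IsOpen U) {x : E} (hx : x ∈ U) (hL : ∀ k, DifferentiableAt ℂ (fun y => L y k) x)
    (hΦ : DifferentiableAt ℂ Φ x) (k : Fin 12) (e : E) :
    DL L x k e = ll A k (fderiv ℂ Φ x e) / lf A k (Φ x) := by
  obtain ⟨C, hC⟩ := h k
  have h1 : HasFDerivAt (fun y => Complex.exp (L y k)) (Complex.exp (L x k) • DL L x k) x :=
    (hL k).hasFDerivAt.cexp
  have h3 : HasFDerivAt (lf A k) (A k 0 • ContinuousLinearMap.fst ℂ ℂ ℂ +
      A k 1 • ContinuousLinearMap.snd ℂ ℂ ℂ) (Φ x) := by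
    unfold lf
    exact ((hasFDerivAt_fst.const_mul _).add (hasFDerivAt_snd.const_mul _)).add_const _
  have h2 := ((h3.comp x hΦ.hasFDerivAt).const_mul C).congr_of_eventuallyEq
    (f₁ := fun y => Complex.exp (L y k)) (by
      filter_upwards [hU.mem_nhds hx] with y hy using hC y hy)
  have h4 := congrArg (fun D => D e) (h1.unique h2)
  have h5 : Complex.exp (L x k) * DL L x k e = C * ll A k (fderiv ℂ Φ x e) := by
    simpa [ll, mul_add] using h4
  have h6 := Complex.exp_ne_zero (L x k)
  rw [hC x hx] at h5 h6
  have h7 : C ≠ 0 := left_ne_zero_of_mul h6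
  have h8 : lf A k (Φ x) ≠ 0 := right_ne_zero_of_mul h6
  rw [eq_div_iff h8]
  apply mul_left_cancel₀ h7
  linear_combination h5

theorem closed_of (hA : TrOK A) {p : ℂ × ℂ} (hp : p ∈ XA A) (T) (e f : ℂ × ℂ) :
    eta T (fun k => ll A k e / lf A k p) (fun k => ll A k f / lf A k p) = 0 := by
  have h := hA T
  simp only [eta, uu, vv]
  have h1 := hp (tr T).1
  have h2 := hp (tr T).2.1
  have h3 := hp (tr T).2.2
  set a := (tr T).1
  set b := (tr T).2.1
  set c := (tr T).2.2
  field_simp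
  have key : (lf A c p * (ll A a e * ll A b f - ll A b e * ll A a f)
      + lf A a p * (ll A b e * ll A c f - ll A c e * ll A b f)
      + lf A b p * (ll A c e * ll A a f - ll A a e * ll A c f)) = 0 := by
    have : (lf A c p * (ll A a e * ll A b f - ll A b e * ll A a f)
      + lf A a p * (ll A b e * ll A c f - ll A c e * ll A b f)
      + lf A b p * (ll A c e * ll A a f - ll A a e * ll A c f))
      = (e.1 * f.2 - e.2 * f.1) * det3 (A a) (A b) (A c) := by
      simp only [lf, ll, det3]; ring
    rw [this, h, mul_zero]
  linear_combination (lf A c p) * key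

theorem IsLog.sub_const {Φ : E → ℂ × ℂ} {U : Set E} {L L' : E → Fin 12 → ℂ} (h : IsLog A Φ U L)
    (h' : IsLog A Φ U L') (hU : IsOpen U) (hUc : Convex ℝ U)
    (hL : ∀ x ∈ U, ∀ k, DifferentiableAt ℂ (fun y => L y k) x)
    (hL' : ∀ x ∈ U, ∀ k, DifferentiableAt ℂ (fun y => L' y k) x)
    (hΦ : ∀ x ∈ U, DifferentiableAt ℂ Φ x) :
    ∀ x ∈ U, ∀ y ∈ U, L x - L' x = L y - L' y := by
  intro x hx y hy
  funext k
  refine const_of_hasFDerivAt (f := fun x => L x k) (g := fun x => L' x k) hUc ?_ hx hy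
  intro z hz
  have : DL L z k = DL L' z k := by
    ext e
    rw [h.deriv hU hz (hL z hz) (hΦ z hz), h'.deriv hU hz (hL' z hz) (hΦ z hz)]
  exact ⟨DL L z k, (hL z hz k).hasFDerivAt, this ▸ (hL' z hz k).hasFDerivAt⟩

theorem sec_of_log (hA : TrOK A) {Φ : E → ℂ × ℂ} {U : Set E} {L : E → Fin 12 → ℂ}
    (h : IsLog A Φ U L) (hU : IsOpen U) (hUc : Convex ℝ U)
    (hL : ∀ k, ContDiffOn ℂ 2 (fun y => L y k) U)
    (hΦ : ∀ x ∈ U, DifferentiableAt ℂ Φ x) (hm : MapsTo Φ U (XA A)) :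
    ∃ g : E → Uni, IsSec g U ∧ ∀ x, (g x).L = L x := by
  refine exists_sec hUc hU hL fun x hx T e f => ?_
  have hd : ∀ k, DifferentiableAt ℂ (fun y => L y k) x := fun k =>
    ((hL k).contDiffAt (hU.mem_nhds hx)).differentiableAt (by norm_num)
  have := h.deriv hU hx hd (hΦ x hx)
  simp only [this]
  exact closed_of hA (hm hx) T _ _
end

theorem ball_sec (hA : TrOK A) (z : XA A) : ∃ r > 0, Metric.ball z.1 r ⊆ XA A ∧
    ∃ g : ℂ × ℂ → Uni, IsSec g (Metric.ball z.1 r) ∧ IsLog A id (Metric.ball z.1 r) (fun x => (g x).L)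
      ∧ g z.1 = 1 := by
  have h1 : ∀ k, ∀ᶠ p in 𝓝 z.1, lf A k p / lf A k z.1 ∈ Complex.slitPlane := by
    intro k
    have hc : ContinuousAt (fun p => lf A k p / lf A k z.1) z.1 :=
      ((lf_cont A k).div_const _).continuousAt
    refine hc.eventually (Complex.isOpen_slitPlane.mem_nhds ?_)
    simp only [div_self (z.2 k)]
    exact Complex.one_mem_slitPlane
  obtain ⟨r, hr, hb⟩ := Metric.eventually_nhds_iff_ball.1 (Filter.eventually_all.2 h1)
  have hsub : Metric.ball z.1 r ⊆ XA A := by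
    intro p hp k h0
    have := hb p hp k
    rw [h0, zero_div] at this
    exact Complex.slitPlane_ne_zero this rfl
  have hlog : IsLog A id (Metric.ball z.1 r) (fun p k => Complex.log (lf A k p / lf A k z.1)) := by
    intro k
    refine ⟨(lf A k z.1)⁻¹, fun x hx => ?_⟩
    rw [Complex.exp_log (div_ne_zero (hsub hx k) (z.2 k)), div_eq_inv_mul]; rfl
  obtain ⟨g, hg, hgL⟩ := sec_of_log hA hlog Metric.isOpen_ball (convex_ball _ _)
    (fun k x hx => ((Complex.contDiffAt_log (hb x hx k)).comp x
      ((lf_cd A k).div_const _).contDiffAt).contDiffWithinAt)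
    (fun x _ => differentiableAt_id) hsub
  refine ⟨r, hr, hsub, fun x => (g z.1)⁻¹ * g x, hg.mul_left _, ?_, by simp⟩
  intro k
  obtain ⟨C, hC⟩ := hlog k
  refine ⟨Complex.exp (-(g z.1).L k) * C, fun x hx => ?_⟩
  have := hC x hx
  simp only at this
  simp only [Uni.mul_L, Uni.inv_L, Pi.add_apply, Pi.neg_apply, Complex.exp_add, hgL x, this, mul_assoc]

theorem hol_exists (hA : TrOK A) : ∃ F : PF (XA A) Uni, ∀ z : XA A, ∃ r > 0,
    ∃ g : ℂ × ℂ → Uni, IsSec g (Metric.ball z.1 r) ∧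
      IsLog A id (Metric.ball z.1 r) (fun x => (g x).L) ∧
      ∀ a b (γ : Path a b), (∀ t, (γ t).1 ∈ Metric.ball z.1 r) → F.val γ = (g a.1)⁻¹ * g b.1 := by
  choose r hr hsub g hg hlog h1 using ball_sec hA
  have cst : ∀ i j : XA A, ∀ x ∈ Metric.ball i.1 (r i) ∩ Metric.ball j.1 (r j),
      ∀ y ∈ Metric.ball i.1 (r i) ∩ Metric.ball j.1 (r j),
      g i x * (g j x)⁻¹ = g i y * (g j y)⁻¹ := by
    intro i j x hx y hy
    have hi := (hg i).mono (inter_subset_left (t := Metric.ball j.1 (r j)))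
    have hj := (hg j).mono (inter_subset_right (s := Metric.ball i.1 (r i)))
    have hc := (convex_ball i.1 (r i)).inter (convex_ball j.1 (r j))
    have ho := (Metric.isOpen_ball (x := i.1) (ε := r i)).inter
      (Metric.isOpen_ball (x := j.1) (ε := r j))
    have hli : IsLog A id (Metric.ball i.1 (r i) ∩ Metric.ball j.1 (r j)) (fun x => (g i x).L) :=
      fun k => (hlog i k).imp fun C h x hx => h x hx.1
    have hlj : IsLog A id (Metric.ball i.1 (r i) ∩ Metric.ball j.1 (r j)) (fun x => (g j x).L) :=
      fun k => (hlog j k).imp fun C h x hx => h x hx.2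
    have := hi.unique hj hc ho (hli.sub_const hlj ho hc hi.L hj.L
      (fun x _ => differentiableAt_id)) hx hy
    have h3 : g i y = g i x * ((g j x)⁻¹ * g j y) := by rw [← this]; group
    rw [h3]; group
  classical
  let B : XA A → Set (XA A) := fun z => {x | x.1 ∈ Metric.ball z.1 (r z)}
  let h : XA A → XA A → Uni := fun i j =>
    if hx : ∃ x : ℂ × ℂ, x ∈ Metric.ball i.1 (r i) ∩ Metric.ball j.1 (r j) then
      g i hx.choose * (g j hx.choose)⁻¹ else 1
  have hh : ∀ i j x, x ∈ Metric.ball i.1 (r i) ∩ Metric.ball j.1 (r j) →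
      h i j = g i x * (g j x)⁻¹ := by
    intro i j x hx
    have he : ∃ x : ℂ × ℂ, x ∈ Metric.ball i.1 (r i) ∩ Metric.ball j.1 (r j) := ⟨x, hx⟩
    simp only [h, he, dite_true]
    exact cst i j _ he.choose_spec _ hx
  obtain ⟨F, hF⟩ := cech B (fun y => Metric.isOpen_ball.preimage continuous_subtype_val)
    (fun y => Metric.mem_ball_self (hr y)) h (by
      intro i j k y hi hj hk
      rw [hh i j y.1 ⟨hi, hj⟩, hh j k y.1 ⟨hj, hk⟩, hh i k y.1 ⟨hi, hk⟩]
      group)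
  refine ⟨F, fun z => ⟨r z, hr z, g z, hg z, hlog z, ?_⟩⟩
  intro a b γ hγ
  rw [hF z a b γ (by rintro _ ⟨t, rfl⟩; exact hγ t)]
  have ha := hγ 0
  have hb := hγ 1
  rw [γ.source] at ha
  rw [γ.target] at hb
  rw [hh a z a.1 ⟨Metric.mem_ball_self (hr a), ha⟩, hh z b b.1 ⟨hb, Metric.mem_ball_self (hr b)⟩,
    h1, h1]
  simp

def Hol (hA : TrOK A) : PF (XA A) Uni := (hol_exists hA).choose

theorem hol_eval (hA : TrOK A) {E : Type*} [NormedAddCommGroup E] [NormedSpace ℂ E]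
    {Φ : E → ℂ × ℂ} {U : Set E} {G : E → Uni} (hU : IsOpen U)
    (hΦ : ∀ x ∈ U, DifferentiableAt ℂ Φ x) (hG : IsSec G U)
    (hl : IsLog A Φ U (fun x => (G x).L))
    (Φ' : C(U, XA A)) (hΦ' : ∀ x : U, (Φ' x).1 = Φ x.1) {a b : U} (γ : Path a b) :
    (Hol hA).val (γ.map Φ'.continuous) = (G a.1)⁻¹ * G b.1 := by
  refine path_induct (P := fun a b γ => (Hol hA).val (γ.map Φ'.continuous) = (G a.1)⁻¹ * G b.1)
    ?_ ?_ ?_ γ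
  · intro x y γ γ' h h1
    rw [← h1]
    exact (Hol hA).hom _ _ (h.symm.map Φ')
  · intro x y z γ γ' h1 h2
    rw [Path.map_trans, PF.trans, h1, h2]
    group
  · intro y
    obtain ⟨r, hr, g, hg, hlog, hF⟩ := (hol_exists hA).choose_spec (Φ' y)
    have hc : ∀ᶠ x in 𝓝 y.1, x ∈ U ∧ Φ x ∈ Metric.ball (Φ' y).1 r := by
      refine Filter.Eventually.and (hU.mem_nhds y.2) ?_
      refine (hΦ y.1 y.2).continuousAt.eventually (Metric.isOpen_ball.mem_nhds ?_)
      rw [← hΦ']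
      exact Metric.mem_ball_self hr
    obtain ⟨ε, hε, hb⟩ := Metric.eventually_nhds_iff_ball.1 hc
    refine ⟨{x | x.1 ∈ Metric.ball y.1 ε}, ?_, ?_⟩
    · exact (Metric.isOpen_ball.preimage continuous_subtype_val).mem_nhds
        (Metric.mem_ball_self hε)
    intro a b γ hγ
    have hγ' : ∀ t, (γ t).1 ∈ Metric.ball y.1 ε := fun t => hγ ⟨t, rfl⟩
    have e1 : (Hol hA).val (γ.map Φ'.continuous) = (g (Φ' a).1)⁻¹ * g (Φ' b).1 := by
      refine hF _ _ _ fun t => ?_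
      have := hΦ' (γ t)
      simp only [Path.map_coe, Function.comp_apply]
      rw [this]
      exact (hb _ (hγ' t)).2
    rw [e1, hΦ', hΦ']
    have hs : IsSec (g ∘ Φ) (Metric.ball y.1 ε) := hg.comp (fun x hx => hΦ x (hb x hx).1)
      (fun x hx => (hb x hx).2)
    have hG' := hG.mono (fun x hx => (hb x hx).1 : Metric.ball y.1 ε ⊆ U)
    have hl1 : IsLog A Φ (Metric.ball y.1 ε) (fun x => ((g ∘ Φ) x).L) :=
      fun k => (hlog k).imp fun C h x hx => h _ (hb x hx).2
    have hl2 : IsLog A Φ (Metric.ball y.1 ε) (fun x => (G x).L) :=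
      fun k => (hl k).imp fun C h x hx => h _ (hb x hx).1
    have ha := hγ' 0
    have hb' := hγ' 1
    rw [γ.source] at ha
    rw [γ.target] at hb'
    exact hs.unique hG' (convex_ball _ _) Metric.isOpen_ball
      (hl1.sub_const hl2 Metric.isOpen_ball (convex_ball _ _) hs.L hG'.L
        (fun x hx => hΦ x (hb x hx).1)) ha hb'

end

noncomputable section
open Set Topology unitInterval

variable {A : Fin 12 → Fin 3 → ℂ}

theorem L_local (hA : TrOK A) (z : XA A) : ∃ N ∈ 𝓝 z, ∀ a b (γ : Path a b), range γ ⊆ N → ∀ k,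
    lf A k b.1 / lf A k a.1 ∈ Complex.slitPlane ∧
    ((Hol hA).val γ).L k = Complex.log (lf A k b.1 / lf A k a.1) := by
  obtain ⟨r, hr, g, hg, hlog, hF⟩ := (hol_exists hA).choose_spec z
  have hcont : ∀ k, ContinuousAt (fun x => (g x).L k) z.1 := fun k =>
    (hg.L z.1 (Metric.mem_ball_self hr) k).continuousAt
  have h1 : ∀ᶠ x in 𝓝 z.1, x ∈ Metric.ball z.1 r ∧ ∀ k, dist ((g x).L k) ((g z.1).L k) < 1/2 :=
    Filter.Eventually.and (Metric.isOpen_ball.mem_nhds (Metric.mem_ball_self hr))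
      (Filter.eventually_all.2 fun k => (hcont k).eventually (Metric.ball_mem_nhds _ (by norm_num)))
  refine ⟨{x | x.1 ∈ Metric.ball z.1 r ∧ ∀ k, dist ((g x.1).L k) ((g z.1).L k) < 1/2},
    continuousAt_subtype_val.eventually h1, ?_⟩
  intro a b γ hγ k
  have ha := hγ ⟨0, rfl⟩
  have hb := hγ ⟨1, rfl⟩
  rw [γ.source] at ha
  rw [γ.target] at hb
  have e : (Hol hA).val γ = (g a.1)⁻¹ * g b.1 := hF _ _ _ fun t => (hγ ⟨t, rfl⟩).1
  obtain ⟨C, hC⟩ := hlog k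
  have e1 : Complex.exp ((g b.1).L k - (g a.1).L k) = lf A k b.1 / lf A k a.1 := by
    have ca := hC a.1 ha.1
    have cb := hC b.1 hb.1
    have hn : C ≠ 0 := by
      rintro rfl
      simp only [zero_mul] at ca
      exact Complex.exp_ne_zero _ ca
    simp only [id] at ca cb
    rw [Complex.exp_sub, ca, cb, mul_div_mul_left _ _ hn]
  have hd : ‖(g b.1).L k - (g a.1).L k‖ < 1 := by
    have h2 := ha.2 k
    have h3 := hb.2 k
    have h4 := dist_triangle_right ((g b.1).L k) ((g a.1).L k) ((g z.1).L k)
    rw [← dist_eq_norm]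
    linarith
  have him := (Complex.abs_im_le_norm ((g b.1).L k - (g a.1).L k)).trans_lt hd
  rw [abs_lt] at him
  have hpi := Real.pi_gt_three
  have e2 : Complex.log (lf A k b.1 / lf A k a.1) = (g b.1).L k - (g a.1).L k := by
    rw [← e1, Complex.log_exp (by linarith) (by linarith)]
  refine ⟨?_, ?_⟩
  · rw [Complex.mem_slitPlane_iff_arg]
    refine ⟨?_, div_ne_zero (b.2 k) (a.2 k)⟩
    rw [← Complex.log_im, e2]
    intro h
    linarith
  · rw [e2, e, Uni.mul_L, Uni.inv_L]
    simp only [Pi.add_apply, Pi.neg_apply]; ring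

theorem L_eval (hA : TrOK A) {Y : Type*} [TopologicalSpace Y] (Φ : C(Y, XA A)) (k : Fin 12)
    (lam : Y → ℂ) (hl : Continuous lam) (C : ℂ)
    (h : ∀ y, Complex.exp (lam y) = C * lf A k (Φ y).1) {a b : Y} (γ : Path a b) :
    ((Hol hA).val (γ.map Φ.continuous)).L k = lam b - lam a := by
  refine path_induct (P := fun a b γ => ((Hol hA).val (γ.map Φ.continuous)).L k = lam b - lam a)
    ?_ ?_ ?_ γ
  · intro x y γ γ' hh h1
    rw [← h1]
    exact congrArg (fun g : Uni => g.L k) ((Hol hA).hom _ _ (hh.symm.map Φ))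
  · intro x y z γ γ' h1 h2
    rw [Path.map_trans, PF.trans, Uni.mul_L, Pi.add_apply, h1, h2]
    ring
  · intro y
    obtain ⟨N, hN, hl1⟩ := L_local hA (Φ y)
    have e1 : ∀ᶠ x in 𝓝 y, Φ x ∈ N ∧ dist (lam x) (lam y) < 1/2 :=
      (Φ.continuous.continuousAt.eventually hN).and
        (hl.continuousAt.eventually (Metric.ball_mem_nhds _ (by norm_num)))
    refine ⟨_, e1, fun a b γ hγ => ?_⟩
    have ha := hγ ⟨0, rfl⟩
    have hb := hγ ⟨1, rfl⟩
    rw [γ.source] at ha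
    rw [γ.target] at hb
    rw [(hl1 _ _ (γ.map Φ.continuous) (by rintro _ ⟨t, rfl⟩; exact (hγ ⟨t, rfl⟩).1) k).2]
    have ca := h a
    have cb := h b
    have hn : C ≠ 0 := by
      rintro rfl
      simp only [zero_mul] at ca
      exact Complex.exp_ne_zero _ ca
    have e2 : lf A k (Φ b).1 / lf A k (Φ a).1 = Complex.exp (lam b - lam a) := by
      rw [Complex.exp_sub, ca, cb, mul_div_mul_left _ _ hn]
    have hd : ‖lam b - lam a‖ < 1 := by
      have h2 := ha.2
      have h3 := hb.2
      have h4 := dist_triangle_right (lam b) (lam a) (lam y)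
      rw [← dist_eq_norm]
      linarith
    have him := (Complex.abs_im_le_norm (lam b - lam a)).trans_lt hd
    rw [abs_lt] at him
    have hpi := Real.pi_gt_three
    rw [e2, Complex.log_exp (by linarith) (by linarith)]

theorem exp_L (hA : TrOK A) {a b : XA A} (γ : Path a b) (k) :
    Complex.exp (((Hol hA).val γ).L k) = lf A k b.1 / lf A k a.1 := by
  refine path_induct (P := fun a b γ => Complex.exp (((Hol hA).val γ).L k) = lf A k b.1 / lf A k a.1)
    ?_ ?_ ?_ γ
  · intro x y γ γ' hh h1
    rw [← h1, (Hol hA).hom _ _ hh]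
  · intro x y z γ γ' h1 h2
    have hx := x.2 k
    have hy := y.2 k
    rw [PF.trans, Uni.mul_L, Pi.add_apply, Complex.exp_add, h1, h2]
    field_simp
  · intro z
    obtain ⟨N, hN, hl1⟩ := L_local hA z
    refine ⟨N, hN, fun a b γ hγ => ?_⟩
    rw [(hl1 a b γ hγ k).2, Complex.exp_log (div_ne_zero (b.2 k) (a.2 k))]

/-- conjugate arrangement -/
def cjA (A : Fin 12 → Fin 3 → ℂ) : Fin 12 → Fin 3 → ℂ := fun k i => star (A k i)

theorem lf_cj (A : Fin 12 → Fin 3 → ℂ) (k p) : lf (cjA A) k (star p) = star (lf A k p) := by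
  simp [lf, cjA]

def cjX (A : Fin 12 → Fin 3 → ℂ) : C(XA A, XA (cjA A)) where
  toFun p := ⟨star p.1, fun k => by rw [lf_cj]; exact star_ne_zero.2 (p.2 k)⟩
  continuous_toFun := by fun_prop

theorem L_conj (hA : TrOK A) (hA' : TrOK (cjA A)) {a b : XA A} (γ : Path a b) (k) :
    ((Hol hA').val (γ.map (cjX A).continuous)).L k = star (((Hol hA).val γ).L k) := by
  refine path_induct (P := fun a b γ => ((Hol hA').val (γ.map (cjX A).continuous)).L k =
    star (((Hol hA).val γ).L k)) ?_ ?_ ?_ γ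
  · intro x y γ γ' hh h1
    rw [← (Hol hA).hom _ _ hh, ← h1]
    exact congrArg (fun g : Uni => g.L k) ((Hol hA').hom _ _ (hh.symm.map (cjX A)))
  · intro x y z γ γ' h1 h2
    rw [Path.map_trans, PF.trans, PF.trans, Uni.mul_L, Uni.mul_L, Pi.add_apply, Pi.add_apply, h1, h2,
      star_add]
  · intro z
    obtain ⟨N, hN, hl1⟩ := L_local hA z
    obtain ⟨N', hN', hl2⟩ := L_local hA' (cjX A z)
    refine ⟨N ∩ (cjX A) ⁻¹' N', Filter.inter_mem hN ((cjX A).continuous.continuousAt hN'),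
      fun a b γ hγ => ?_⟩
    have h1 := hl1 a b γ (hγ.trans inter_subset_left) k
    have h2 := hl2 _ _ (γ.map (cjX A).continuous)
      (by rintro _ ⟨t, rfl⟩; exact (hγ ⟨t, rfl⟩).2) k
    rw [h1.2, h2.2]
    change Complex.log (lf (cjA A) k (star b.1) / lf (cjA A) k (star a.1)) = _
    rw [lf_cj, lf_cj, ← star_div₀]
    exact Complex.log_conj _ (Complex.mem_slitPlane_iff_arg.1 h1.1).1

end

noncomputable section
open Set Topology unitInterval

theorem PF.extend {X Y G : Type*} [TopologicalSpace X] [TopologicalSpace Y] [Group G]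
    (ι : C(Y, X)) (hd : DenseRange ι) (H : PF Y G) (B : X → Set X) (hB : ∀ x, IsOpen (B x))
    (hx : ∀ x, x ∈ B x)
    (conn : ∀ i j a b, ι a ∈ B i ∩ B j → ι b ∈ B i ∩ B j → ∃ γ : Path a b, ∀ t, ι (γ t) ∈ B i ∩ B j)
    (triv : ∀ i a (γ : Path a a), (∀ t, ι (γ t) ∈ B i) → H.val γ = 1) :
    ∃ F : PF X G, ∃ s : Y → G, ∀ a b (γ : Path a b),
      s a * H.val γ = F.val (γ.map ι.continuous) * s b := by
  classical
  have ex : ∀ i, ∃ b : Y, ι b ∈ B i := fun i => by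
    obtain ⟨b, hb⟩ := hd.exists_mem_open (hB i) ⟨i, hx i⟩
    exact ⟨b, hb⟩
  choose b hb using ex
  have conn1 : ∀ i a, ι a ∈ B i → ∃ γ : Path (b i) a, ∀ t, ι (γ t) ∈ B i := by
    intro i a ha
    obtain ⟨γ, h⟩ := conn i i (b i) a ⟨hb i, hb i⟩ ⟨ha, ha⟩
    exact ⟨γ, fun t => (h t).1⟩
  let u : X → Y → G := fun i a => if h : ι a ∈ B i then H.val (conn1 i a h).choose else 1
  have hu : ∀ i a c (γ : Path a c), (∀ t, ι (γ t) ∈ B i) → u i a * H.val γ = u i c := by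
    intro i a c γ hγ
    have ha : ι a ∈ B i := by simpa using hγ 0
    have hc : ι c ∈ B i := by simpa using hγ 1
    simp only [u, ha, hc, dite_true]
    have h1 := (conn1 i a ha).choose_spec
    have h2 := (conn1 i c hc).choose_spec
    have := triv i (b i) (((conn1 i a ha).choose.trans γ).trans (conn1 i c hc).choose.symm) (by
      intro t
      have hr : ((((conn1 i a ha).choose.trans γ).trans (conn1 i c hc).choose.symm) t) ∈
        range ((((conn1 i a ha).choose.trans γ).trans (conn1 i c hc).choose.symm)) := ⟨t, rfl⟩
      rw [Path.trans_range, Path.trans_range, Path.symm_range] at hr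
      rcases hr with (⟨s, hs⟩ | ⟨s, hs⟩) | ⟨s, hs⟩
      · rw [← hs]; exact h1 s
      · rw [← hs]; exact hγ s
      · rw [← hs]; exact h2 s)
    rw [PF.trans, PF.trans, PF.symm] at this
    exact mul_inv_eq_one.1 this
  let h : X → X → G := fun i j =>
    if hx : ∃ a : Y, ι a ∈ B i ∩ B j then u i hx.choose * (u j hx.choose)⁻¹ else 1
  have hh : ∀ i j a, ι a ∈ B i ∩ B j → h i j = u i a * (u j a)⁻¹ := by
    intro i j a ha
    have he : ∃ a : Y, ι a ∈ B i ∩ B j := ⟨a, ha⟩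
    simp only [h, he, dite_true]
    obtain ⟨γ, hγ⟩ := conn i j _ _ ha he.choose_spec
    rw [← hu i _ _ γ fun t => (hγ t).1, ← hu j _ _ γ fun t => (hγ t).2]
    group
  obtain ⟨F, hF⟩ := cech B hB hx h (by
    intro i j k y hi hj hk
    obtain ⟨a, ha⟩ := hd.exists_mem_open (((hB i).inter (hB j)).inter (hB k)) ⟨y, ⟨hi, hj⟩, hk⟩
    rw [hh i j a ha.1, hh j k a ⟨ha.1.2, ha.2⟩, hh i k a ⟨ha.1.1, ha.2⟩]
    group)
  refine ⟨F, fun a => u (ι a) a, fun a c γ => ?_⟩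
  refine PF.ext_local H (F.comap ι) (fun a => u (ι a) a) ?_ γ
  intro y
  refine ⟨ι ⁻¹' (B (ι y)), ((hB _).preimage ι.continuous).mem_nhds (hx _), ?_⟩
  intro a c γ hγ
  have hγ' : ∀ t, ι (γ t) ∈ B (ι y) := fun t => hγ ⟨t, rfl⟩
  have ha : ι a ∈ B (ι y) := by simpa using hγ' 0
  have hc : ι c ∈ B (ι y) := by simpa using hγ' 1
  have e : (F.comap ι).val γ = h (ι a) (ι y) * h (ι y) (ι c) := hF _ _ _ _ (by
    rintro _ ⟨t, rfl⟩; exact hγ' t)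
  rw [e, hh _ _ a ⟨hx _, ha⟩, hh _ _ c ⟨hc, hx _⟩, ← hu _ _ _ γ hγ']
  group

end

noncomputable section
open Set Topology unitInterval

theorem convex_minus_joined {C : Set ℂ} (hC : Convex ℝ C) (ho : IsOpen C) {a b c : ℂ} (ha : a ∈ C)
    (hb : b ∈ C) (hac : a ≠ c) (hbc : b ≠ c) : JoinedIn (C \ {c}) a b := by
  by_cases h : c ∈ segment ℝ a b
  · have hcC : c ∈ C := hC.segment_subset ha hb h
    have h1 : Filter.Tendsto (fun ε : ℝ => c + ε * (Complex.I * (b - a))) (𝓝[>] 0) (𝓝 c) := by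
      have : Filter.Tendsto (fun ε : ℝ => c + ε * (Complex.I * (b - a))) (𝓝 0)
          (𝓝 (c + (0:ℝ) * (Complex.I * (b - a)))) :=
        Continuous.tendsto (by fun_prop) 0
      simp only [Complex.ofReal_zero, zero_mul, add_zero] at this
      exact this.mono_left nhdsWithin_le_nhds
    obtain ⟨ε, hm, hε⟩ := ((h1.eventually (ho.mem_nhds hcC)).and self_mem_nhdsWithin).exists
    have hε' : (0:ℝ) < ε := hε
    rw [segment_eq_image_lineMap] at h
    obtain ⟨s, _, hs⟩ := h
    have hs' : c = a + s * (b - a) := by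
      rw [← hs, AffineMap.lineMap_apply]; simp; ring
    have hab : b - a ≠ 0 := by
      intro h0
      rw [h0, mul_zero, add_zero] at hs'
      exact hac hs'.symm
    have key : ∀ d : ℂ, d ∈ C → d ≠ c → (∃ q : ℝ, d = c + q * (b - a)) →
        JoinedIn (C \ {c}) d (c + ε * (Complex.I * (b - a))) := by
      rintro d hd hdc ⟨q, hq⟩
      apply JoinedIn.of_segment_subset
      intro x hx
      refine ⟨hC.segment_subset hd hm hx, ?_⟩
      rw [segment_eq_image_lineMap] at hx
      obtain ⟨t, _, ht⟩ := hx
      rintro rfl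
      rw [AffineMap.lineMap_apply] at ht
      simp only [vsub_eq_sub, Complex.real_smul, vadd_eq_add] at ht
      rw [hq] at ht
      have h2 : ((q * (1 - t) : ℝ) + (t * ε : ℝ) * Complex.I : ℂ) * (b - a) = 0 := by
        push_cast; linear_combination ht
      have h3 := (mul_eq_zero.1 h2).resolve_right hab
      have h4 := congrArg Complex.im h3
      have h5 := congrArg Complex.re h3
      simp only [Complex.add_im, Complex.ofReal_im, Complex.mul_im, Complex.ofReal_re, Complex.I_im,
        Complex.I_re, Complex.add_re, Complex.mul_re, Complex.zero_im, Complex.zero_re] at h4 h5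
      have ht0 : t = 0 := by
        have : t * ε = 0 := by linarith
        exact (mul_eq_zero.1 this).resolve_right hε'.ne'
      rw [ht0] at h5
      have : q = 0 := by linarith
      rw [this] at hq
      apply hdc
      rw [hq]; simp
    have ka := key a ha hac ⟨-s, by rw [hs']; push_cast; ring⟩
    have kb := key b hb hbc ⟨1 - s, by rw [hs']; push_cast; ring⟩
    exact ka.trans kb.symm
  · apply JoinedIn.of_segment_subset
    intro x hx
    exact ⟨hC.segment_subset ha hb hx, fun h2 => h (h2 ▸ hx)⟩

section
variable (e : (ℂ × ℂ) ≃L[ℂ] (ℂ × ℂ)) (c : ℂ)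

def box (y : ℂ × ℂ) (r : ℝ) : Set (ℂ × ℂ) := {x | e x ∈ Metric.ball (e y) r}

theorem mem_box {x y : ℂ × ℂ} {r : ℝ} : x ∈ box e y r ↔
    ‖(e x).1 - (e y).1‖ < r ∧ ‖(e x).2 - (e y).2‖ < r := by
  simp only [box, mem_ofPred_eq, Metric.mem_ball, dist_eq_norm, Prod.norm_def, max_lt_iff,
    Prod.fst_sub, Prod.snd_sub]

theorem isOpen_box (y r) : IsOpen (box e y r) := Metric.isOpen_ball.preimage e.continuous

theorem box_self (y) {r : ℝ} (hr : 0 < r) : y ∈ box e y r := Metric.mem_ball_self hr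

theorem box_sub {U : Set (ℂ × ℂ)} (hU : IsOpen U) {y} (hy : y ∈ U) : ∃ r > 0, box e y r ⊆ U := by
  have : e.symm ⁻¹' U ∈ 𝓝 (e y) := (hU.preimage e.symm.continuous).mem_nhds (by simpa using hy)
  obtain ⟨r, hr, h⟩ := Metric.mem_nhds_iff.1 this
  exact ⟨r, hr, fun x hx => by simpa using h hx⟩

theorem convex_box (y r) : Convex ℝ (box e y r) :=
  (convex_ball (e y) r).is_linear_preimage
    ⟨fun x y => map_add e x y, fun a x => by
      exact (e.toContinuousLinearMap.restrictScalars ℝ).map_smul a x⟩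

def chat (r : ℝ) : Set (ℂ × ℂ) := {q | Real.exp q.1.re < r ∧ ‖q.2‖ < r}

theorem convex_chat {r : ℝ} (hr : 0 < r) : Convex ℝ (chat r) := by
  have : chat r = (fun q : ℂ × ℂ => q.1.re) ⁻¹' (Iio (Real.log r)) ∩
      (fun q : ℂ × ℂ => q.2) ⁻¹' (Metric.ball 0 r) := by
    ext q
    simp [chat, Real.lt_log_iff_exp_lt hr]
  rw [this]
  refine Convex.inter ((convex_Iio _).is_linear_preimage ⟨?_, ?_⟩)
    ((convex_ball _ _).is_linear_preimage ⟨?_, ?_⟩) <;> intros <;> simp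

variable {V W : Set (ℂ × ℂ)} (hW : ∀ x, x ∈ W ↔ x ∈ V ∧ (e x).1 ≠ c)

def PsiW (y : ℂ × ℂ) (hy : (e y).1 = c) (r : ℝ) (hb : box e y r ⊆ V) : C(chat r, W) where
  toFun q := ⟨e.symm (c + Complex.exp q.1.1, (e y).2 + q.1.2), (hW _).2 ⟨hb ((mem_box e).2 (by
    have := q.2
    simp only [chat, mem_ofPred_eq] at this
    simp [hy, Complex.norm_exp, this.1, this.2])), by simp⟩⟩
  continuous_toFun := by fun_prop

def tau (r : ℝ) : C(chat r, chat r) where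
  toFun q := ⟨(q.1.1 + 2 * Real.pi * Complex.I, q.1.2), by
    have := q.2
    simp only [chat, mem_ofPred_eq] at this
    simp [chat, this]⟩
  continuous_toFun := by fun_prop

theorem PsiW_tau (y : ℂ × ℂ) (hy : (e y).1 = c) (r : ℝ) (hb : box e y r ⊆ V) :
    (PsiW e c hW y hy r hb).comp (tau r) = PsiW e c hW y hy r hb := by
  ext q <;> simp [PsiW, tau, Complex.exp_add, Complex.exp_two_pi_mul_I]

variable {G : Type*} [CommGroup G] (H : PF W G)

def Good (y : ℂ × ℂ) (r : ℝ) : Prop := 0 < r ∧ box e y r ⊆ V ∧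
  ∀ a (γ : Path a a), (∀ t, (γ t).1 ∈ box e y r) → H.val γ = 1

theorem good_of {y : ℂ × ℂ} (hy : (e y).1 = c) {r : ℝ} (hr : 0 < r) (hb : box e y r ⊆ V)
    (p : chat r) (γ₀ : Path p (tau r p)) (h0 : H.val (γ₀.map (PsiW e c hW y hy r hb).continuous) = 1) :
    Good e (V := V) H y r := by
  refine ⟨hr, hb, ?_⟩
  have : ContractibleSpace (chat r) := (convex_chat hr).contractibleSpace ⟨p.1, p.2⟩
  let K : PF (chat r) G := H.comap (PsiW e c hW y hy r hb)
  have Kf : ∀ a b (γ γ' : Path a b), K.val γ = K.val γ' := fun a b γ γ' =>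
    K.hom _ _ (SimplyConnectedSpace.paths_homotopic _ _)
  have Kt : ∀ a b (γ : Path a b), K.val (γ.map (tau r).continuous) = K.val γ := by
    intro a b γ
    have := congrArg (fun f => (H.comap f).val γ) (PsiW_tau e c hW y hy r hb)
    exact this
  let D : chat r → chat r → G := fun a b => K.val (PathConnectedSpace.somePath a b)
  have hD : ∀ a b (γ : Path a b), K.val γ = D a b := fun a b γ => Kf _ _ _ _
  have Dt : ∀ a b d, D a b * D b d = D a d := fun a b d => by
    rw [← hD a d ((PathConnectedSpace.somePath a b).trans (PathConnectedSpace.somePath b d)),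
      PF.trans]
  have Dtau : ∀ a b, D (tau r a) (tau r b) = D a b := fun a b => by
    rw [← hD a b (PathConnectedSpace.somePath a b), ← Kt, hD]
  have m1 : ∀ q, D q (tau r q) = 1 := by
    intro q
    have h1 : D p (tau r p) = 1 := by rw [← hD _ _ γ₀]; exact h0
    have h2 := Dt p (tau r p) (tau r q)
    have h3 := Dt p q (tau r q)
    rw [Dtau, h1, one_mul] at h2
    rw [← h2] at h3
    simpa using h3
  have mn : ∀ (n : ℕ) q, D q ((tau r)^[n] q) = 1 := by
    intro n
    induction n with
    | zero =>
      intro q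
      simp only [Function.iterate_zero, id]
      rw [← hD _ _ (Path.refl q), PF.refl]
    | succ n ih =>
      intro q
      rw [Function.iterate_succ_apply, ← Dt q (tau r q), m1, ih, one_mul]
  have mz : ∀ q q' : chat r, (∃ n : ℕ, q'.1.1 = q.1.1 + n * (2 * Real.pi * Complex.I)) →
      q'.1.2 = q.1.2 → D q q' = 1 := by
    rintro q q' ⟨n, hn⟩ h2
    have : q' = (tau r)^[n] q := by
      have : ∀ n : ℕ, ((tau r)^[n] q).1 = (q.1.1 + n * (2 * Real.pi * Complex.I), q.1.2) := by
        intro n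
        induction n with
        | zero => simp
        | succ n ih =>
          rw [Function.iterate_succ_apply']
          simp only [tau, ContinuousMap.coe_mk] at ih ⊢
          rw [ih]
          push_cast
          ext <;> simp; ring
      apply Subtype.ext
      rw [this n]
      ext <;> simp [hn, h2]
    rw [this, mn]
  intro a γ hγ
  have hne : ∀ t, (e (γ t).1).1 - c ≠ 0 := fun t => sub_ne_zero.2 ((hW _).1 (γ t).2).2
  let γ1 : C(I, {z : ℂ // z ≠ 0}) := ⟨fun t => ⟨(e (γ t).1).1 - c, hne t⟩, by fun_prop⟩
  have h00 : γ1 0 = ⟨_, Complex.exp_ne_zero (Complex.log ((e (γ 0).1).1 - c))⟩ := by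
    apply Subtype.ext
    exact (Complex.exp_log (hne 0)).symm
  let lam := Complex.isCoveringMap_exp.liftPath γ1 _ h00
  have hlam : ∀ t, Complex.exp (lam t) = (e (γ t).1).1 - c := fun t =>
    congrArg Subtype.val (congrFun (Complex.isCoveringMap_exp.liftPath_lifts γ1 _ h00) t)
  have hmem : ∀ t, ((lam t, (e (γ t).1).2 - (e y).2) : ℂ × ℂ) ∈ chat r := by
    intro t
    have := (mem_box e).1 (hγ t)
    rw [hy, ← hlam, Complex.norm_exp] at this
    exact this
  let q0 : chat r := ⟨_, hmem 0⟩
  let q1 : chat r := ⟨_, hmem 1⟩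
  let Γ : Path q0 q1 := ⟨⟨fun t => ⟨_, hmem t⟩, by fun_prop⟩, rfl, rfl⟩
  have hΨ : ∀ t, (PsiW e c hW y hy r hb) (Γ t) = γ t := by
    intro t
    apply Subtype.ext
    simp [PsiW, Γ, hlam]
  have e1 : H.val γ = K.val Γ := by
    have s0 : a = (PsiW e c hW y hy r hb) q0 := by
      have := hΨ 0
      rw [Γ.source, γ.source] at this; exact this.symm
    have s1 : a = (PsiW e c hW y hy r hb) q1 := by
      have := hΨ 1
      rw [Γ.target, γ.target] at this; exact this.symm
    have : γ = (Γ.map (PsiW e c hW y hy r hb).continuous).cast s0 s1 := by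
      ext1
      funext t
      exact (hΨ t).symm
    rw [this, PF.cast]
    rfl
  rw [e1, hD]
  have h2 : q1.1.2 = q0.1.2 := by simp [q0, q1]
  have h3 : Complex.exp (lam 1) = Complex.exp (lam 0) := by
    rw [hlam, hlam, γ.source, γ.target]
  obtain ⟨n, hn⟩ := Complex.exp_eq_exp_iff_exists_int.1 h3
  rcases Int.eq_nat_or_neg n with ⟨k, rfl | rfl⟩
  · exact mz q0 q1 ⟨k, by simpa [q0, q1] using hn⟩ h2
  · have h4 := mz q1 q0 ⟨k, by simp [q0, q1, hn]⟩ h2.symm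
    have h5 := Dt q0 q1 q0
    rw [h4, mul_one] at h5
    rw [h5]
    exact mn 0 q0
end

end

noncomputable section
open Set Topology unitInterval

section
variable (e : (ℂ × ℂ) ≃L[ℂ] (ℂ × ℂ)) (c : ℂ)
variable {V W : Set (ℂ × ℂ)} {G : Type*} [CommGroup G] (H : PF W G)

theorem good_of_loop (hW : ∀ x, x ∈ W ↔ x ∈ V ∧ (e x).1 ≠ c) {y y' : ℂ × ℂ} (hy : (e y).1 = c)
    {r ε : ℝ} (hε : 0 < ε) (hεr : ε < r) (hb : box e y r ⊆ V) (hy' : y' ∈ box e y r) {a : W} (m : Path a a)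
    (hm : ∀ t, (m t).1 = e.symm (c + ε * Complex.exp (2 * Real.pi * Complex.I * t), (e y').2))
    (h1 : H.val m = 1) : Good e (V := V) H y r := by
  have hmem : ∀ t : I, (((Real.log ε : ℝ) + 2 * Real.pi * Complex.I * (t : ℝ), (e y').2 - (e y).2) : ℂ × ℂ)
      ∈ chat r := by
    intro t
    simp only [chat, mem_ofPred_eq]
    refine ⟨?_, ((mem_box e).1 hy').2⟩
    have : ((Real.log ε : ℝ) + 2 * Real.pi * Complex.I * (t : ℝ) : ℂ).re = Real.log ε := by
      simp
    rw [this, Real.exp_log hε]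
    exact hεr
  let γ₀ : Path (⟨_, hmem 0⟩ : chat r) (tau r ⟨_, hmem 0⟩) :=
    ⟨⟨fun t => ⟨_, hmem t⟩, by fun_prop⟩, rfl, by
      apply Subtype.ext
      simp [tau]⟩
  refine good_of e c hW H hy (hε.trans hεr) hb _ γ₀ ?_
  have hΨ : ∀ t, (PsiW e c hW y hy r hb) (γ₀ t) = m t := by
    intro t
    apply Subtype.ext
    rw [hm]
    simp only [PsiW, γ₀]
    simp [Complex.exp_add, ← Complex.ofReal_exp, Real.exp_log hε]
  have s0 := hΨ 0
  have s1 := hΨ 1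
  rw [m.source, γ₀.source] at s0
  rw [m.target, γ₀.target] at s1
  rw [← h1, ← H.cast m s0 s1]
  congr 1
  ext1
  funext t
  exact hΨ t

theorem good_near (hW : ∀ x, x ∈ W ↔ x ∈ V ∧ (e x).1 ≠ c) {y y' : ℂ × ℂ} (hy : (e y).1 = c)
    (hyc : (e y').1 = c)
    {r r' : ℝ} (hr : 0 < r) (hb : box e y r ⊆ V) (hy' : y' ∈ box e y r)
    (hg : Good e (V := V) H y' r') : Good e (V := V) H y r := by
  obtain ⟨hr', hb', ht⟩ := hg
  have hε : 0 < min r r' / 2 := half_pos (lt_min hr hr')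
  have hε2 : min r r' / 2 < min r r' := half_lt_self (lt_min hr hr')
  have hmem' : ∀ t : ℝ, e.symm (c + (min r r' / 2 : ℝ) * Complex.exp (2 * Real.pi * Complex.I * t),
      (e y').2) ∈ box e y' r' := by
    intro t
    rw [mem_box]
    have : ‖Complex.exp (2 * Real.pi * Complex.I * t)‖ = 1 := by
      rw [Complex.norm_exp]; simp
    simp only [ContinuousLinearEquiv.apply_symm_apply, hyc, add_sub_cancel_left, sub_self, norm_zero,
      norm_mul, this, mul_one, Complex.norm_real, Real.norm_eq_abs, abs_of_pos hε]
    exact ⟨hε2.trans_le (min_le_right _ _), hr'⟩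
  have hmem : ∀ t : ℝ, e.symm (c + (min r r' / 2 : ℝ) * Complex.exp (2 * Real.pi * Complex.I * t),
      (e y').2) ∈ W := by
    intro t
    refine (hW _).2 ⟨hb' (hmem' t), ?_⟩
    simp only [ContinuousLinearEquiv.apply_symm_apply, ne_eq, add_eq_left, mul_eq_zero,
      Complex.exp_ne_zero, or_false, Complex.ofReal_eq_zero]
    exact hε.ne'
  let m : Path (⟨_, hmem 0⟩ : W) ⟨_, hmem 0⟩ :=
    ⟨⟨fun t => ⟨_, hmem t⟩, by fun_prop⟩, rfl, by
      apply Subtype.ext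
      simp⟩
  exact good_of_loop e c H hW hy hε (hε2.trans_le (min_le_left _ _)) hb hy' m (fun t => rfl)
    (ht _ m fun t => hmem' t)

theorem good_mono {y y' : ℂ × ℂ} {r r' : ℝ} (hr' : 0 < r') (h : box e y' r' ⊆ box e y r)
    (hg : Good e (V := V) H y r) : Good e (V := V) H y' r' :=
  ⟨hr', h.trans hg.2.1, fun a γ hγ => hg.2.2 a γ fun t => h (hγ t)⟩

theorem good_all (hW : ∀ x, x ∈ W ↔ x ∈ V ∧ (e x).1 ≠ c) (hV : IsOpen V)
    (hZ : IsPreconnected {x | x ∈ V ∧ (e x).1 = c})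
    {y₀ : ℂ × ℂ} {r₀ : ℝ} (hy₀ : (e y₀).1 = c) (h₀ : Good e (V := V) H y₀ r₀) :
    ∀ y ∈ V, (e y).1 = c → ∃ r, Good e (V := V) H y r := by
  let u : Set (ℂ × ℂ) := ⋃ y, ⋃ (_ : (e y).1 = c), ⋃ r, ⋃ (_ : Good e (V := V) H y r), box e y r
  have hu : ∀ x, x ∈ u ↔ ∃ y, (e y).1 = c ∧ ∃ r, Good e (V := V) H y r ∧ x ∈ box e y r := by
    intro x; simp [u]
  have proj : ∀ x ∈ V, (e x).1 = c → ∀ r, 0 < r → box e x r ⊆ V → (box e x r ∩ u).Nonempty →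
      Good e (V := V) H x r := by
    rintro x hx hxc r hr hb ⟨z, hz, hzu⟩
    obtain ⟨y, hyc, r', hg, hzy⟩ := (hu z).1 hzu
    have h1 : e.symm (c, (e z).2) ∈ box e y r' := by
      rw [mem_box] at hzy ⊢
      simp [hyc, hg.1, hzy.2]
    have h2 : e.symm (c, (e z).2) ∈ box e x r := by
      rw [mem_box] at hz ⊢
      simp [hxc, hr, hz.2]
    obtain ⟨r'', hr'', hs⟩ := box_sub e (isOpen_box e y r') h1
    exact good_near e c H hW hxc (by simp) hr hb h2 (good_mono e H hr'' hs hg)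
  have := hZ.subset_of_closure_inter_subset (u := u)
    (isOpen_iUnion fun y => isOpen_iUnion fun _ => isOpen_iUnion fun r => isOpen_iUnion fun _ =>
      isOpen_box e y r)
    ⟨y₀, ⟨h₀.2.1 (box_self e _ h₀.1), hy₀⟩, (hu _).2 ⟨y₀, hy₀, r₀, h₀, box_self e _ h₀.1⟩⟩
    (by
      rintro x ⟨hx, hxV, hxc⟩
      obtain ⟨r, hr, hb⟩ := box_sub e hV hxV
      have hne := mem_closure_iff.1 hx _ (isOpen_box e x r) (box_self e x hr)
      exact (hu x).2 ⟨x, hxc, r, proj x hxV hxc r hr hb hne, box_self e x hr⟩)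
  intro y hy hyc
  obtain ⟨r, hr, hb⟩ := box_sub e hV hy
  exact ⟨r, proj y hy hyc r hr hb ⟨y, box_self e y hr, this ⟨hy, hyc⟩⟩⟩

theorem ext_line (hW : ∀ x, x ∈ W ↔ x ∈ V ∧ (e x).1 ≠ c) (hV : IsOpen V)
    (hZ : IsPreconnected {x | x ∈ V ∧ (e x).1 = c})
    {y₀ : ℂ × ℂ} {r₀ : ℝ} (hy₀ : (e y₀).1 = c) (h₀ : Good e (V := V) H y₀ r₀) :
    ∃ F : PF V G, ∀ (ι : C(W, V)), (∀ x, (ι x).1 = x.1) → ∀ a (γ : Path a a),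
      H.val γ = F.val (γ.map ι.continuous) := by
  have hWV : W ⊆ V := fun x hx => ((hW x).1 hx).1
  let ι : C(W, V) := ⟨Set.inclusion hWV, continuous_inclusion hWV⟩
  have hga := good_all e c H hW hV hZ hy₀ h₀
  have ex : ∀ x : V, ∃ r > 0, box e x.1 r ⊆ V ∧
      ∀ a (γ : Path a a), (∀ t, (γ t).1 ∈ box e x.1 r) → H.val γ = 1 := by
    intro x
    by_cases hx : (e x.1).1 = c
    · exact hga x.1 x.2 hx
    · have hWo : IsOpen (V ∩ {z | (e z).1 ≠ c}) :=
        hV.inter (isOpen_ne.preimage (f := fun z => (e z).1) (by fun_prop))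
      obtain ⟨r, hr, hb⟩ := box_sub e hWo (y := x.1) ⟨x.2, hx⟩
      refine ⟨r, hr, hb.trans inter_subset_left, fun a γ hγ => ?_⟩
      have hbW : box e x.1 r ⊆ W := fun z hz => (hW z).2 (hb hz)
      have : ContractibleSpace (box e x.1 r) :=
        (convex_box e _ _).contractibleSpace ⟨x.1, box_self e _ hr⟩
      let j : C(box e x.1 r, W) := ⟨Set.inclusion hbW, continuous_inclusion hbW⟩
      have ha : a.1 ∈ box e x.1 r := by simpa using hγ 0
      let γ' : Path (⟨a.1, ha⟩ : box e x.1 r) ⟨a.1, ha⟩ :=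
        ⟨⟨fun t => ⟨_, hγ t⟩, by fun_prop⟩, by simp, by simp⟩
      have e1 : H.val γ = (H.comap j).val γ' := rfl
      rw [e1, (H.comap j).hom _ _ (SimplyConnectedSpace.paths_homotopic γ' (Path.refl _)), PF.refl]
  choose r hr hb ht using ex
  obtain ⟨F, s, hF⟩ := PF.extend ι (by
      intro x
      rw [mem_closure_iff]
      rintro o ho hxo
      obtain ⟨o', ho', rfl⟩ := isOpen_induced_iff.1 ho
      obtain ⟨ρ, hρ, hs⟩ := box_sub e (ho'.inter hV) (y := x.1) ⟨hxo, x.2⟩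
      obtain ⟨t, ht, htc⟩ : ∃ t : ℝ, (0 < t ∧ t < ρ) ∧ (e x.1).1 + t ≠ c := by
        by_cases h : (e x.1).1 + (ρ/2 : ℝ) = c
        · refine ⟨ρ/3, ⟨by linarith, by linarith⟩, ?_⟩
          rw [← h]
          intro h2
          have h4 := Complex.ofReal_injective (add_left_cancel h2)
          linarith
        · exact ⟨ρ/2, ⟨by linarith, by linarith⟩, h⟩
      have hz : e.symm ((e x.1).1 + t, (e x.1).2) ∈ box e x.1 ρ := by
        rw [mem_box]; simp [hρ, abs_of_pos ht.1, ht.2]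
      exact ⟨⟨_, (hs hz).2⟩, (hs hz).1, ⟨_, (hW _).2 ⟨(hs hz).2, by simpa using htc⟩⟩, rfl⟩)
    H (fun x => {z | z.1 ∈ box e x.1 (r x)})
    (fun x => (isOpen_box e _ _).preimage continuous_subtype_val)
    (fun x => box_self e _ (hr x))
    (by
      intro i j a b ha hb'
      let C : Set ℂ := Metric.ball (e i.1).1 (r i) ∩ Metric.ball (e j.1).1 (r j)
      have hj := convex_minus_joined (C := C) ((convex_ball _ _).inter (convex_ball _ _))
        (Metric.isOpen_ball.inter Metric.isOpen_ball) (a := (e a.1).1) (b := (e b.1).1) (c := c)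
        ⟨mem_ball_iff_norm.2 ((mem_box e).1 ha.1).1,
          mem_ball_iff_norm.2 ((mem_box e).1 ha.2).1⟩
        ⟨mem_ball_iff_norm.2 ((mem_box e).1 hb'.1).1,
          mem_ball_iff_norm.2 ((mem_box e).1 hb'.2).1⟩
        ((hW _).1 a.2).2 ((hW _).1 b.2).2
      obtain ⟨p, hp⟩ := hj
      let q : Path (e a.1).2 (e b.1).2 := Path.segment _ _
      have hq : ∀ k : V, ι a ∈ {z : V | z.1 ∈ box e k.1 (r k)} → ι b ∈ {z : V | z.1 ∈ box e k.1 (r k)} →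
          ∀ t, q t ∈ Metric.ball (e k.1).2 (r k) := by
        intro k h1 h2 t
        apply (convex_ball (e k.1).2 (r k)).segment_subset
          (mem_ball_iff_norm.2 ((mem_box e).1 h1).2 :
            (e a.1).2 ∈ Metric.ball (e k.1).2 (r k))
          (mem_ball_iff_norm.2 ((mem_box e).1 h2).2)
        rw [← Path.range_segment]
        exact ⟨t, rfl⟩
      have h1 : ∀ t, e.symm (p t, q t) ∈ box e i.1 (r i) := by
        intro t
        have h2 := (hp t).1.1
        have h3 := hq i ha.1 hb'.1 t
        simp only [Metric.mem_ball, dist_eq_norm] at h2 h3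
        rw [mem_box]; simp [h2, h3]
      have h2 : ∀ t, e.symm (p t, q t) ∈ box e j.1 (r j) := by
        intro t
        have h2 := (hp t).1.2
        have h3 := hq j ha.2 hb'.2 t
        simp only [Metric.mem_ball, dist_eq_norm] at h2 h3
        rw [mem_box]; simp [h2, h3]
      exact ⟨⟨⟨fun t => ⟨e.symm (p t, q t), (hW _).2 ⟨hb i (h1 t), by simpa using (hp t).2⟩⟩,
        by fun_prop⟩, by apply Subtype.ext; simp,
        by apply Subtype.ext; simp⟩, fun t => ⟨h1 t, h2 t⟩⟩)
    (fun i a γ hγ => ht i a γ hγ)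
  refine ⟨F, fun ι' hι a γ => ?_⟩
  have : ι' = ι := by
    ext1 x
    apply Subtype.ext
    rw [hι]; rfl
  subst this
  have := hF a a γ
  rw [mul_comm] at this
  exact mul_right_cancel this
end

end

noncomputable section
open Set Topology unitInterval

/-- basic non degeneracy -/
structure ND (A : Fin 12 → Fin 3 → ℂ) : Prop where
  inf : A 0 = ![0, 0, 1]
  dist : ∀ j k, j ≠ k → ∃ i, det3 (A i) (A j) (A k) ≠ 0

variable {A : Fin 12 → Fin 3 → ℂ}

theorem two_pts (hN : ND A) {j k : Fin 12} (hjk : j ≠ k) {p q : ℂ × ℂ} (h1 : lf A j p = 0)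
    (h2 : lf A k p = 0) (h3 : lf A j q = 0) (h4 : lf A k q = 0) : p = q := by
  by_contra hne
  obtain ⟨i, hi⟩ := hN.dist j k hjk
  apply hi
  simp only [lf] at h1 h2 h3 h4
  have c2 : A j 0 * A k 1 - A j 1 * A k 0 = 0 := by
    by_cases hx : p.1 = q.1
    · have hy : p.2 - q.2 ≠ 0 := fun h => hne (Prod.ext hx (sub_eq_zero.1 h))
      apply mul_right_cancel₀ hy
      rw [hx] at h1 h2
      linear_combination A j 0 * (h2 - h4) - A k 0 * (h1 - h3)
    · apply mul_right_cancel₀ (sub_ne_zero.2 hx)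
      linear_combination A k 1 * (h1 - h3) - A j 1 * (h2 - h4)
  simp only [det3]
  linear_combination (A i 0 * p.1 + A i 1 * p.2 + A i 2) * c2 + A i 0 * (A j 1 * h2 - A k 1 * h1)
    - A i 1 * (A j 0 * h2 - A k 0 * h1)

theorem lin_ne (hN : ND A) {k : Fin 12} (hk : k ≠ 0) : A k 0 ≠ 0 ∨ A k 1 ≠ 0 := by
  by_contra h
  push Not at h
  obtain ⟨i, hi⟩ := hN.dist 0 k hk.symm
  apply hi
  simp [det3, hN.inf, h.1, h.2]

theorem coord_exists (p q : ℂ) (h : p ≠ 0 ∨ q ≠ 0) :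
    ∃ e : (ℂ × ℂ) ≃L[ℂ] (ℂ × ℂ), ∀ x, (e x).1 = p * x.1 + q * x.2 := by
  have hd : p * star p + q * star q ≠ 0 := by
    simp only [Complex.star_def, Complex.mul_conj]
    norm_cast
    have := Complex.normSq_nonneg p
    have := Complex.normSq_nonneg q
    rcases h with h | h
    · have := Complex.normSq_pos.2 h; positivity
    · have := Complex.normSq_pos.2 h; positivity
  set d := p * star p + q * star q with hdd
  let f : (ℂ × ℂ) ≃ₗ[ℂ] (ℂ × ℂ) :=
    { toFun := fun x => (p * x.1 + q * x.2, - star q * x.1 + star p * x.2)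
      map_add' := by intro x y; ext <;> simp <;> ring
      map_smul' := by intro x y; ext <;> simp <;> ring
      invFun := fun x => (d⁻¹ * (star p * x.1 - q * x.2), d⁻¹ * (star q * x.1 + p * x.2))
      left_inv := by
        intro x
        ext
        · simp only
          field_simp
          rw [hdd]; ring
        · simp only
          field_simp
          rw [hdd]; ring
      right_inv := by
        intro x
        ext
        · simp only
          field_simp
          rw [hdd]; ring
        · simp only
          field_simp
          rw [hdd]; ring }
  exact ⟨f.toContinuousLinearEquiv, fun x => rfl⟩

theorem lf_ll (k p) : lf A k p = ll A k p + A k 2 := rfl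

theorem Z_conn (hN : ND A) (k : Fin 12) (S : Finset (Fin 12)) (hS : k ∉ S)
    (e : (ℂ × ℂ) ≃L[ℂ] (ℂ × ℂ)) (he : ∀ x, (e x).1 = ll A k x) :
    IsPathConnected {x | (∀ j ∈ S, lf A j x ≠ 0) ∧ (e x).1 = - A k 2} := by
  have hc : IsPathConnected ({t : ℂ | ∃ j ∈ S, lf A j (e.symm (- A k 2, t)) = 0}ᶜ) := by
    apply Set.Countable.isPathConnected_compl_of_one_lt_rank (by simp)
    have : {t : ℂ | ∃ j ∈ S, lf A j (e.symm (- A k 2, t)) = 0} =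
        ⋃ j ∈ (S : Set (Fin 12)), {t : ℂ | lf A j (e.symm (- A k 2, t)) = 0} := by
      ext t; simp
    rw [this]
    refine Set.Countable.biUnion (Set.to_countable _) fun j hj => ?_
    apply Set.Subsingleton.countable
    intro t ht t' ht'
    have hk : ∀ t : ℂ, lf A k (e.symm (- A k 2, t)) = 0 := by
      intro t
      rw [lf_ll, ← he]; simp
    have := two_pts hN (j := j) (k := k) (by rintro rfl; exact hS hj) ht (hk t) ht' (hk t')
    have := e.symm.injective this
    exact (Prod.mk.inj this).2
  have hi := hc.image (f := fun t => e.symm (- A k 2, t)) (by fun_prop)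
  convert hi using 1
  ext x
  simp only [mem_ofPred_eq, mem_image, mem_compl_iff, not_exists, not_and]
  constructor
  · rintro ⟨h1, h2⟩
    refine ⟨(e x).2, ?_, ?_⟩
    · intro j hj h
      apply h1 j hj
      rwa [← h2, e.symm_apply_apply] at h
    · rw [← h2]; simp
  · rintro ⟨t, h1, rfl⟩
    exact ⟨h1, by simp⟩

theorem mer_exists (hN : ND A) (k : Fin 12) (hk : k ≠ 0) : ∃ (e : (ℂ × ℂ) ≃L[ℂ] (ℂ × ℂ)) (y : ℂ × ℂ)
    (r : ℝ), (∀ x, (e x).1 = ll A k x) ∧ (e y).1 = - A k 2 ∧ 0 < r ∧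
    ∀ x ∈ box e y r, ∀ j, j ≠ k → lf A j x ≠ 0 ∧ lf A j x / lf A j y ∈ Complex.slitPlane := by
  obtain ⟨e, he⟩ := coord_exists (A k 0) (A k 1) (lin_ne hN hk)
  obtain ⟨y, hy, hyk⟩ := (Z_conn hN k (Finset.univ.erase k) (by simp) e he).nonempty
  have ho : IsOpen {x | ∀ j, j ≠ k → lf A j x / lf A j y ∈ Complex.slitPlane} := by
    simp only [ofPred_forall]
    refine isOpen_iInter_of_finite fun j => isOpen_iInter_of_finite fun _ =>
      Complex.isOpen_slitPlane.preimage ((lf_cont A j).div_const _)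
  obtain ⟨r, hr, hb⟩ := box_sub e ho (y := y) (by
    intro j hj
    rw [div_self (hy j (by simp [hj]))]
    exact Complex.one_mem_slitPlane)
  refine ⟨e, y, r, he, hyk, hr, fun x hx j hj => ⟨fun h => ?_, hb hx j hj⟩⟩
  have := hb hx j hj
  rw [h, zero_div] at this
  exact Complex.slitPlane_ne_zero this rfl

def XS (A : Fin 12 → Fin 3 → ℂ) (S : Finset (Fin 12)) : Set (ℂ × ℂ) := {p | ∀ k ∈ S, lf A k p ≠ 0}

theorem isOpen_XS (S) : IsOpen (XS A S) := by
  have : XS A S = ⋂ k ∈ S, (lf A k) ⁻¹' {0}ᶜ := by ext p; simp [XS]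
  rw [this]
  exact isOpen_biInter_finset fun k _ => isOpen_compl_singleton.preimage (lf_cont A k)

theorem XS_triv (hN : ND A) {G : Type*} [CommGroup G] (e : Fin 12 → (ℂ × ℂ) ≃L[ℂ] (ℂ × ℂ))
    (y : Fin 12 → ℂ × ℂ) (r : Fin 12 → ℝ) (he : ∀ k, k ≠ 0 → ∀ x, (e k x).1 = ll A k x)
    (hy : ∀ k, k ≠ 0 → (e k (y k)).1 = - A k 2) (hr : ∀ k, k ≠ 0 → 0 < r k)
    (hb : ∀ k, k ≠ 0 → ∀ x ∈ box (e k) (y k) (r k), ∀ j, j ≠ k → lf A j x ≠ 0)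
    (m : Fin 12 → I → ℂ × ℂ) (hmc : ∀ k, k ≠ 0 → Continuous (m k)) (hm01 : ∀ k, k ≠ 0 → m k 0 = m k 1)
    (hmX : ∀ k, k ≠ 0 → ∀ t, m k t ∈ XA A)
    (hm : ∀ k, k ≠ 0 → ∀ t, m k t = (e k).symm (- A k 2 + (r k / 2 : ℝ) *
      Complex.exp (2 * Real.pi * Complex.I * t), (e k (y k)).2)) :
    ∀ S : Finset (Fin 12), 0 ∉ S → ∀ H : PF (XS A S) G,
    (∀ k ∈ S, ∀ a (γ : Path a a), (∀ t, (γ t).1 = m k t) → H.val γ = 1) →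
    ∀ a (γ : Path a a), H.val γ = 1 := by
  intro S
  induction S using Finset.induction_on with
  | empty =>
    intro _ H _ a γ
    have : ContractibleSpace (XS A ∅) := by
      have h : XS A ∅ = univ := by ext; simp [XS]
      exact Convex.contractibleSpace (h ▸ convex_univ) ⟨a.1, a.2⟩
    rw [H.hom _ _ (SimplyConnectedSpace.paths_homotopic γ (Path.refl _)), PF.refl]
  | insert k S hkS ih =>
    intro h0 H hH a γ
    have hk0 : k ≠ 0 := by rintro rfl; exact h0 (Finset.mem_insert_self _ _)
    have h0S : 0 ∉ S := fun h => h0 (Finset.mem_insert_of_mem h)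
    have hW : ∀ x, x ∈ XS A (insert k S) ↔ x ∈ XS A S ∧ (e k x).1 ≠ - A k 2 := by
      intro x
      simp only [XS, Finset.forall_mem_insert, mem_ofPred_eq, he k hk0, lf_ll k, ne_eq,
        eq_neg_iff_add_eq_zero]
      tauto
    have hbS : box (e k) (y k) (r k) ⊆ XS A S := fun x hx j hj =>
      hb k hk0 x hx j (by rintro rfl; exact hkS hj)
    have mW : ∀ k' : Fin 12, k' ≠ 0 → ∀ (S' : Finset (Fin 12)) (t : I), m k' t ∈ XS A S' :=
      fun k' hk' S' t j _ => hmX k' hk' t j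
    let M : ∀ k' : Fin 12, ∀ h : k' ≠ 0, ∀ S' : Finset (Fin 12),
      Path (⟨m k' 0, mW k' h S' 0⟩ : XS A S') ⟨m k' 0, mW k' h S' 0⟩ := fun k' h S' =>
      { toFun := fun t => ⟨m k' t, mW k' h S' t⟩
        continuous_toFun := by have := hmc k' h; fun_prop
        source' := rfl
        target' := Subtype.ext (hm01 k' h).symm }
    have hr' := hr k hk0
    have hg := good_of_loop (e k) (- A k 2) H hW (hy k hk0) (half_pos hr') (half_lt_self hr') hbS
      (box_self _ _ hr') (M k hk0 (insert k S)) (fun t => hm k hk0 t)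
      (hH k (Finset.mem_insert_self _ _) _ _ fun t => rfl)
    obtain ⟨F, hF⟩ := ext_line (e k) (- A k 2) H hW (isOpen_XS S)
      (Z_conn hN k S hkS (e k) (he k hk0)).isConnected.isPreconnected (hy k hk0) hg
    have hWV : XS A (insert k S) ⊆ XS A S := fun x hx => ((hW x).1 hx).1
    let ι : C(XS A (insert k S), XS A S) := ⟨Set.inclusion hWV, continuous_inclusion hWV⟩
    have hF' := hF ι fun x => rfl
    rw [hF' a γ]
    apply ih h0S
    intro j hj a γ' hγ'
    have hj0 : j ≠ 0 := by rintro rfl; exact h0S hj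
    have h1 := hF' _ (M j hj0 (insert k S))
    rw [hH j (Finset.mem_insert_of_mem hj) _ _ fun t => rfl] at h1
    rw [h1]
    have ha : a = ι ⟨m j 0, mW j hj0 _ 0⟩ := by
      apply Subtype.ext
      have := hγ' 0
      rw [γ'.source] at this
      exact this
    have : γ' = ((M j hj0 (insert k S)).map ι.continuous).cast ha ha := by
      ext1; funext t
      exact Subtype.ext (hγ' t)
    rw [this, PF.cast]

end

noncomputable section
open Set Topology unitInterval

variable {A : Fin 12 → Fin 3 → ℂ}

/-- every additive path functional is a combination of logarithms -/
theorem hom_lin (hA : TrOK A) (hN : ND A) {C : Type*} [CommGroup C] (q : Multiplicative ℂ →* C)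
    (hq : Function.Surjective q) (H : PF (XA A) C) :
    ∃ a : Fin 12 → ℂ, ∀ x (γ : Path x x),
      H.val γ = q (Multiplicative.ofAdd (∑ k, a k * ((Hol hA).val γ).L k)) := by
  have ex : ∀ k : Fin 12, ∃ (e : (ℂ × ℂ) ≃L[ℂ] (ℂ × ℂ)) (y : ℂ × ℂ) (r : ℝ), k ≠ 0 →
      (∀ x, (e x).1 = ll A k x) ∧ (e y).1 = - A k 2 ∧ 0 < r ∧
      ∀ x ∈ box e y r, ∀ j, j ≠ k → lf A j x ≠ 0 ∧ lf A j x / lf A j y ∈ Complex.slitPlane := by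
    intro k
    by_cases hk : k = 0
    · exact ⟨ContinuousLinearEquiv.refl ℂ _, 0, 0, fun h => absurd hk h⟩
    · obtain ⟨e, y, r, h⟩ := mer_exists hN k hk
      exact ⟨e, y, r, fun _ => h⟩
  choose e y r hh using ex
  let m : Fin 12 → ℝ → ℂ × ℂ := fun k t => (e k).symm (- A k 2 + (r k / 2 : ℝ) *
      Complex.exp (2 * Real.pi * Complex.I * t), (e k (y k)).2)
  have hmb : ∀ k, k ≠ 0 → ∀ t, m k t ∈ box (e k) (y k) (r k) := by
    intro k hk t
    obtain ⟨h1, h2, h3, h4⟩ := hh k hk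
    rw [mem_box]
    have : ‖Complex.exp (2 * Real.pi * Complex.I * t)‖ = 1 := by
      rw [Complex.norm_exp]; simp
    simp only [m, ContinuousLinearEquiv.apply_symm_apply, h2, add_sub_cancel_left, sub_self, norm_zero,
      norm_mul, this, mul_one, Complex.norm_real, Real.norm_eq_abs, abs_of_pos (half_pos h3)]
    exact ⟨half_lt_self h3, h3⟩
  have hmk : ∀ k, k ≠ 0 → ∀ t, lf A k (m k t) = (r k / 2 : ℝ) *
      Complex.exp (2 * Real.pi * Complex.I * t) := by
    intro k hk t
    rw [lf_ll, ← (hh k hk).1]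
    simp [m]
  have hmX : ∀ k, k ≠ 0 → ∀ t, m k t ∈ XA A := by
    intro k hk t j
    by_cases hj : j = k
    · subst hj
      rw [hmk j hk]
      have := (hh j hk).2.2.1
      exact mul_ne_zero (by exact_mod_cast (half_pos this).ne') (Complex.exp_ne_zero _)
    · exact ((hh k hk).2.2.2 _ (hmb k hk t) j hj).1
  have hm01 : ∀ k, m k 0 = m k 1 := by intro k; simp [m]
  have hmc : ∀ k, Continuous (m k) := by intro k; fun_prop
  let Φ : ∀ k : Fin 12, k ≠ 0 → C(I, XA A) := fun k hk =>
    ⟨fun t => ⟨m k t, hmX k hk t⟩, by have := hmc k; fun_prop⟩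
  let idp : Path (0 : I) 1 := ⟨⟨id, continuous_id⟩, rfl, rfl⟩
  let M : ∀ k : Fin 12, ∀ h : k ≠ 0, Path (Φ k h 0) (Φ k h 0) := fun k h =>
    (idp.map (Φ k h).continuous).cast rfl (Subtype.ext (by simpa [Φ] using hm01 k))
  have LM : ∀ k (h : k ≠ 0) j, ((Hol hA).val (M k h)).L j = if j = k then 2 * Real.pi * Complex.I else 0 := by
    intro k hk j
    simp only [M, PF.cast]
    have hr := (hh k hk).2.2.1
    split_ifs with hj
    · subst hj
      rw [L_eval hA (Φ j hk) j (fun t => 2 * Real.pi * Complex.I * (t : ℝ)) (by fun_prop)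
        ((r j / 2 : ℝ) : ℂ)⁻¹]
      · simp
      · intro t
        have : ((r j / 2 : ℝ) : ℂ) ≠ 0 := by exact_mod_cast (half_pos hr).ne'
        rw [show ((Φ j hk) t).1 = m j t from rfl, hmk j hk, inv_mul_cancel_left₀ this]
    · have hs : ∀ t : I, lf A j (m k t) / lf A j (y k) ∈ Complex.slitPlane := fun t =>
        ((hh k hk).2.2.2 _ (hmb k hk t) j hj).2
      rw [L_eval hA (Φ k hk) j (fun t => Complex.log (lf A j (m k t) / lf A j (y k))) ?_
        (lf A j (y k))⁻¹]
      · have := hm01 k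
        simp [this]
      · intro t
        rw [Complex.exp_log (Complex.slitPlane_ne_zero (hs t)), div_eq_inv_mul]; rfl
      · refine Continuous.clog ?_ hs
        have h1 := hmc k
        have h2 := lf_cont A j
        fun_prop
  let a : Fin 12 → ℂ := fun k => if h : k = 0 then 0 else
    (hq (H.val (M k h))).choose.toAdd / (2 * Real.pi * Complex.I)
  refine ⟨a, ?_⟩
  let H' : PF (XA A) C :=
    { val := fun γ => H.val γ * (q (Multiplicative.ofAdd (∑ k, a k * ((Hol hA).val γ).L k)))⁻¹
      trans := by
        intro x y z γ γ'
        rw [H.trans, (Hol hA).trans]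
        simp only [Uni.mul_L, Pi.add_apply, mul_add, Finset.sum_add_distrib, ofAdd_add, map_mul]
        rw [mul_inv]
        exact mul_mul_mul_comm _ _ _ _
      hom := by
        intro x y γ γ' h
        rw [H.hom _ _ h, (Hol hA).hom _ _ h] }
  have key : ∀ x (γ : Path x x), H'.val γ = 1 := by
    have hX : XS A (Finset.univ.erase 0) = XA A := by
      ext p
      simp only [XS, XA, mem_ofPred_eq, Finset.mem_erase, Finset.mem_univ, and_true]
      refine ⟨fun h k => ?_, fun h k _ => h k⟩
      by_cases hk : k = 0
      · subst hk; simp [lf, hN.inf]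
      · exact h k hk
    let ι : C(XS A (Finset.univ.erase 0), XA A) := ⟨Set.inclusion hX.le, continuous_inclusion hX.le⟩
    have := XS_triv hN e y r (fun k hk => (hh k hk).1) (fun k hk => (hh k hk).2.1)
      (fun k hk => (hh k hk).2.2.1) (fun k hk x hx j hj => ((hh k hk).2.2.2 x hx j hj).1)
      (fun k t => m k t) (fun k _ => by have := hmc k; fun_prop) (fun k _ => by simpa using hm01 k)
      (fun k hk t => hmX k hk t)
      (fun k hk t => rfl) (Finset.univ.erase 0) (by simp) (H'.comap ι) (by
        intro k hk b γ hγ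
        have hk0 : k ≠ 0 := by simpa using hk
        have hb : ι b = Φ k hk0 0 := by
          apply Subtype.ext
          have := hγ 0
          rw [γ.source] at this
          exact this
        have e1 : γ.map ι.continuous = (M k hk0).cast hb hb := by
          ext1; funext t
          exact Subtype.ext (hγ t)
        change H'.val (γ.map ι.continuous) = 1
        rw [e1, PF.cast]
        simp only [H', LM]
        have hpi : (2 * Real.pi * Complex.I : ℂ) ≠ 0 := Complex.two_pi_I_ne_zero
        have e2 : ∑ x, a x * (if x = k then (2 * Real.pi * Complex.I : ℂ) else 0)
            = (hq (H.val (M k hk0))).choose.toAdd := by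
          simp [a, hk0, div_mul_cancel₀ _ hpi]
        rw [e2, ofAdd_toAdd, (hq (H.val (M k hk0))).choose_spec, mul_inv_cancel])
    intro x γ
    have hx : x.1 ∈ XS A (Finset.univ.erase 0) := hX.ge x.2
    let γ' : Path (⟨x.1, hx⟩ : XS A (Finset.univ.erase 0)) ⟨x.1, hx⟩ :=
      ⟨⟨fun t => ⟨(γ t).1, hX.ge (γ t).2⟩, by fun_prop⟩, by simp, by simp⟩
    exact this _ γ'
  intro x γ
  exact mul_inv_eq_one.1 (key x γ)

end

noncomputable section
open Set Topology unitInterval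

variable {A : Fin 12 → Fin 3 → ℂ}

theorem lf_line (A : Fin 12 → Fin 3 → ℂ) (k) (a w : ℂ × ℂ) (t : ℂ) :
    lf A k (a + t • w) = lf A k a + t * ll A k w := by
  simp only [lf, ll, Prod.fst_add, Prod.snd_add, Prod.smul_fst, Prod.smul_snd, smul_eq_mul]; ring

theorem XA_pc (h : (XA A).Nonempty) : PathConnectedSpace (XA A) := by
  rw [← isPathConnected_iff_pathConnectedSpace]
  obtain ⟨b, hb⟩ := h
  refine ⟨b, hb, fun {c} hc => ?_⟩
  let f : ℂ → ℂ × ℂ := fun t => b + t • (c - b)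
  have hf : Continuous f := by fun_prop
  have hcount : (⋃ k, {t : ℂ | lf A k (f t) = 0}).Countable := by
    refine countable_iUnion fun k => (Set.Subsingleton.countable ?_)
    intro t ht t' ht'
    simp only [mem_ofPred_eq, f, lf_line] at ht ht'
    have h1 : (t - t') * ll A k (c - b) = 0 := by linear_combination ht - ht'
    rcases mul_eq_zero.1 h1 with h1 | h1
    · exact sub_eq_zero.1 h1
    · rw [h1, mul_zero, add_zero] at ht
      exact absurd ht (hb k)
  have hpc := hcount.isPathConnected_compl_of_one_lt_rank (by simp)
  have hi := hpc.image hf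
  have m0 : b ∈ f '' (⋃ k, {t : ℂ | lf A k (f t) = 0})ᶜ :=
    ⟨0, by simpa [f, XA] using hb, by simp [f]⟩
  have m1 : c ∈ f '' (⋃ k, {t : ℂ | lf A k (f t) = 0})ᶜ :=
    ⟨1, by simpa [f, XA] using hc, by simp [f]⟩
  refine (hi.joinedIn _ m0 _ m1).mono ?_
  rintro _ ⟨t, ht, rfl⟩ k hk
  exact ht (mem_iUnion.2 ⟨k, hk⟩)

section
variable {X : Type*} [TopologicalSpace X] {G : Type*} [Group G]

/-- class of a loop -/
def cls {x : X} (γ : Path x x) : FundamentalGroup X x :=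
  FundamentalGroup.fromPath (Path.Homotopic.Quotient.mk γ)

theorem cls_surj {x : X} (g : FundamentalGroup X x) : ∃ γ, cls γ = g :=
  Path.Homotopic.Quotient.mk_surjective g

theorem cls_mul {x : X} (γ γ' : Path x x) : cls γ * cls γ' = cls (γ'.trans γ) := rfl

theorem cls_eq {x : X} {γ γ' : Path x x} (h : γ.Homotopic γ') : cls γ = cls γ' :=
  Path.Homotopic.Quotient.eq.2 h

def PF.onG (F : PF X G) {x : X} (g : FundamentalGroup X x) : G :=
  Quotient.lift (fun γ : Path x x => F.val γ) (fun _ _ h => F.hom _ _ h) g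

theorem PF.onG_cls (F : PF X G) {x : X} (γ : Path x x) : F.onG (cls γ) = F.val γ := rfl

theorem PF.onG_mul (F : PF X G) {x : X} (g h : FundamentalGroup X x) :
    F.onG (g * h) = F.onG h * F.onG g := by
  obtain ⟨γ, rfl⟩ := cls_surj g
  obtain ⟨γ', rfl⟩ := cls_surj h
  rw [cls_mul, F.onG_cls, F.onG_cls, F.onG_cls, F.trans]

/-- loop with tail -/
def tail {b x : X} (τ : Path b x) (γ : Path x x) : Path b b := (τ.trans γ).trans τ.symm

theorem PF.tail (F : PF X G) {b x : X} (τ : Path b x) (γ : Path x x) :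
    F.val (tail τ γ) = F.val τ * F.val γ * (F.val τ)⁻¹ := by
  rw [_root_.tail, F.trans, F.trans, F.symm]

theorem q_assoc {a b c d : X} (p : Path.Homotopic.Quotient a b) (q : Path.Homotopic.Quotient b c)
    (r : Path.Homotopic.Quotient c d) : (p.trans q).trans r = p.trans (q.trans r) :=
  CategoryTheory.Category.assoc (obj := FundamentalGroupoid X) (W := ⟨a⟩) (X := ⟨b⟩) (Y := ⟨c⟩)
    (Z := ⟨d⟩) p q r

theorem q_refl {a b : X} (p : Path.Homotopic.Quotient a b) :
    (Path.Homotopic.Quotient.refl a).trans p = p :=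
  CategoryTheory.Category.id_comp (obj := FundamentalGroupoid X) (X := ⟨a⟩) (Y := ⟨b⟩) p

theorem q_symm {a b : X} (p : Path.Homotopic.Quotient a b) :
    p.symm.trans p = Path.Homotopic.Quotient.refl b := by
  obtain ⟨γ, rfl⟩ := Path.Homotopic.Quotient.mk_surjective p
  exact (Path.Homotopic.Quotient.eq.2 ⟨Path.Homotopy.reflSymmTrans γ⟩).symm

theorem tail_mul {b x y z : X} (τ : Path b x) (υ : Path b y) (ρ : Path b z)
    (γ : Path x y) (γ' : Path y z) :
    cls ((υ.trans γ').trans ρ.symm) * cls ((τ.trans γ).trans υ.symm) =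
      cls ((τ.trans (γ.trans γ')).trans ρ.symm) := by
  rw [cls_mul]
  simp only [cls, Path.Homotopic.Quotient.mk_trans, Path.Homotopic.Quotient.mk_symm]
  congr 1
  simp only [q_assoc]
  congr 2
  rw [← q_assoc (Path.Homotopic.Quotient.mk υ).symm, q_symm, q_refl]

theorem cls_refl (x : X) : cls (Path.refl x) = 1 := rfl

/-- extension of a homomorphism to all paths -/
def PF.ofHom {C : Type*} [CommGroup C] {b : X} (τ : ∀ x, Path b x) (h : FundamentalGroup X b →* C) :
    PF X C where
  val {x y} γ := h (cls (((τ x).trans γ).trans (τ y).symm))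
  trans {x y z} γ γ' := by
    rw [← tail_mul (τ x) (τ y) (τ z), map_mul, mul_comm]
  hom γ γ' hh := by
    congr 1
    exact cls_eq (((Path.Homotopic.refl _).hcomp hh).hcomp (Path.Homotopic.refl _))

theorem PF.ofHom_loop {C : Type*} [CommGroup C] {b : X} (τ : ∀ x, Path b x)
    (h : FundamentalGroup X b →* C) (γ : Path b b) : (PF.ofHom τ h).val γ = h (cls γ) := by
  have e : ∀ γ, (PF.ofHom τ h).val γ = h (cls ((τ b).trans γ |>.trans (τ b).symm)) := fun _ => rfl
  rw [e, ← cls_mul, ← cls_mul, map_mul, map_mul]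
  have : cls (τ b).symm * cls (τ b) = 1 := by
    rw [cls_mul, ← cls_refl]
    exact cls_eq ⟨(Path.Homotopy.reflTransSymm _).symm⟩
  rw [mul_left_comm, ← map_mul, this, map_one, mul_one]

/-- commuting loops with a common tail -/
theorem tail_comm {b x : X} (τ : Path b x) {γ γ' : Path x x}
    (h : (γ.trans γ').Homotopic (γ'.trans γ)) :
    cls (tail τ γ) * cls (tail τ γ') = cls (tail τ γ') * cls (tail τ γ) := by
  simp only [tail]
  rw [tail_mul, tail_mul]
  exact cls_eq (((Path.Homotopic.refl _).hcomp h.symm).hcomp (Path.Homotopic.refl _))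

end

end

noncomputable section
open Set Topology unitInterval

variable {A : Fin 12 → Fin 3 → ℂ}

/-- the two commuting loops of a doubly periodic map -/
theorem per_loops {X : Type*} [TopologicalSpace X] (Φ : C(ℝ × ℝ, X))
    (h1 : ∀ s t, Φ (s + 1, t) = Φ (s, t)) (h2 : ∀ s t, Φ (s, t + 1) = Φ (s, t)) :
    ∃ (P : Path ((0:ℝ), (0:ℝ)) (1, 0)) (Q : Path ((0:ℝ), (0:ℝ)) (0, 1))
      (γ γ' : Path (Φ (0, 0)) (Φ (0, 0))), (γ.trans γ').Homotopic (γ'.trans γ) ∧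
      ∀ (G : Type) [Group G] (F : PF X G), F.val γ = F.val (P.map Φ.continuous) ∧
        F.val γ' = F.val (Q.map Φ.continuous) := by
  have e10 : Φ (0, 0) = Φ (1, 0) := by simpa using (h1 0 0).symm
  have e01 : Φ (0, 0) = Φ (0, 1) := by simpa using (h2 0 0).symm
  have e11 : Φ (0, 0) = Φ (1, 1) := by rw [e01]; simpa using (h1 0 1).symm
  let P : Path ((0:ℝ), (0:ℝ)) (1, 0) := ⟨⟨fun t => ((t:ℝ), 0), by fun_prop⟩, by simp, by simp⟩
  let Q : Path ((0:ℝ), (0:ℝ)) (0, 1) := ⟨⟨fun t => (0, (t:ℝ)), by fun_prop⟩, by simp, by simp⟩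
  let P' : Path ((0:ℝ), (1:ℝ)) (1, 1) := ⟨⟨fun t => ((t:ℝ), 1), by fun_prop⟩, by simp, by simp⟩
  let Q' : Path ((1:ℝ), (0:ℝ)) (1, 1) := ⟨⟨fun t => (1, (t:ℝ)), by fun_prop⟩, by simp, by simp⟩
  refine ⟨P, Q, (P.map Φ.continuous).cast rfl e10, (Q.map Φ.continuous).cast rfl e01, ?_,
    fun G _ F => ⟨F.cast _ _ _, F.cast _ _ _⟩⟩
  have k1 : (((P.map Φ.continuous).cast rfl e10).trans ((Q.map Φ.continuous).cast rfl e01)) =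
      ((P.trans Q').map Φ.continuous).cast rfl e11 := by
    ext t
    simp only [Path.trans_apply, Path.cast_coe, Path.map_coe, Function.comp]
    split_ifs
    · rfl
    · have := h1 0 (2 * (t:ℝ) - 1)
      rw [zero_add] at this
      exact this.symm
  have k2 : (((Q.map Φ.continuous).cast rfl e01).trans ((P.map Φ.continuous).cast rfl e10)) =
      ((Q.trans P').map Φ.continuous).cast rfl e11 := by
    ext t
    simp only [Path.trans_apply, Path.cast_coe, Path.map_coe, Function.comp]
    split_ifs
    · rfl
    · have := h2 (2 * (t:ℝ) - 1) 0
      rw [zero_add] at this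
      exact this.symm
  rw [k1, k2]
  exact ((SimplyConnectedSpace.paths_homotopic (P.trans Q') (Q.trans P')).map Φ).pathCast _ _

theorem exists_normal (hN : ND A) {k : Fin 12} (hk : k ≠ 0) : ∃ n, ll A k n = 1 := by
  rcases lin_ne hN hk with h | h
  · exact ⟨((A k 0)⁻¹, 0), by simp [ll, h]⟩
  · exact ⟨(0, (A k 1)⁻¹), by simp [ll, h]⟩

theorem exists_small (a b : Fin 12 → ℝ) (k : Fin 12) (h : ∀ j, j ≠ k → 0 < a j) :
    ∃ ρ : ℝ, 0 < ρ ∧ ∀ j, j ≠ k → ρ * b j < a j := by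
  have hev : ∀ᶠ ρ in 𝓝[>] (0:ℝ), ∀ j, j ≠ k → ρ * b j < a j := by
    rw [Filter.eventually_all]
    intro j
    by_cases hj : j = k
    · simp [hj]
    · have : Filter.Tendsto (fun ρ : ℝ => ρ * b j) (𝓝[>] 0) (𝓝 0) := by
        have : Filter.Tendsto (fun ρ : ℝ => ρ * b j) (𝓝 0) (𝓝 (0 * b j)) :=
          (continuous_id.mul continuous_const).tendsto _
        rw [zero_mul] at this
        exact this.mono_left nhdsWithin_le_nhds
      filter_upwards [this.eventually_lt_const (h j hj)] with ρ hρ _ using hρ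
  obtain ⟨ρ, h1, h2⟩ := (hev.and self_mem_nhdsWithin).exists
  exact ⟨ρ, h2, h1⟩

def ex (t : ℝ) : ℂ := Complex.exp (2 * Real.pi * Complex.I * t)

theorem ex_norm (t : ℝ) : ‖ex t‖ = 1 := by rw [ex, Complex.norm_exp]; simp
theorem ex_cont : Continuous ex := by unfold ex; fun_prop
theorem ex_ne (t : ℝ) : ex t ≠ 0 := Complex.exp_ne_zero _
theorem ex_add_one (t : ℝ) : ex (t + 1) = ex t := by
  rw [ex, ex]; push_cast; rw [mul_add, mul_one, Complex.exp_add, Complex.exp_two_pi_mul_I, mul_one]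

theorem torus (hA : TrOK A) (hN : ND A) {k : Fin 12} (hk : k ≠ 0) (x0 w : ℂ × ℂ)
    (hx : lf A k x0 = 0) (hw : ll A k w = 0) (hne : ∀ j, j ≠ k → ‖lf A j x0‖ ≠ ‖ll A j w‖) :
    ∃ (x : XA A) (γ γ' : Path x x), (γ.trans γ').Homotopic (γ'.trans γ) ∧
      (∀ j, ((Hol hA).val γ').L j = if j = k then 2 * Real.pi * Complex.I else 0) ∧
      (∀ j, ((Hol hA).val γ).L j =
        if j ≠ k ∧ ‖lf A j x0‖ < ‖ll A j w‖ then 2 * Real.pi * Complex.I else 0) := by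
  obtain ⟨n, hn⟩ := exists_normal hN hk
  obtain ⟨ρ, hρ, hs⟩ := exists_small (fun j => |‖lf A j x0‖ - ‖ll A j w‖|) (fun j => ‖ll A j n‖) k (fun j hj => abs_pos.2 (sub_ne_zero.2 (hne j hj)))
  have hρ' : (ρ : ℂ) ≠ 0 := by exact_mod_cast hρ.ne'
  let f : ℝ × ℝ → ℂ × ℂ := fun p => x0 + ex p.1 • w + (ρ * ex p.2) • n
  have hf : ∀ j p, lf A j (f p) = lf A j x0 + ex p.1 * ll A j w + ρ * ex p.2 * ll A j n := by
    intro j p; simp only [f, lf_line]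
  have nr : ∀ j p, ‖(ρ:ℂ) * ex p * ll A j n‖ = ρ * ‖ll A j n‖ := by
    intro j p
    rw [norm_mul, norm_mul, ex_norm, mul_one, Complex.norm_real, Real.norm_eq_abs, abs_of_pos hρ]
  -- continuous logs
  have hlog : ∀ j, ∃ (lam : ℝ × ℝ → ℂ) (c : ℂ), Continuous lam ∧ c ≠ 0 ∧
      (∀ p, lf A j (f p) = c * Complex.exp (lam p)) ∧
      lam (1, 0) - lam (0, 0) = (if j ≠ k ∧ ‖lf A j x0‖ < ‖ll A j w‖ then
        2 * Real.pi * Complex.I else 0) ∧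
      lam (0, 1) - lam (0, 0) = (if j = k then 2 * Real.pi * Complex.I else 0) := by
    intro j
    have c0 : ex 1 = ex 0 := by simpa using ex_add_one 0
    by_cases hj : j = k
    · subst hj
      refine ⟨fun p => 2 * Real.pi * Complex.I * p.2, ρ, by fun_prop, hρ', fun p => ?_, by simp, by simp⟩
      rw [hf, hx, hw, hn]; simp only [ex]; ring
    have hs := hs j hj
    rcases lt_or_gt_of_ne (hne j hj) with h | h
    · have hw0 : ll A j w ≠ 0 := by
        intro h0; rw [h0, norm_zero] at h; exact absurd h (norm_nonneg _).not_gt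
      have hsm : ∀ p : ℝ × ℝ, ‖(lf A j x0 + ρ * ex p.2 * ll A j n) / (ex p.1 * ll A j w)‖ < 1 := by
        intro p
        rw [norm_div, norm_mul, ex_norm, one_mul, div_lt_one (norm_pos_iff.2 hw0)]
        refine (norm_add_le _ _).trans_lt ?_
        rw [nr]
        rw [abs_of_neg (sub_neg.2 h)] at hs
        linarith
      refine ⟨fun p => 2 * Real.pi * Complex.I * p.1 + Complex.log
        (1 + (lf A j x0 + ρ * ex p.2 * ll A j n) / (ex p.1 * ll A j w)), ll A j w, ?_, hw0, ?_, ?_, ?_⟩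
      · refine Continuous.add (by fun_prop) (Continuous.clog ?_ fun p =>
          Complex.mem_slitPlane_of_norm_lt_one (hsm p))
        have := ex_cont
        refine Continuous.add continuous_const (Continuous.div (by fun_prop) (by fun_prop) fun p => ?_)
        exact mul_ne_zero (ex_ne _) hw0
      · intro p
        rw [hf, Complex.exp_add, Complex.exp_log (Complex.slitPlane_ne_zero
          (Complex.mem_slitPlane_of_norm_lt_one (hsm p)))]
        change _ = ll A j w * (ex p.1 * _)
        have := ex_ne p.1
        field_simp
        ring
      · simp [hj, h, c0]
      · simp [hj, c0]
    · have hw0 : lf A j x0 ≠ 0 := by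
        intro h0; rw [h0, norm_zero] at h; exact absurd h (norm_nonneg _).not_gt
      have hsm : ∀ p : ℝ × ℝ, ‖(ex p.1 * ll A j w + ρ * ex p.2 * ll A j n) / lf A j x0‖ < 1 := by
        intro p
        rw [norm_div, div_lt_one (norm_pos_iff.2 hw0)]
        refine (norm_add_le _ _).trans_lt ?_
        rw [nr, norm_mul, ex_norm, one_mul]
        rw [abs_of_pos (sub_pos.2 h)] at hs
        linarith
      refine ⟨fun p => Complex.log
        (1 + (ex p.1 * ll A j w + ρ * ex p.2 * ll A j n) / lf A j x0), lf A j x0, ?_, hw0, ?_, ?_, ?_⟩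
      · refine Continuous.clog ?_ fun p => Complex.mem_slitPlane_of_norm_lt_one (hsm p)
        have := ex_cont
        fun_prop
      · intro p
        rw [hf, Complex.exp_log (Complex.slitPlane_ne_zero
          (Complex.mem_slitPlane_of_norm_lt_one (hsm p)))]
        field_simp
        ring
      · simp [hj, h.le, c0]
      · simp [hj, c0]
  choose lam c hlc hc0 hle hl1 hl2 using hlog
  let Φ : C(ℝ × ℝ, XA A) := ⟨fun p => ⟨f p, fun j => by
    rw [hle]; exact mul_ne_zero (hc0 j) (Complex.exp_ne_zero _)⟩, by
      have := ex_cont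
      fun_prop⟩
  obtain ⟨P, Q, γ, γ', hh, hF⟩ := per_loops Φ
    (fun s t => Subtype.ext (by simp only [Φ, f, ContinuousMap.coe_mk, ex_add_one]))
    (fun s t => Subtype.ext (by simp only [Φ, f, ContinuousMap.coe_mk, ex_add_one]))
  have he : ∀ j p, Complex.exp (lam j p) = (c j)⁻¹ * lf A j (Φ p).1 := by
    intro j p
    rw [show (Φ p).1 = f p from rfl, hle, inv_mul_cancel_left₀ (hc0 j)]
  refine ⟨_, γ, γ', hh, fun j => ?_, fun j => ?_⟩
  · rw [(hF _ (Hol hA)).2, L_eval hA Φ j (lam j) (hlc j) _ (he j), hl2]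
  · rw [(hF _ (Hol hA)).1, L_eval hA Φ j (lam j) (hlc j) _ (he j), hl1]

end

noncomputable section
open Set Topology unitInterval

variable {A : Fin 12 → Fin 3 → ℂ}

theorem chi_loc (hA : TrOK A) (hN : ND A) {k : Fin 12} (hk : k ≠ 0) :
    ∃ (x : XA A) (γ : Path x x),
      (∀ j, ((Hol hA).val γ).L j = if j = k then 2 * Real.pi * Complex.I else 0) ∧
      ∀ T b r, b ≠ k → r ≠ k → (∀ x y, eta T x y =
        (x k - x r) * (y b - y r) - (x b - x r) * (y k - y r)) → ∀ p q s : ℂ,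
        (∀ z, p * lf A k z + q * lf A b z + s * lf A r z = 0) →
        Complex.exp (((Hol hA).val γ).J T / (2 * Real.pi * Complex.I)) * (s * lf A r x.1) =
          - (q * lf A b x.1) := by
  obtain ⟨n, hn⟩ := exists_normal hN hk
  obtain ⟨y, hyk, hy⟩ : ∃ y, lf A k y = 0 ∧ ∀ j, j ≠ k → lf A j y ≠ 0 := by
    obtain ⟨e, he⟩ := coord_exists (A k 0) (A k 1) (lin_ne hN hk)
    obtain ⟨y, hy, hyk⟩ := (Z_conn hN k (Finset.univ.erase k) (by simp) e he).nonempty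
    refine ⟨y, ?_, fun j hj => hy j (by simp [hj])⟩
    rw [lf_ll]
    have := he y
    rw [hyk] at this
    rw [ll, ← this]; ring
  obtain ⟨ρ, hρ, hs⟩ := exists_small (fun j => ‖lf A j y‖) (fun j => ‖ll A j n‖) k
    (fun j hj => norm_pos_iff.2 (hy j hj))
  have hρ' : (ρ : ℂ) ≠ 0 := by exact_mod_cast hρ.ne'
  let c : Fin 12 → ℂ := fun j => ρ * ll A j n / lf A j y
  have hc : ∀ j, j ≠ k → ‖c j‖ < 1 := by
    intro j hj
    simp only [c, norm_div, norm_mul, Complex.norm_real, Real.norm_eq_abs, abs_of_pos hρ]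
    rw [div_lt_one (norm_pos_iff.2 (hy j hj))]
    exact hs j hj
  let lam : Fin 12 → ℂ → ℂ := fun j s => Complex.log (1 + s * c j)
  have hsl : ∀ j, j ≠ k → ∀ s ∈ Metric.ball (0:ℂ) 1, 1 + s * c j ∈ Complex.slitPlane := by
    intro j hj s hs
    apply Complex.mem_slitPlane_of_norm_lt_one
    rw [norm_mul]
    have := mem_ball_zero_iff.1 hs
    nlinarith [hc j hj, norm_nonneg (c j), norm_nonneg s]
  have hlamd : ∀ j, j ≠ k → DifferentiableOn ℂ (lam j) (Metric.ball 0 1) := by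
    intro j hj s hs
    have h1 : DifferentiableAt ℂ (fun s : ℂ => 1 + s * c j) s := by fun_prop
    exact (h1.clog (hsl j hj s hs)).differentiableWithinAt
  let U : Set ℂ := {ζ | ζ.re < 0}
  have hU : IsOpen U := isOpen_lt Complex.continuous_re continuous_const
  have hUc : Convex ℝ U := convex_halfSpace_re_lt 0
  have hexp : ∀ ζ ∈ U, Complex.exp ζ ∈ Metric.ball (0:ℂ) 1 := by
    intro ζ hζ
    rw [mem_ball_zero_iff, Complex.norm_exp]
    exact Real.exp_lt_one_iff.2 hζ
  let L : ℂ → Fin 12 → ℂ := fun ζ j => if j = k then ζ else lam j (Complex.exp ζ)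
  have hLk : ∀ ζ, L ζ k = ζ := fun ζ => by simp [L]
  have hLj : ∀ ζ j, j ≠ k → L ζ j = lam j (Complex.exp ζ) := fun ζ j hj => by simp [L, hj]
  let Φ : ℂ → ℂ × ℂ := fun ζ => y + (ρ * Complex.exp ζ) • n
  have hΦ : ∀ j ζ, lf A j (Φ ζ) = lf A j y + ρ * Complex.exp ζ * ll A j n := by
    intro j ζ; simp only [Φ, lf_line]
  have hΦj : ∀ j, j ≠ k → ∀ ζ, lf A j (Φ ζ) = lf A j y * (1 + Complex.exp ζ * c j) := by
    intro j hj ζ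
    rw [hΦ]
    have := hy j hj
    simp only [c]
    field_simp
  have hm : MapsTo Φ U (XA A) := by
    intro ζ hζ j
    by_cases hj : j = k
    · subst hj
      rw [hΦ, hyk, hn, zero_add, mul_one]
      exact mul_ne_zero hρ' (Complex.exp_ne_zero _)
    · rw [hΦj j hj]
      exact mul_ne_zero (hy j hj) (Complex.slitPlane_ne_zero (hsl j hj _ (hexp ζ hζ)))
  have hlog : IsLog A Φ U L := by
    intro j
    by_cases hj : j = k
    · subst hj
      refine ⟨(ρ:ℂ)⁻¹, fun ζ _ => ?_⟩
      rw [hLk, hΦ, hyk, hn]; field_simp; ring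
    · refine ⟨(lf A j y)⁻¹, fun ζ hζ => ?_⟩
      rw [hLj _ _ hj, hΦj j hj, inv_mul_cancel_left₀ (hy j hj)]
      exact Complex.exp_log (Complex.slitPlane_ne_zero (hsl j hj _ (hexp ζ hζ)))
  have hLd : ∀ j, DifferentiableOn ℂ (fun ζ => L ζ j) U := by
    intro j
    by_cases hj : j = k
    · subst hj
      simp only [hLk]
      exact differentiableOn_id
    · simp only [hLj _ _ hj]
      exact (hlamd j hj).comp Complex.differentiable_exp.differentiableOn hexp
  have hΦd : ∀ x ∈ U, DifferentiableAt ℂ Φ x := by intro x _; fun_prop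
  obtain ⟨g, hg, hgL⟩ := sec_of_log hA hlog hU hUc (fun j => (hLd j).contDiffOn hU) hΦd hm
  let Φ' : C(U, XA A) := ⟨fun ζ => ⟨Φ ζ, hm ζ.2⟩, by fun_prop⟩
  have h0 : (-1:ℂ) ∈ U := by simp [U]
  have h1 : (-1 + 2 * Real.pi * Complex.I:ℂ) ∈ U := by simp [U]
  have hee : Complex.exp (-1 + 2 * Real.pi * Complex.I) = Complex.exp (-1) := by
    rw [Complex.exp_add, Complex.exp_two_pi_mul_I, mul_one]
  have : PathConnectedSpace U := isPathConnected_iff_pathConnectedSpace.1 (hUc.isPathConnected ⟨_, h0⟩)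
  let P : Path (⟨_, h0⟩ : U) ⟨_, h1⟩ := PathConnectedSpace.somePath _ _
  have hend : Φ' ⟨_, h0⟩ = Φ' ⟨_, h1⟩ := by
    apply Subtype.ext
    simp only [Φ', Φ, ContinuousMap.coe_mk, hee]
  have hv := hol_eval hA hU hΦd hg (by simpa only [hgL] using hlog) Φ' (fun _ => rfl) P
  refine ⟨Φ' ⟨_, h0⟩, (P.map Φ'.continuous).cast rfl hend, ?_, ?_⟩
  · intro j
    rw [PF.cast, hv]
    simp only [Uni.mul_L, Uni.inv_L, hgL, Pi.add_apply, Pi.neg_apply]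
    split_ifs with hj
    · subst hj; rw [hLk, hLk]; ring
    · rw [hLj _ _ hj, hLj _ _ hj, hee]; ring
  intro T b r hb hr heta p q s hrel
  -- the function v
  let v : ℂ → ℂ := fun s => lam b s - lam r s
  have hvd : DifferentiableOn ℂ v (Metric.ball 0 1) := (hlamd b hb).sub (hlamd r hr)
  have hv0 : v 0 = 0 := by simp [v, lam]
  have hbn : Metric.ball (0:ℂ) 1 ∈ 𝓝 (0:ℂ) := Metric.ball_mem_nhds _ one_pos
  have hw : DifferentiableOn ℂ (fun s => dslope v 0 s - v s * deriv (lam r) s) (Metric.ball 0 1) :=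
    ((Complex.differentiableOn_dslope hbn).2 hvd).sub (hvd.mul ((hlamd r hr).deriv Metric.isOpen_ball))
  obtain ⟨W, hW⟩ := hw.isExactOn_ball
  have hJ : ∀ ζ ∈ U, HasDerivAt (fun ζ => (g ζ).J T) (1/2 * ((ζ - lam r (Complex.exp ζ)) *
      (deriv v (Complex.exp ζ) * Complex.exp ζ) - v (Complex.exp ζ) *
      (1 - deriv (lam r) (Complex.exp ζ) * Complex.exp ζ))) ζ := by
    intro ζ hζ
    obtain ⟨D, hD, hDe⟩ := hg.J ζ hζ T
    convert hD.hasDerivAt using 1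
    rw [hDe, heta]
    have hat : ∀ j, j ≠ k → HasDerivAt (lam j) (deriv (lam j) (Complex.exp ζ)) (Complex.exp ζ) :=
      fun j hj => ((hlamd j hj).differentiableAt (Metric.isOpen_ball.mem_nhds (hexp ζ hζ))).hasDerivAt
    have dk : DL (fun y => (g y).L) ζ k 1 = 1 := by
      simp only [DL, hgL, hLk]; simp
    have dj : ∀ j, j ≠ k → DL (fun y => (g y).L) ζ j 1 = deriv (lam j) (Complex.exp ζ) * Complex.exp ζ := by
      intro j hj
      simp only [DL, hgL, hLj _ _ hj]
      rw [fderiv_apply_one_eq_deriv]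
      exact ((hat j hj).comp ζ (Complex.hasDerivAt_exp ζ)).deriv
    have dv : deriv v (Complex.exp ζ) = deriv (lam b) (Complex.exp ζ) - deriv (lam r) (Complex.exp ζ) :=
      ((hat b hb).sub (hat r hr)).deriv
    rw [dk, dj b hb, dj r hr, hgL, hLk, hLj _ _ hb, hLj _ _ hr, dv]
    simp only [v]
    ring
  have hH : ∀ ζ ∈ U, HasDerivAt (fun ζ => 1/2 * ((ζ - lam r (Complex.exp ζ)) * v (Complex.exp ζ))
      - W (Complex.exp ζ)) (1/2 * ((ζ - lam r (Complex.exp ζ)) *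
      (deriv v (Complex.exp ζ) * Complex.exp ζ) - v (Complex.exp ζ) *
      (1 - deriv (lam r) (Complex.exp ζ) * Complex.exp ζ))) ζ := by
    intro ζ hζ
    have he := Complex.hasDerivAt_exp ζ
    have hb' := Metric.isOpen_ball.mem_nhds (hexp ζ hζ)
    have d1 := ((hlamd r hr).differentiableAt hb').hasDerivAt.comp ζ he
    have d2 := (hvd.differentiableAt hb').hasDerivAt.comp ζ he
    have d3 := (hW _ (hexp ζ hζ)).comp ζ he
    have ds : dslope v 0 (Complex.exp ζ) * Complex.exp ζ = v (Complex.exp ζ) := by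
      have := sub_smul_dslope v 0 (Complex.exp ζ)
      rw [sub_zero, hv0, sub_zero, smul_eq_mul] at this
      rw [mul_comm]; exact this
    have d := ((((hasDerivAt_id ζ).sub d1).mul d2).const_mul (1/2)).sub d3
    refine HasDerivAt.congr_deriv d ?_
    simp only [Function.comp, Pi.sub_apply, id]
    linear_combination (-1:ℂ) * ds
  have hcst := const_of_hasFDerivAt hUc (fun ζ hζ => ⟨_, (hJ ζ hζ).hasFDerivAt, (hH ζ hζ).hasFDerivAt⟩)
    h1 h0
  have hval : ((Hol hA).val ((P.map Φ'.continuous).cast rfl hend)).J T =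
      2 * Real.pi * Complex.I * v (Complex.exp (-1)) := by
    rw [PF.cast, hv, Uni.mul_J, Uni.inv_J, Uni.inv_L, heta]
    simp only [hgL, Pi.neg_apply, hLk, hLj _ _ hb, hLj _ _ hr, hee] at hcst ⊢
    simp only [v] at hcst ⊢
    linear_combination hcst
  rw [hval, mul_div_cancel_left₀ _ Complex.two_pi_I_ne_zero]
  have e1 : ∀ j, j ≠ k → lf A j (Φ' ⟨_, h0⟩).1 = lf A j y * Complex.exp (lam j (Complex.exp (-1))) := by
    intro j hj
    rw [show (Φ' ⟨_, h0⟩).1 = Φ (-1) from rfl, hΦj j hj,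
      Complex.exp_log (Complex.slitPlane_ne_zero (hsl j hj _ (hexp _ h0)))]
  rw [e1 b hb, e1 r hr]
  simp only [v, Complex.exp_sub]
  have := hrel y
  rw [hyk] at this
  have h6 := Complex.exp_ne_zero (lam r (Complex.exp (-1)))
  field_simp
  linear_combination this

end

noncomputable section
open Set Topology unitInterval

variable {A : Fin 12 → Fin 3 → ℂ}

/-- the points of multiplicity at least three -/
def pts : Fin 13 → List ℕ :=
  ![[0,8,9,10,11],[1,5,6,7],[0,2,5],[0,3,6],[0,4,7],[1,2,8],[1,3,9],[1,4,10],[2,3,4],[2,6,11],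
    [2,7,10],[3,5,8],[4,6,9]]

def inP (P : Fin 13) (i : ℕ) : Bool := (pts P).contains i

def dep (i j m : ℕ) : Bool := m == i || m == j ||
  (List.finRange 13).any fun P => inP P i && inP P j && inP P m

def DepOK (A : Fin 12 → Fin 3 → ℂ) : Prop :=
  ∀ i j m : Fin 12, i ≠ j → (det3 (A i) (A j) (A m) = 0 ↔ dep i j m = true)

theorem dep_tr : ∀ T, (tr T).1 ≠ (tr T).2.1 ∧ dep (tr T).1 (tr T).2.1 (tr T).2.2 = true := by
  decide +kernel
theorem dep_inf : ∀ k j m : Fin 12, k ≠ j → m ≠ k → dep k j m = true → dep k j 0 = dep k m 0 := by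
  decide +kernel
theorem dep_dist : ∀ j k : Fin 12, j ≠ k → ∃ i : Fin 12, dep j k i = false := by
  decide +kernel
theorem dep_inf' : ∀ k j m : Fin 12, k ≠ 0 → k ≠ j → m ≠ k → dep k j 0 = true → dep k m 0 = dep k j m := by
  decide +kernel

theorem DepOK.tr (h : DepOK A) : TrOK A := fun T => (h _ _ _ (dep_tr T).1).2 (dep_tr T).2

theorem DepOK.nd (h : DepOK A) (h0 : A 0 = ![0, 0, 1]) : ND A := by
  refine ⟨h0, fun j k hjk => ?_⟩
  obtain ⟨i, hi⟩ := dep_dist j k hjk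
  refine ⟨i, fun h2 => ?_⟩
  have h3 : det3 (A j) (A k) (A i) = 0 := by rw [← h2]; simp only [det3]; ring
  rw [(h j k i hjk).1 h3] at hi
  cases hi

theorem tor_ex (h : DepOK A) (h0 : A 0 = ![0, 0, 1]) (k j : Fin 12) (hk : k ≠ 0) (hj : k ≠ j) :
    ∃ x0 w, lf A k x0 = 0 ∧ ll A k w = 0 ∧ (∀ m, m ≠ k → ‖lf A m x0‖ ≠ ‖ll A m w‖) ∧
      ∀ m, m ≠ k → (‖lf A m x0‖ < ‖ll A m w‖ ↔ dep k j m = !(dep k j 0)) := by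
  have hN := h.nd h0
  have d0 : ∀ m, det3 (A k) (A m) (A 0) = A k 0 * A m 1 - A k 1 * A m 0 := by
    intro m; rw [h0]; simp only [det3, Matrix.cons_val]; ring
  let e : ℂ × ℂ := (A k 1, - A k 0)
  have he : ∀ m, ll A m e = - det3 (A k) (A m) (A 0) := by
    intro m; rw [d0]; simp only [ll, e]; ring
  have het : ∀ (t : ℝ) m, 0 < t → ‖ll A m ((t:ℂ) • e)‖ = t * ‖ll A m e‖ := by
    intro t m ht
    have : ll A m ((t:ℂ) • e) = t * ll A m e := by
      simp only [ll, Prod.smul_fst, Prod.smul_snd, smul_eq_mul]; ring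
    rw [this, norm_mul, Complex.norm_real, Real.norm_eq_abs, abs_of_pos ht]
  have hke : ll A k e = 0 := by simp only [ll, e]; ring
  have hez : ∀ m, m ≠ k → (ll A m e = 0 ↔ dep k m 0 = true) := by
    intro m hm
    rw [he, neg_eq_zero]
    exact h k m 0 hm.symm
  cases hd : dep k j 0
  · -- finite point
    have hδ : A k 0 * A j 1 - A k 1 * A j 0 ≠ 0 := by
      rw [← d0]
      intro h2
      have := (h k j 0 hj).1 h2
      rw [Fin.val_zero, hd] at this
      cases this
    set δ := A k 0 * A j 1 - A k 1 * A j 0 with hδe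
    let x0 : ℂ × ℂ := ((A k 1 * A j 2 - A k 2 * A j 1) / δ, (A k 2 * A j 0 - A k 0 * A j 2) / δ)
    have hx0 : ∀ m, lf A m x0 = det3 (A k) (A j) (A m) / δ := by
      intro m; simp only [lf, x0, det3]; field_simp; rw [hδe]; ring
    have hxz : ∀ m, lf A m x0 = 0 ↔ dep k j m = true := by
      intro m
      rw [hx0, div_eq_zero_iff, or_iff_left hδ]
      exact h k j m hj
    obtain ⟨t, ht, hs⟩ := exists_small (fun m => if dep k j m = true then 1 else ‖lf A m x0‖)
      (fun m => if dep k j m = true then 0 else ‖ll A m e‖) k (by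
        intro m hm
        split_ifs with hh
        · exact one_pos
        · exact norm_pos_iff.2 (fun h3 => hh ((hxz m).1 h3)))
    have key : ∀ m, m ≠ k → (dep k j m = true ∧ ‖lf A m x0‖ < ‖ll A m ((t:ℂ) • e)‖) ∨
        (¬ dep k j m = true ∧ ‖ll A m ((t:ℂ) • e)‖ < ‖lf A m x0‖) := by
      intro m hm
      rw [het t m ht]
      by_cases hh : dep k j m = true
      · left
        refine ⟨hh, ?_⟩
        rw [(hxz m).2 hh, norm_zero]
        refine mul_pos ht (norm_pos_iff.2 fun h3 => ?_)
        have h4 := (hez m hm).1 h3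
        rw [← dep_inf k j m hj hm hh, hd] at h4
        cases h4
      · right
        have := hs m hm
        rw [if_neg hh, if_neg hh] at this
        exact ⟨hh, this⟩
    refine ⟨x0, (t:ℂ) • e, ?_, ?_, ?_, ?_⟩
    · rw [hxz]; simp [dep]
    · rw [← norm_eq_zero, het t k ht, hke, norm_zero, mul_zero]
    · intro m hm
      rcases key m hm with h1 | h1
      · exact h1.2.ne
      · exact h1.2.ne'
    · intro m hm
      rcases key m hm with h1 | h1
      · exact iff_of_true h1.2 h1.1
      · exact iff_of_false h1.2.not_gt h1.1
  · obtain ⟨c, hc⟩ : ∃ c, lf A k c = 0 := by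
      obtain ⟨n, hn⟩ := exists_normal hN hk
      refine ⟨(- A k 2) • n, ?_⟩
      simp only [lf, ll, Prod.smul_fst, Prod.smul_snd, smul_eq_mul] at hn ⊢
      linear_combination (- A k 2) * hn
    have hpar : ∀ m, m ≠ k → dep k j m = true → ll A m e = 0 ∧ lf A m c ≠ 0 := by
      intro m hm hh
      have h1 : ll A m e = 0 := by rw [hez m hm, dep_inf' k j m hk hj hm hd, hh]
      refine ⟨h1, fun h2 => ?_⟩
      have h3 : lf A k (c + (1:ℂ) • e) = 0 := by rw [lf_line, hc, hke]; ring
      have h4 : lf A m (c + (1:ℂ) • e) = 0 := by rw [lf_line, h2, h1]; ring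
      have h5 := two_pts hN hm h2 hc h4 h3
      have h6 : e = 0 := by simpa using h5
      rcases lin_ne hN hk with h7 | h7
      · exact h7 (neg_eq_zero.1 (congrArg Prod.snd h6))
      · exact h7 (congrArg Prod.fst h6)
    obtain ⟨t, ht, hs⟩ := exists_small (fun m => if dep k j m = true then 1 else ‖ll A m e‖)
      (fun m => if dep k j m = true then 0 else ‖lf A m c‖) k (by
        intro m hm
        split_ifs with hh
        · exact one_pos
        · refine norm_pos_iff.2 (fun h3 => hh ?_)
          rw [← dep_inf' k j m hk hj hm hd]; exact (hez m hm).1 h3)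
    have ht' : 0 < t⁻¹ := inv_pos.2 ht
    have key : ∀ m, m ≠ k → (dep k j m = false ∧ ‖lf A m c‖ < ‖ll A m ((t⁻¹:ℝ) • e)‖) ∨
        (dep k j m = true ∧ ‖ll A m ((t⁻¹:ℝ) • e)‖ < ‖lf A m c‖) := by
      intro m hm
      rw [show (t⁻¹:ℝ) • e = ((t⁻¹:ℝ):ℂ) • e from (Complex.coe_smul _ _).symm, het _ m ht']
      by_cases hh : dep k j m = true
      · right
        refine ⟨hh, ?_⟩
        rw [(hpar m hm hh).1, norm_zero, mul_zero]
        exact norm_pos_iff.2 (hpar m hm hh).2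
      · left
        have := hs m hm
        rw [if_neg hh, if_neg hh] at this
        refine ⟨by simpa using hh, ?_⟩
        rw [inv_mul_eq_div, lt_div_iff₀ ht, mul_comm]
        exact this
    refine ⟨c, (t⁻¹:ℝ) • e, hc, ?_, ?_, ?_⟩
    · rw [show (t⁻¹:ℝ) • e = ((t⁻¹:ℝ):ℂ) • e from (Complex.coe_smul _ _).symm,
        ← norm_eq_zero, het _ k ht', hke, norm_zero, mul_zero]
    · intro m hm
      rcases key m hm with h1 | h1
      · exact h1.2.ne
      · exact h1.2.ne'
    · intro m hm
      rcases key m hm with h1 | h1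
      · exact iff_of_true h1.2 h1.1
      · exact iff_of_false h1.2.not_gt (by rw [h1.1]; decide)

end

noncomputable section
open Set Topology unitInterval

variable {A : Fin 12 → Fin 3 → ℂ}

structure GD (A : Fin 12 → Fin 3 → ℂ) (G : Type) [Group G] where
  ho : G → Uni
  mul : ∀ g h, ho (g * h) = ho h * ho g
  lin : ∀ {C : Type} [CommGroup C] (q : Multiplicative ℂ →* C), Function.Surjective q →
    ∀ h : G →* C, ∃ a : Fin 12 → ℂ, ∑ k, a k = 0 ∧
      ∀ g, h g = q (Multiplicative.ofAdd (∑ k, a k * (ho g).L k))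
  int : ∀ g k, ∃ n : ℤ, (ho g).L k = n * (2 * Real.pi * Complex.I)
  tor : ∀ k j : Fin 12, k ≠ 0 → k ≠ j → ∃ g h, g * h = h * g ∧
    (∀ m, (ho h).L m = if m = k then 2 * Real.pi * Complex.I else 0) ∧
    ∃ e e' : ℂ, e ≠ 0 ∧ ∀ x : Fin 12 → ℂ, ∑ m, x m = 0 → ∑ m, x m * (ho g).L m =
      2 * Real.pi * Complex.I * (e * (∑ m : Fin 12, if dep k j m = true then x m else 0) + e' * x k)
  bp : ℂ × ℂ
  mem : bp ∈ XA A
  zero : ∀ g, (ho g).L 0 = 0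
  chi : ∀ k, k ≠ 0 → ∃ g, (∀ m, (ho g).L m = if m = k then 2 * Real.pi * Complex.I else 0) ∧
    ∀ T b r, b ≠ k → r ≠ k → (∀ x y, eta T x y =
        (x k - x r) * (y b - y r) - (x b - x r) * (y k - y r)) → ∀ p q s : ℂ,
        (∀ z, p * lf A k z + q * lf A b z + s * lf A r z = 0) →
        Complex.exp ((ho g).J T / (2 * Real.pi * Complex.I)) * (s * lf A r bp) =
          - (q * lf A b bp)

theorem L_zero (hA : TrOK A) (hN : ND A) {a b : XA A} (γ : Path a b) : ((Hol hA).val γ).L 0 = 0 := by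
  have h : ∀ y, Complex.exp ((fun _ : XA A => (0:ℂ)) y) = 1 * lf A 0 (ContinuousMap.id (XA A) y).1 := by
    intro y
    simp [lf, hN.inf]
  have := L_eval hA (ContinuousMap.id _) 0 (fun _ => 0) continuous_const 1 h γ
  simpa using this

theorem tail_L (F : PF (XA A) Uni) {b x : XA A} (τ : Path b x) (γ : Path x x) :
    (F.val (tail τ γ)).L = (F.val γ).L := by
  rw [PF.tail, Uni.mul_L, Uni.mul_L, Uni.inv_L]; abel

def GD.of (h : DepOK A) (h0 : A 0 = ![0, 0, 1]) (b : XA A) {G : Type} [Group G]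
    (e : G ≃* FundamentalGroup (XA A) b) : GD A G where
  ho g := (Hol h.tr).onG (e g)
  mul g k := by rw [map_mul, PF.onG_mul]
  lin {C} _ q hq f := by
    have : PathConnectedSpace (XA A) := XA_pc ⟨_, b.2⟩
    obtain ⟨a, ha⟩ := hom_lin h.tr (h.nd h0) q hq (PF.ofHom
      (fun x => PathConnectedSpace.somePath b x) (f.comp e.symm.toMonoidHom))
    refine ⟨a + Pi.single 0 (- ∑ k, a k), ?_, fun g => ?_⟩
    · simp [Finset.sum_add_distrib]
    · obtain ⟨γ, hγ⟩ := cls_surj (e g)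
      have h1 := ha b γ
      rw [PF.ofHom_loop, hγ] at h1
      rw [← hγ, PF.onG_cls]
      have h2 : f g = (f.comp e.symm.toMonoidHom) (e g) := by simp
      rw [h2, h1]
      congr 2
      refine Finset.sum_congr rfl fun k _ => ?_
      by_cases hk : k = 0
      · subst hk; rw [L_zero h.tr (h.nd h0)]; ring
      · simp [hk]
  int g k := by
    obtain ⟨γ, hγ⟩ := cls_surj (e g)
    rw [← hγ, PF.onG_cls]
    have := exp_L h.tr γ k
    rw [div_self (b.2 k), Complex.exp_eq_one_iff] at this
    exact this
  zero g := by
    obtain ⟨γ, hγ⟩ := cls_surj (e g)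
    rw [← hγ, PF.onG_cls, L_zero h.tr (h.nd h0)]
  tor k j hk hj := by
    have : PathConnectedSpace (XA A) := XA_pc ⟨_, b.2⟩
    obtain ⟨x0, w, h1, h2, h3, h4⟩ := tor_ex h h0 k j hk hj
    obtain ⟨x, γ, γ', hc, hL', hL⟩ := torus h.tr (h.nd h0) hk x0 w h1 h2 h3
    let τ := PathConnectedSpace.somePath b x
    have hkk : dep k j k = true := by simp [dep]
    refine ⟨e.symm (cls (tail τ γ)), e.symm (cls (tail τ γ')), ?_, ?_, ?_⟩
    · rw [← map_mul, ← map_mul, tail_comm τ hc]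
    · intro m
      rw [MulEquiv.apply_symm_apply, PF.onG_cls, tail_L, hL']
    · have hg : ∀ x : Fin 12 → ℂ, ∑ m, x m * ((Hol h.tr).onG (e (e.symm (cls (tail τ γ))))).L m =
          2 * Real.pi * Complex.I * ∑ m : Fin 12, if m ≠ k ∧ dep k j m = !(dep k j 0) then x m else 0 := by
        intro x
        rw [MulEquiv.apply_symm_apply, PF.onG_cls, tail_L, Finset.mul_sum]
        refine Finset.sum_congr rfl fun m _ => ?_
        rw [hL]
        by_cases hm : m = k
        · simp [hm]
        · simp only [h4 m hm]
          split_ifs <;> ring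
      cases hd : dep k j 0
      · refine ⟨1, -1, one_ne_zero, fun x _ => ?_⟩
        rw [hg, hd]
        congr 1
        have e1 : x k = ∑ m, if m = k then x m else 0 := by simp
        rw [e1, one_mul, Finset.mul_sum, ← Finset.sum_add_distrib]
        refine Finset.sum_congr rfl fun m _ => ?_
        by_cases hm : m = k
        · subst hm; simp [hkk]
        · simp [hm]
      · refine ⟨-1, 0, by simp, fun x hx => ?_⟩
        rw [hg, hd]
        congr 1
        rw [← sub_eq_zero, zero_mul, add_zero, neg_one_mul, sub_neg_eq_add,
          ← Finset.sum_add_distrib]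
        refine Eq.trans ?_ hx
        refine Finset.sum_congr rfl fun m _ => ?_
        by_cases hm : m = k
        · subst hm; simp [hkk]
        · simp only [hm, ne_eq, not_false_eq_true, true_and]
          cases dep k j m <;> simp
  bp := b.1
  mem := b.2
  chi k hk := by
    have : PathConnectedSpace (XA A) := XA_pc ⟨_, b.2⟩
    obtain ⟨x, γ, hL, hJ⟩ := chi_loc h.tr (h.nd h0) hk
    let τ := PathConnectedSpace.somePath b x
    refine ⟨e.symm (cls (tail τ γ)), fun m => ?_, ?_⟩
    · rw [MulEquiv.apply_symm_apply, PF.onG_cls, tail_L, hL]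
    intro T i r hi hr heta p q s hrel
    have h1 := hJ T i r hi hr heta p q s hrel
    rw [MulEquiv.apply_symm_apply, PF.onG_cls]
    have e1 : ((Hol h.tr).val (tail τ γ)).J T = ((Hol h.tr).val γ).J T +
        2 * Real.pi * Complex.I * (((Hol h.tr).val τ).L r - ((Hol h.tr).val τ).L i) := by
      rw [PF.tail, Uni.mul_J, Uni.mul_J, Uni.inv_J, Uni.mul_L, Uni.inv_L, heta, heta]
      simp only [Pi.add_apply, Pi.neg_apply, hL, hi, hr, if_true, if_false]
      ring
    rw [e1, add_div, mul_div_cancel_left₀ _ Complex.two_pi_I_ne_zero, Complex.exp_add,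
      Complex.exp_sub, exp_L h.tr τ, exp_L h.tr τ]
    have n1 := b.2 i
    have n2 := b.2 r
    have n3 := x.2 i
    field_simp
    linear_combination h1

end

noncomputable section
open Set Topology unitInterval

def nzm : ℕ := 10136192686717992071557774187890047096705020

def edg (i j : ℕ) : ℕ := Nat.add (Nat.mul 12 i) j
def mn (i j : ℕ) : ℕ := cond (Nat.ble i j) (edg i j) (edg j i)
def enc (e f : ℕ) : ℕ := Nat.add (Nat.mul 144 e) f
def tb (s n : ℕ) : Bool := Nat.beq (Nat.land (Nat.shiftRight s n) 1) 1

def tz (s i j k l : ℕ) : Bool :=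
  cond (tb nzm (edg i j)) (cond (tb nzm (edg k l)) (cond (tb s (enc (mn i j) (mn k l))) true
    (tb s (enc (mn k l) (mn i j)))) true) true

def cnd (P Q : List ℕ) (i j k l s : ℕ) : Bool :=
  (tz s i k j l && tz s i l j k) ||
  P.all (fun m => Nat.beq m i || Nat.beq m j || tz s m j k l) ||
  P.all (fun m => Nat.beq m i || Nat.beq m j || tz s m i k l) ||
  Q.all (fun m => Nat.beq m k || Nat.beq m l || tz s i j m l) ||
  Q.all (fun m => Nat.beq m k || Nat.beq m l || tz s i j m k)

def stp (P Q : List ℕ) (e f : ℕ × ℕ) (s : ℕ) : ℕ :=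
  bif tz s e.1 e.2 f.1 f.2 then s else
  bif cnd P Q e.1 e.2 f.1 f.2 s then Nat.lor s (Nat.pow 2 (enc (edg e.1 e.2) (edg f.1 f.2))) else s

def prs : List ℕ → List (ℕ × ℕ)
  | [] => []
  | a :: t => t.map (fun b => (a, b)) ++ prs t

def frc (s : ℕ) (F : ℕ → ℕ) : ℕ := Nat.rec (F 0) (fun k _ => F (k + 1)) s

def fld {α : Type} (f : ℕ → α → ℕ) : List α → ℕ → ℕ
  | [], s => s
  | a :: t, s => frc (f s a) (fld f t)

def blk (P Q : List ℕ) (s : ℕ) : ℕ :=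
  fld (fun s e => fld (fun s f => stp P Q e f s) (prs Q) s) (prs P) s

def rnd : List (List ℕ) → ℕ → ℕ
  | [], s => s
  | P :: t, s => frc (fld (fun s Q => blk P Q s) t s) (rnd t)

def ptl : List (List ℕ) :=
  [[0,8,9,10,11],[1,5,6,7],[0,2,5],[0,3,6],[0,4,7],[1,2,8],[1,3,9],[1,4,10],[2,3,4],[2,6,11],
    [2,7,10],[3,5,8],[4,6,9]]

theorem ptl_eq : ptl = (List.finRange 13).map pts := by decide

def fin6 : ℕ := fld (fun s _ => rnd ptl s) [1,2,3,4,5,6] 0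

def chk (s : ℕ) : Bool := ptl.all fun P => ptl.all fun Q => P == Q ||
  (prs P).all fun e => (prs Q).all fun f => tz s e.1 e.2 f.1 f.2

theorem chk_ok : (Nat.rec (chk 0) (fun k _ => chk (k+1)) fin6 : Bool) = true := by decide +kernel

end

noncomputable section
open Set Topology unitInterval

theorem tb_eq (s n : ℕ) : tb s n = s.testBit n := by
  have h : ∀ m : ℕ, Nat.beq (Nat.land m 1) 1 = (1 &&& m != 0) := by
    intro m
    change Nat.beq (m &&& 1) 1 = _
    rw [Nat.land_comm 1 m, Nat.and_one_is_mod]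
    rcases Nat.mod_two_eq_zero_or_one m with h | h <;> rw [h] <;> rfl
  exact h _

theorem frc_eq (s : ℕ) (F : ℕ → ℕ) : frc s F = F s := by cases s <;> rfl

theorem fld_inv {α : Type} (Q0 : ℕ → Prop) (f : ℕ → α → ℕ) : ∀ (l : List α) (s : ℕ),
    (∀ s a, a ∈ l → Q0 s → Q0 (f s a)) → Q0 s → Q0 (fld f l s)
  | [], _, _, h => h
  | a :: t, s, hf, h => by
    rw [fld, frc_eq]
    exact fld_inv Q0 f t _ (fun s b hb => hf s b (List.mem_cons_of_mem _ hb))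
      (hf _ _ List.mem_cons_self h)

theorem mem_prs {e : ℕ × ℕ} : ∀ {P : List ℕ}, e ∈ prs P → e.1 ∈ P ∧ e.2 ∈ P
  | [], h => by simp [prs] at h
  | a :: t, h => by
    rw [prs, List.mem_append] at h
    rcases h with h | h
    · obtain ⟨b, hb, rfl⟩ := List.mem_map.1 h
      exact ⟨List.mem_cons_self, List.mem_cons_of_mem _ hb⟩
    · exact ⟨List.mem_cons_of_mem _ (mem_prs h).1, List.mem_cons_of_mem _ (mem_prs h).2⟩

theorem pt_lt : ∀ P ∈ ptl, ∀ i ∈ P, i < 12 := by decide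
theorem pt_pr : ∀ P, ∀ i j : Fin 12, i.val < j.val → inP P i = true → inP P j = true →
  (i.val, j.val) ∈ prs (pts P) := by decide +kernel
theorem nz_dep : ∀ i j : Fin 12, i ≠ j → tb nzm (edg i j) = false →
    ∀ m : Fin 12, dep j i m = true ↔ (m = i ∨ m = j) := by decide +kernel
theorem nz_refl : ∀ i : Fin 12, tb nzm (edg i i) = false := by decide +kernel
theorem dep_pt : ∀ P, ∀ i j : Fin 12, i ≠ j → inP P i = true → inP P j = true →
    ∀ m : Fin 12, dep j i m = inP P m := by decide +kernel
theorem pt_two : ∀ P, ∀ j : Fin 12, ∃ i : Fin 12, i ≠ j ∧ inP P i = true := by decide +kernel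
theorem nz_pt : ∀ i j : Fin 12, tb nzm (edg i j) = true → ∃ P, inP P i = true ∧ inP P j = true := by
  decide +kernel

section
variable (x y : Fin 12 → ℂ)

def cN (i : ℕ) : Fin 12 := Fin.ofNat 12 i
theorem cN_val {i : ℕ} (h : i < 12) : (cN i).val = i := Nat.mod_eq_of_lt h
theorem cN_fin (m : Fin 12) : cN m.val = m := Fin.ext (cN_val m.2)
def DN (i j : ℕ) : ℂ := x (cN i) * y (cN j) - x (cN j) * y (cN i)
def DE (e : ℕ) : ℂ := DN x y (e / 12) (e % 12)

theorem DN_anti (i j) : DN x y i j = - DN x y j i := by simp only [DN]; ring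

theorem DE_edg {i j : ℕ} (hj : j < 12) : DE x y (edg i j) = DN x y i j := by
  have h1 : edg i j = 12 * i + j := rfl
  rw [DE, h1]
  congr 1 <;> omega

theorem DE_mn {i j : ℕ} (hi : i < 12) (hj : j < 12) :
    DE x y (mn i j) = DN x y i j ∨ DE x y (mn i j) = - DN x y i j := by
  rw [mn]
  cases Nat.ble i j
  · right; rw [cond_false, DE_edg x y hi, DN_anti]
  · left; rw [cond_true, DE_edg x y hj]

theorem mn_lt {i j : ℕ} (hi : i < 12) (hj : j < 12) : mn i j < 144 := by
  have h1 : ∀ i j, edg i j = 12 * i + j := fun _ _ => rfl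
  rw [mn]
  cases Nat.ble i j <;> simp only [cond_false, cond_true, h1] <;> omega

def GS (s : ℕ) : Prop := ∀ n, tb s n = true → DE x y (n / 144) * DE x y (n % 144) = 0

def Row : Prop := ∀ k j : Fin 12, k ≠ 0 → k ≠ j →
  ∑ m : Fin 12, (if dep k j m = true then x m * y k - x k * y m else 0) = 0

variable {x y}

theorem GS.enc {s e f : ℕ} (h : GS x y s) (hf : f < 144) (ht : tb s (enc e f) = true) :
    DE x y e * DE x y f = 0 := by
  have h1 : _root_.enc e f = 144 * e + f := rfl
  have := h _ ht
  rw [h1] at this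
  rwa [show (144 * e + f) / 144 = e by omega, show (144 * e + f) % 144 = f by omega] at this

theorem Row.dbl (h : Row x y) {i j : ℕ} (hi : i < 12) (hj : j < 12) (hz : tb nzm (edg i j) = false) :
    DN x y i j = 0 := by
  have key : ∀ i j : Fin 12, j ≠ 0 → i ≠ j → (∀ m : Fin 12, dep j i m = true ↔ (m = i ∨ m = j)) →
      x i * y j - x j * y i = 0 := by
    intro i j hj hij hd
    have hh := h j i hj hij.symm
    rw [Finset.sum_eq_single i] at hh
    · rwa [if_pos ((hd i).2 (Or.inl rfl))] at hh
    · intro m _ hm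
      split_ifs with h1
      · rcases (hd m).1 h1 with h2 | h2
        · exact absurd h2 hm
        · rw [h2]; ring
      · rfl
    · simp
  have e1 : (cN i).val = i := cN_val hi
  have e2 : (cN j).val = j := cN_val hj
  by_cases hij : (cN i) = (cN j)
  · rw [DN, hij]; ring
  have hd := nz_dep (cN i) (cN j) hij (by rw [e1, e2]; exact hz)
  by_cases hj0 : (cN j) = 0
  · have hi0 : (cN i) ≠ 0 := fun h2 => hij (h2.trans hj0.symm)
    have hd' : ∀ m : Fin 12, dep (cN i).val (cN j).val m = true ↔
        (m = (cN j) ∨ m = (cN i)) := by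
      intro m
      rw [or_comm, ← hd m]
      simp only [dep, Bool.or_eq_true, List.any_eq_true, Bool.and_eq_true, beq_iff_eq]
      constructor
      · rintro ((h1 | h1) | ⟨P, h1, ⟨h2, h3⟩, h4⟩)
        · exact Or.inl (Or.inr h1)
        · exact Or.inl (Or.inl h1)
        · exact Or.inr ⟨P, h1, ⟨h3, h2⟩, h4⟩
      · rintro ((h1 | h1) | ⟨P, h1, ⟨h2, h3⟩, h4⟩)
        · exact Or.inl (Or.inr h1)
        · exact Or.inl (Or.inl h1)
        · exact Or.inr ⟨P, h1, ⟨h3, h2⟩, h4⟩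
    have := key _ _ hi0 (Ne.symm hij) hd'
    rw [DN]
    linear_combination -this
  · exact key _ _ hj0 hij hd

theorem Row.pt (h : Row x y) (P) {j : Fin 12} (hj : inP P j = true) :
    ∑ m : Fin 12, (if inP P m = true then x m * y j - x j * y m else 0) = 0 := by
  have h1 : ∀ j : Fin 12, j ≠ 0 → inP P j = true →
      ∑ m : Fin 12, (if inP P m = true then x m * y j - x j * y m else 0) = 0 := by
    intro j hj0 hj
    obtain ⟨i, hij, hi⟩ := pt_two P j
    refine Eq.trans ?_ (h j i hj0 hij.symm)
    refine Finset.sum_congr rfl fun m _ => ?_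
    rw [dep_pt P i j hij hi hj m]
  by_cases hj0 : j = 0
  · have h2 : ∑ k : Fin 12, (if inP P k = true then ∑ m : Fin 12, (if inP P m = true then
        x m * y k - x k * y m else 0) else 0) = 0 := by
      have e : ∀ k : Fin 12, (if inP P k = true then ∑ m : Fin 12, (if inP P m = true then
        x m * y k - x k * y m else 0) else 0) = ∑ m : Fin 12, (if inP P k = true then
          (if inP P m = true then x m * y k else 0) else 0) - ∑ m : Fin 12, (if inP P m = true then
          (if inP P k = true then x k * y m else 0) else 0) := by
        intro k
        rw [← Finset.sum_sub_distrib]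
        split_ifs with hk
        · refine Finset.sum_congr rfl fun m _ => ?_
          split_ifs <;> simp
        · simp
      rw [Finset.sum_congr rfl fun k _ => e k, Finset.sum_sub_distrib, sub_eq_zero, Finset.sum_comm]
    rw [Finset.sum_eq_single 0] at h2
    · subst hj0; rwa [if_pos hj] at h2
    · intro k _ hk
      split_ifs with h3
      · exact h1 k hk h3
      · rfl
    · simp
  · exact h1 j hj0 hj

theorem tz_sound (h : Row x y) {s : ℕ} (hs : GS x y s) {i j k l : ℕ} (hi : i < 12) (hj : j < 12)
    (hk : k < 12) (hl : l < 12) (ht : tz s i j k l = true) : DN x y i j * DN x y k l = 0 := by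
  rw [tz] at ht
  cases h1 : tb nzm (edg i j)
  · rw [h.dbl hi hj h1, zero_mul]
  cases h2 : tb nzm (edg k l)
  · rw [h.dbl hk hl h2, mul_zero]
  rw [h1, h2, cond_true, cond_true] at ht
  have h3 : DE x y (mn i j) * DE x y (mn k l) = 0 := by
    cases h4 : tb s (enc (mn i j) (mn k l))
    · rw [h4, cond_false] at ht
      rw [mul_comm]
      exact hs.enc (mn_lt hi hj) ht
    · exact hs.enc (mn_lt hk hl) h4
  rcases DE_mn x y hi hj with h5 | h5 <;> rcases DE_mn x y hk hl with h6 | h6 <;>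
    rw [h5, h6] at h3 <;> simpa using h3

theorem row_sound (h : Row x y) (P) {i j : ℕ} (hi : i ∈ pts P) (hj : j ∈ pts P)
    (hi' : i < 12) (hj' : j < 12) (c : ℂ)
    (ha : ∀ m ∈ pts P, m < 12 → m = i ∨ m = j ∨ DN x y m j * c = 0) : DN x y i j * c = 0 := by
  have e1 : (cN i).val = i := cN_val hi'
  have e2 : (cN j).val = j := cN_val hj'
  have h1 := h.pt P (j := cN j) (by rw [e2]; simpa [inP] using hj)
  have h2 : (∑ m : Fin 12, (if inP P m = true then x m * y (cN j) - x (cN j) * y m else 0)) * c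
    = 0 := by rw [h1, zero_mul]
  rw [Finset.sum_mul, Finset.sum_eq_single (cN i)] at h2
  · rwa [if_pos (by rw [e1]; simpa [inP] using hi)] at h2
  · intro m _ hm
    split_ifs with h3
    · rcases ha m (by simpa [inP] using h3) m.2 with h4 | h4 | h4
      · exact absurd (by rw [← h4, cN_fin]) hm
      · rw [← h4, cN_fin]; ring
      · rwa [DN, cN_fin] at h4
    · rw [zero_mul]
  · simp

theorem stp_sound (h : Row x y) (P Q : Fin 13) {e f : ℕ × ℕ} (he : e ∈ prs (pts P))
    (hf : f ∈ prs (pts Q)) {s : ℕ} (hs : GS x y s) : GS x y (stp (pts P) (pts Q) e f s) := by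
  have hP : ∀ P, ∀ i ∈ pts P, i < 12 := by
    intro P; exact pt_lt _ (by rw [ptl_eq]; exact List.mem_map_of_mem (List.mem_finRange P))
  obtain ⟨i, j⟩ := e
  obtain ⟨k, l⟩ := f
  obtain ⟨hi, hj⟩ := mem_prs he
  obtain ⟨hk, hl⟩ := mem_prs hf
  simp only at hi hj hk hl
  have hi' := hP _ _ hi
  have hj' := hP _ _ hj
  have hk' := hP _ _ hk
  have hl' := hP _ _ hl
  rw [stp]
  cases tz s i j k l
  · rw [cond_false]
    cases hc : cnd (pts P) (pts Q) i j k l s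
    · rwa [cond_false]
    rw [cond_true]
    have key : DN x y i j * DN x y k l = 0 := by
      simp only [cnd, Bool.or_eq_true, Bool.and_eq_true, List.all_eq_true, Nat.beq_eq, or_assoc] at hc
      rcases hc with hc | hc | hc | hc | hc
      · have h1 := tz_sound h hs hi' hk' hj' hl' hc.1
        have h2 := tz_sound h hs hi' hl' hj' hk' hc.2
        simp only [DN] at h1 h2 ⊢
        linear_combination h1 - h2
      · exact row_sound h P hi hj hi' hj' _ fun m hm hm' =>
          (hc m hm).imp id (Or.imp id fun h3 => tz_sound h hs hm' hj' hk' hl' h3)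
      · rw [DN_anti, neg_mul, neg_eq_zero]
        exact row_sound h P hj hi hj' hi' _ fun m hm hm' => by
          rcases hc m hm with h3 | h3 | h3
          · exact Or.inr (Or.inl h3)
          · exact Or.inl h3
          · exact Or.inr (Or.inr (tz_sound h hs hm' hi' hk' hl' h3))
      · rw [mul_comm]
        exact row_sound h Q hk hl hk' hl' _ fun m hm hm' =>
          (hc m hm).imp id (Or.imp id fun h3 => by
            rw [mul_comm]; exact tz_sound h hs hi' hj' hm' hl' h3)
      · rw [mul_comm, DN_anti, neg_mul, neg_eq_zero]
        exact row_sound h Q hl hk hl' hk' _ fun m hm hm' => by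
          rcases hc m hm with h3 | h3 | h3
          · exact Or.inr (Or.inl h3)
          · exact Or.inl h3
          · exact Or.inr (Or.inr (by rw [mul_comm]; exact tz_sound h hs hi' hj' hm' hk' h3))
    intro n hn
    have e1 : Nat.lor s (Nat.pow 2 (enc (edg i j) (edg k l))) = s ||| 2 ^ (enc (edg i j) (edg k l)) := rfl
    rw [e1, tb_eq, Nat.testBit_or, Bool.or_eq_true, Nat.testBit_two_pow, decide_eq_true_eq] at hn
    rcases hn with hn | hn
    · exact hs n (by rw [tb_eq, hn])
    · have e2 : enc (edg i j) (edg k l) = 144 * edg i j + edg k l := rfl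
      have e3 : edg k l = 12 * k + l := rfl
      rw [← hn, e2, show (144 * edg i j + edg k l) / 144 = edg i j by omega,
        show (144 * edg i j + edg k l) % 144 = edg k l by omega, DE_edg x y hj', DE_edg x y hl', key]
  · rwa [cond_true]

theorem rnd_sound (h : Row x y) : ∀ (t : List (List ℕ)) (s : ℕ), (∀ P ∈ t, P ∈ ptl) → GS x y s →
    GS x y (rnd t s)
  | [], _, _, hs => hs
  | P :: t, s, ht, hs => by
    rw [rnd, frc_eq]
    refine rnd_sound h t _ (fun Q hQ => ht Q (List.mem_cons_of_mem _ hQ)) ?_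
    refine fld_inv (GS x y) _ t s (fun s Q hQ hs => ?_) hs
    have h1 := ht P List.mem_cons_self
    have h2 := ht Q (List.mem_cons_of_mem _ hQ)
    rw [ptl_eq, List.mem_map] at h1 h2
    obtain ⟨P', _, rfl⟩ := h1
    obtain ⟨Q', _, rfl⟩ := h2
    refine fld_inv (GS x y) _ _ s (fun s e he hs => ?_) hs
    exact fld_inv (GS x y) _ _ s (fun s f hf hs => stp_sound h P' Q' he hf hs) hs

theorem resonance (h : Row x y) : (∀ i j, x i * y j = x j * y i) ∨
    ∃ P, ∀ m : Fin 12, inP P m = false → x m = 0 ∧ y m = 0 := by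
  have hG : GS x y fin6 := fld_inv (GS x y) _ _ _ (fun s _ _ hs => rnd_sound h ptl s (fun _ h => h) hs)
    (fun n hn => by rw [tb_eq, Nat.zero_testBit] at hn; cases hn)
  have hc : chk fin6 = true := by
    have := chk_ok
    revert this
    cases fin6 <;> exact fun h => h
  have hlt : ∀ (P : Fin 13) (Q : Fin 13), P ≠ Q → ∀ i j k l : Fin 12, i.val < j.val → k.val < l.val →
      inP P i = true → inP P j = true → inP Q k = true → inP Q l = true →
      DN x y i j * DN x y k l = 0 := by
    intro P Q hPQ i j k l hij hkl hi hj hk hl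
    simp only [chk, ptl_eq, List.all_eq_true, List.mem_map, List.mem_finRange, true_and,
      forall_exists_index, forall_apply_eq_imp_iff, Bool.or_eq_true, beq_iff_eq] at hc
    rcases hc P Q with h1 | h1
    · have : ∀ P Q, pts P = pts Q → P = Q := by decide +kernel
      exact absurd (this _ _ h1) hPQ
    · exact tz_sound h hG i.2 j.2 k.2 l.2 (h1 _ (pt_pr P i j hij hi hj) _ (pt_pr Q k l hkl hk hl))
  have hall : ∀ (P : Fin 13) (Q : Fin 13), P ≠ Q → ∀ i j k l : Fin 12,
      inP P i = true → inP P j = true → inP Q k = true → inP Q l = true →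
      DN x y i j * DN x y k l = 0 := by
    intro P Q hPQ i j k l hi hj hk hl
    have z : ∀ i : ℕ, DN x y i i = 0 := fun i => by rw [DN]; ring
    rcases lt_trichotomy i.val j.val with h1 | h1 | h1
    · rcases lt_trichotomy k.val l.val with h2 | h2 | h2
      · exact hlt P Q hPQ i j k l h1 h2 hi hj hk hl
      · rw [h2, z, mul_zero]
      · rw [DN_anti x y k l, mul_neg, neg_eq_zero]
        exact hlt P Q hPQ i j l k h1 h2 hi hj hl hk
    · rw [h1, z, zero_mul]
    · rw [DN_anti x y i j, neg_mul, neg_eq_zero]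
      rcases lt_trichotomy k.val l.val with h2 | h2 | h2
      · exact hlt P Q hPQ j i k l h1 h2 hj hi hk hl
      · rw [h2, z, mul_zero]
      · rw [DN_anti x y k l, mul_neg, neg_eq_zero]
        exact hlt P Q hPQ j i l k h1 h2 hj hi hl hk
  have hD : ∀ i j : Fin 12, DN x y i j = x i * y j - x j * y i := by
    intro i j; rw [DN, cN_fin, cN_fin]
  by_cases h0 : ∀ i j, x i * y j = x j * y i
  · exact Or.inl h0
  push Not at h0
  obtain ⟨i, j, hij⟩ := h0
  have hij' : DN x y i j ≠ 0 := by rw [hD]; exact sub_ne_zero.2 hij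
  obtain ⟨P, hi, hj⟩ := nz_pt i j (by
    by_contra h1
    exact hij' (h.dbl i.2 j.2 (by simpa using h1)))
  refine Or.inr ⟨P, fun m hm => ?_⟩
  have hz : ∀ k : Fin 12, DN x y k m = 0 := by
    intro k
    by_cases h1 : tb nzm (edg k m) = true
    · obtain ⟨Q, hk, hm'⟩ := nz_pt k m h1
      have : P ≠ Q := by rintro rfl; rw [hm] at hm'; cases hm'
      exact (mul_eq_zero.1 (hall P Q this i j k m hi hj hk hm')).resolve_left hij'
    · exact h.dbl k.2 m.2 (by simpa using h1)
  have h1 := hz i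
  have h2 := hz j
  rw [hD] at h1 h2 hij'
  constructor
  · refine (mul_eq_zero.1 (?_ : (x i * y j - x j * y i) * x m = 0)).resolve_left hij'
    linear_combination x j * h1 - x i * h2
  · refine (mul_eq_zero.1 (?_ : (x i * y j - x j * y i) * y m = 0)).resolve_left hij'
    linear_combination y j * h1 - y i * h2
end

end

noncomputable section
open Set Topology unitInterval

variable {A B : Fin 12 → Fin 3 → ℂ} {G : Type} [Group G]

def fn (X : GD A G) (x : Fin 12 → ℂ) (g : G) : ℂ := ∑ m, x m * (X.ho g).L m

theorem fn_mul (X : GD A G) (x g h) : fn X x (g * h) = fn X x g + fn X x h := by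
  rw [fn, fn, fn, ← Finset.sum_add_distrib]
  refine Finset.sum_congr rfl fun m _ => ?_
  rw [X.mul, Uni.mul_L, Pi.add_apply]; ring

theorem tpi : (2 * Real.pi * Complex.I : ℂ) ≠ 0 := Complex.two_pi_I_ne_zero

theorem GD.ext0 (X : GD A G) {x : Fin 12 → ℂ} (hx : ∑ m, x m = 0) (h : ∀ g, fn X x g = 0) : x = 0 := by
  have h1 : ∀ k, k ≠ 0 → x k = 0 := by
    intro k hk
    obtain ⟨g, hg, _⟩ := X.chi k hk
    have := h g
    simp only [fn, hg, mul_ite, mul_zero, Finset.sum_ite_eq', Finset.mem_univ, if_true] at this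
    exact (mul_eq_zero.1 this).resolve_right tpi
  funext k
  by_cases hk : k = 0
  · rw [Finset.sum_eq_single 0 (fun k _ hk => h1 k hk) (by simp)] at hx
    rw [hk]; exact hx
  · exact h1 k hk

theorem GD.lin1 (X : GD A G) (f : G → ℂ) (hf : ∀ g h, f (g * h) = f g + f h) :
    ∃ a : Fin 12 → ℂ, ∑ k, a k = 0 ∧ ∀ g, f g = fn X a g := by
  obtain ⟨a, ha, h⟩ := X.lin (MonoidHom.id (Multiplicative ℂ)) Function.surjective_id
    (MonoidHom.mk' (fun g => Multiplicative.ofAdd (f g)) (fun g h => by rw [hf, ofAdd_add]))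
  exact ⟨a, ha, fun g => Multiplicative.ofAdd.injective (h g)⟩

theorem GD.trans (X : GD A G) (Y : GD B G) : ∃ F : (Fin 12 → ℂ) →ₗ[ℂ] (Fin 12 → ℂ),
    (∀ x, ∑ m, F x m = 0) ∧ ∀ x g, fn Y x g = fn X (F x) g := by
  have h : ∀ j, ∃ a : Fin 12 → ℂ, ∑ k, a k = 0 ∧ ∀ g, (Y.ho g).L j = fn X a g := fun j =>
    X.lin1 (fun g => (Y.ho g).L j) (fun g h => by rw [Y.mul, Uni.mul_L, Pi.add_apply, add_comm])
  choose M hM hL using h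
  refine ⟨(Matrix.of M).vecMulLinear, fun x => ?_, fun x g => ?_⟩
  · simp only [Matrix.vecMulLinear_apply, Matrix.vecMul, dotProduct, Matrix.of_apply]
    rw [Finset.sum_comm]
    exact Finset.sum_eq_zero fun j _ => by rw [← Finset.mul_sum, hM, mul_zero]
  · simp only [fn, Matrix.vecMulLinear_apply, Matrix.vecMul, dotProduct, Matrix.of_apply, hL,
      Finset.sum_mul, Finset.mul_sum]
    rw [Finset.sum_comm]
    exact Finset.sum_congr rfl fun k _ => Finset.sum_congr rfl fun j _ => by ring

def sS (k j : Fin 12) (x : Fin 12 → ℂ) : ℂ := ∑ m : Fin 12, if dep k j m = true then x m else 0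

theorem GD.row (X : GD A G) {ι : Type} [Fintype ι] (x y : ι → Fin 12 → ℂ) (hx : ∀ t, ∑ m, x t m = 0)
    (hy : ∀ t, ∑ m, y t m = 0)
    (h : ∀ g h, g * h = h * g → ∑ t, (fn X (x t) g * fn X (y t) h - fn X (x t) h * fn X (y t) g) = 0)
    (k j : Fin 12) (hk : k ≠ 0) (hj : k ≠ j) :
    ∑ t, (sS k j (x t) * y t k - x t k * sS k j (y t)) = 0 := by
  obtain ⟨g, g', hc, hL, e, e', he, hg⟩ := X.tor k j hk hj
  have h1 : ∀ x, fn X x g' = 2 * Real.pi * Complex.I * x k := by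
    intro x
    simp only [fn, hL, mul_ite, mul_zero, Finset.sum_ite_eq', Finset.mem_univ, if_true]
    ring
  have h2 : ∀ x, ∑ m, x m = 0 → fn X x g = 2 * Real.pi * Complex.I * (e * sS k j x + e' * x k) := hg
  have h3 := h g g' hc
  have h4 : (2 * Real.pi * Complex.I) ^ 2 * e * ∑ t, (sS k j (x t) * y t k - x t k * sS k j (y t)) = 0 := by
    refine Eq.trans ?_ h3
    rw [Finset.mul_sum]
    refine Finset.sum_congr rfl fun t _ => ?_
    rw [h1, h1, h2 _ (hx t), h2 _ (hy t)]; ring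
  exact (mul_eq_zero.1 h4).resolve_left (mul_ne_zero (pow_ne_zero _ tpi) he)

theorem GD.Row (X : GD A G) {x y : Fin 12 → ℂ} (hx : ∑ m, x m = 0) (hy : ∑ m, y m = 0)
    (h : ∀ g h, g * h = h * g → fn X x g * fn X y h = fn X x h * fn X y g) : Row x y := by
  intro k j hk hj
  have := X.row (ι := Unit) (fun _ => x) (fun _ => y) (fun _ => hx) (fun _ => hy)
    (fun g h' hc => by simp [h g h' hc]) k j hk hj
  rw [Fintype.sum_unique] at this
  refine Eq.trans ?_ this
  rw [sS, sS, Finset.sum_mul, Finset.mul_sum, ← Finset.sum_sub_distrib]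
  refine Finset.sum_congr rfl fun m _ => ?_
  split_ifs <;> ring

def vs (P : Fin 13) (x : Fin 12 → ℂ) : Prop := ∑ m, x m = 0 ∧ ∀ m : Fin 12, inP P m = false → x m = 0

theorem pairs : ∀ P, ∃ r : Fin 12, inP P r = true ∧ ∀ m n : Fin 12, inP P m = true → inP P n = true →
    m = n ∨ m = r ∨ n = r ∨ ∃ T, tr T = (m, n, r) ∨ tr T = (n, m, r) := by decide +kernel

theorem vs_comm {P x y} (hx : vs P x) (hy : vs P y) (l l' : Fin 12 → ℂ) (h : ∀ T, eta T l l' = 0) :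
    (∑ m, x m * l m) * (∑ m, y m * l' m) = (∑ m, x m * l' m) * (∑ m, y m * l m) := by
  obtain ⟨r, _, hr⟩ := pairs P
  have e : ∀ x, vs P x → ∀ l : Fin 12 → ℂ, ∑ m, x m * l m = ∑ m, x m * (l m - l r) := by
    intro x hx l
    simp only [mul_sub, Finset.sum_sub_distrib, ← Finset.sum_mul, hx.1]; ring
  have hp : ∀ m n : Fin 12, inP P m = true → inP P n = true →
      (l m - l r) * (l' n - l' r) = (l' m - l' r) * (l n - l r) := by
    intro m n hm hn
    rcases hr m n hm hn with rfl | rfl | rfl | ⟨T, hT | hT⟩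
    · ring
    · ring
    · ring
    · have := h T
      simp only [eta, uu, vv, hT] at this
      linear_combination this
    · have := h T
      simp only [eta, uu, vv, hT] at this
      linear_combination -this
  rw [e x hx l, e y hy l', e x hx l', e y hy l, Finset.sum_mul_sum, Finset.sum_mul_sum]
  refine Finset.sum_congr rfl fun m _ => Finset.sum_congr rfl fun n _ => ?_
  by_cases hm : inP P m = true
  · by_cases hn : inP P n = true
    · linear_combination x m * y n * hp m n hm hn
    · rw [hy.2 n (by simpa using hn)]; ring
  · rw [hx.2 m (by simpa using hm)]; ring

theorem two_supp {x : Fin 12 → ℂ} (hx : ∑ m, x m = 0) (h : x ≠ 0) : ∃ i j, i ≠ j ∧ x i ≠ 0 ∧ x j ≠ 0 := by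
  obtain ⟨i, hi⟩ := Function.ne_iff.1 h
  by_contra h1
  push Not at h1
  rw [Finset.sum_eq_single i (fun j _ hj => h1 i j hj.symm hi) (by simp)] at hx
  exact hi hx

theorem pt_one : ∀ P Q : Fin 13, P ≠ Q → ∀ i j : Fin 12, inP P i = true → inP P j = true →
    inP Q i = true → inP Q j = true → i = j := by decide +kernel

theorem vs_mem {P x} (hx : vs P x) {i : Fin 12} (h : x i ≠ 0) : inP P i = true := by
  by_contra h1
  exact h (hx.2 i (by simpa using h1))

theorem vs_uniq {P Q x} (hP : vs P x) (hQ : vs Q x) (h : x ≠ 0) : P = Q := by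
  by_contra hn
  obtain ⟨i, j, hij, hi, hj⟩ := two_supp hP.1 h
  exact hij (pt_one P Q hn i j (vs_mem hP hi) (vs_mem hP hj) (vs_mem hQ hi) (vs_mem hQ hj))

theorem pt_three : ∀ P, ∃ a b c : Fin 12, a ≠ b ∧ a ≠ c ∧ b ≠ c ∧ inP P a = true ∧ inP P b = true ∧
    inP P c = true := by decide +kernel

def dl (a b : Fin 12) : Fin 12 → ℂ := Pi.single a 1 - Pi.single b 1

theorem dl_vs {P} {a b : Fin 12} (ha : inP P a = true) (hb : inP P b = true) : vs P (dl a b) := by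
  constructor
  · simp [dl, Finset.sum_sub_distrib]
  · intro m hm
    have h1 : m ≠ a := by rintro rfl; rw [hm] at ha; cases ha
    have h2 : m ≠ b := by rintro rfl; rw [hm] at hb; cases hb
    simp [dl, h1, h2]

theorem dl_ne {a b : Fin 12} (h : a ≠ b) : dl a b ≠ 0 := by
  intro h1
  have := congrFun h1 a
  simp [dl, h] at this

structure TR (X : GD A G) (Y : GD B G) where
  F : (Fin 12 → ℂ) →ₗ[ℂ] (Fin 12 → ℂ)
  sum : ∀ x, ∑ m, F x m = 0
  eq : ∀ x g, fn Y x g = fn X (F x) g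

theorem TR.inj {X : GD A G} {Y : GD B G} (t : TR X Y) {x} (hx : ∑ m, x m = 0) (h : t.F x = 0) : x = 0 := by
  refine Y.ext0 hx fun g => ?_
  rw [t.eq, h]; simp [fn]

theorem TR.inv {X : GD A G} {Y : GD B G} (t : TR X Y) (s : TR Y X) {x} (hx : ∑ m, x m = 0) :
    s.F (t.F x) = x := by
  rw [← sub_eq_zero]
  refine Y.ext0 (by simp [Finset.sum_sub_distrib, s.sum, hx]) fun g => ?_
  have : fn Y (s.F (t.F x) - x) g = fn Y (s.F (t.F x)) g - fn Y x g := by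
    simp [fn, sub_mul, Finset.sum_sub_distrib]
  rw [this, ← s.eq, ← t.eq, sub_self]

theorem TR.par {X : GD A G} {Y : GD B G} (t : TR X Y) {x y : Fin 12 → ℂ} (hx : ∑ m, x m = 0)
    (hy : ∑ m, y m = 0) (h : ∀ i j, t.F x i * t.F y j = t.F x j * t.F y i) (j) :
    t.F y j • x = t.F x j • y := by
  rw [← sub_eq_zero]
  refine t.inj ?_ ?_
  · simp [Finset.sum_sub_distrib, ← Finset.mul_sum, hx, hy]
  · funext i
    simp only [map_sub, map_smul, Pi.sub_apply, Pi.smul_apply, smul_eq_mul, Pi.zero_apply]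
    linear_combination h i j

theorem TR.sig {X : GD A G} {Y : GD B G} (t : TR X Y) (P) : ∃ Q, ∀ x, vs P x → vs Q (t.F x) := by
  have hres : ∀ x y, vs P x → vs P y → (∀ i j, t.F x i * t.F y j = t.F x j * t.F y i) ∨
    ∃ Q, vs Q (t.F x) ∧ vs Q (t.F y) := by
    intro x y hx hy
    have hR : Row (t.F x) (t.F y) := X.Row (t.sum x) (t.sum y) fun g h hc => by
      rw [← t.eq, ← t.eq, ← t.eq, ← t.eq]
      refine vs_comm hx hy _ _ fun T => ?_
      exact Uni.comm_eta (by rw [← Y.mul, ← Y.mul, hc]) T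
    rcases resonance hR with h | ⟨Q, h⟩
    · exact Or.inl h
    · exact Or.inr ⟨Q, ⟨t.sum x, fun m hm => (h m hm).1⟩, ⟨t.sum y, fun m hm => (h m hm).2⟩⟩
  obtain ⟨a, b, c, hab, hac, hbc, ha, hb, hc⟩ := pt_three P
  have hx := dl_vs (P := P) ha hb
  have hy := dl_vs (P := P) ha hc
  have hx0 : t.F (dl a b) ≠ 0 := fun h => dl_ne hab (t.inj hx.1 h)
  rcases hres _ _ hx hy with h | ⟨Q, hQx, _⟩
  · exfalso
    apply hx0
    funext j
    have h1 := congrFun (t.par hx.1 hy.1 h j) c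
    rw [Pi.smul_apply, Pi.smul_apply, smul_eq_mul, smul_eq_mul,
      show dl a b c = 0 by simp [dl, hac.symm, hbc.symm], show dl a c c = -1 by simp [dl, hac.symm]] at h1
    rw [Pi.zero_apply]
    linear_combination h1
  · refine ⟨Q, fun z hz => ?_⟩
    rcases hres _ _ hx hz with h | ⟨Q', h1, h2⟩
    · obtain ⟨i, hi⟩ := Function.ne_iff.1 hx0
      refine ⟨t.sum z, fun j hj => ?_⟩
      have := h i j
      rw [hQx.2 j hj, zero_mul] at this
      exact (mul_eq_zero.1 this).resolve_left hi
    · rwa [vs_uniq hQx h1 hx0]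

def dp (P Q S : Fin 13) : Bool := P != Q && Q != S && P != S && (pts P).any fun a => inP Q a &&
  (pts P).any fun c => inP S c && c != a && (pts Q).any fun b => inP S b && b != a && b != c

def h1 : Fin 13 → ℕ := ![40, 36, 32, 32, 26, 30, 26, 26, 28, 22, 26, 22, 26]
def h2 : Fin 13 → ℕ := ![1076, 982, 952, 936, 800, 890, 786, 780, 766, 720, 798, 706, 784]
theorem h1_eq : ∀ P, h1 P = ∑ Q, ∑ S, (if dp P Q S = true then 1 else 0) := by decide +kernel
theorem h2_eq : ∀ P, h2 P = ∑ Q, ∑ S, (if dp P Q S = true then h1 Q else 0) := by decide +kernel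
theorem h2_inj : ∀ P Q, h2 P = h2 Q → P = Q := by decide +kernel

theorem dp_rigid (s : Fin 13 ≃ Fin 13) (h : ∀ P Q S, dp (s P) (s Q) (s S) = dp P Q S) (P) : s P = P := by
  have e1 : ∀ P, h1 (s P) = h1 P := by
    intro P
    rw [h1_eq, h1_eq, ← Equiv.sum_comp s]
    refine Finset.sum_congr rfl fun Q _ => ?_
    rw [← Equiv.sum_comp s]
    simp only [h]
  refine h2_inj _ _ ?_
  rw [h2_eq, h2_eq, ← Equiv.sum_comp s]
  refine Finset.sum_congr rfl fun Q _ => ?_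
  rw [← Equiv.sum_comp s]
  simp only [h, e1]

end

noncomputable section
open Set Topology unitInterval

variable {A B : Fin 12 → Fin 3 → ℂ} {G : Type} [Group G]

theorem dp_iff {P Q S : Fin 13} : dp P Q S = true ↔ (P ≠ Q ∧ Q ≠ S ∧ P ≠ S) ∧ ∃ a b c : Fin 12,
    a ≠ b ∧ b ≠ c ∧ a ≠ c ∧ inP P a = true ∧ inP Q a = true ∧ inP Q b = true ∧ inP S b = true ∧
    inP P c = true ∧ inP S c = true := by
  have hm : ∀ P a, a ∈ pts P ↔ inP P a = true := by intro P a; simp [inP]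
  have hl : ∀ P, ∀ a ∈ pts P, a < 12 := by
    intro P; exact pt_lt _ (by rw [ptl_eq]; exact List.mem_map_of_mem (List.mem_finRange P))
  simp only [dp, Bool.and_eq_true, List.any_eq_true, bne_iff_ne]
  constructor
  · rintro ⟨⟨⟨h1, h2⟩, h3⟩, a, ha, ha', c, hc, ⟨hc', hca⟩, b, hb, ⟨hb', hba⟩, hbc⟩
    refine ⟨⟨h1, h2, h3⟩, ⟨a, hl _ _ ha⟩, ⟨b, hl _ _ hb⟩, ⟨c, hl _ _ hc⟩, ?_, ?_, ?_, (hm _ _).1 ha, ha',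
      (hm _ _).1 hb, hb', (hm _ _).1 hc, hc'⟩
    · simpa [Fin.ext_iff] using Ne.symm hba
    · simpa [Fin.ext_iff] using hbc
    · simpa [Fin.ext_iff] using Ne.symm hca
  · rintro ⟨⟨h1, h2, h3⟩, a, b, c, hab, hbc, hac, x1, x2, x3, x4, x5, x6⟩
    refine ⟨⟨⟨h1, h2⟩, h3⟩, a, (hm _ _).2 x1, x2, c, (hm _ _).2 x5, ⟨x6, ?_⟩, b, (hm _ _).2 x3, ⟨x4, ?_⟩, ?_⟩
    · exact fun h => hac (Fin.ext h.symm)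
    · exact fun h => hab (Fin.ext h.symm)
    · exact fun h => hbc (Fin.ext h)

theorem ld_supp {P Q S : Fin 13} (h1 : P ≠ Q) (h3 : P ≠ S) {x y z} (hx : vs P x) (hy : vs Q y)
    (hz : vs S z) (x0 : x ≠ 0) (h : x + y + z = 0) : ∃ a c : Fin 12, a ≠ c ∧ inP P a = true ∧
      inP Q a = true ∧ inP P c = true ∧ inP S c = true := by
  obtain ⟨i, j, hij, hi, hj⟩ := two_supp hx.1 x0
  have key : ∀ i : Fin 12, x i ≠ 0 → inP Q i = true ∨ inP S i = true := by
    intro i hi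
    by_contra hn
    push Not at hn
    have := congrFun h i
    simp only [Pi.add_apply, hy.2 i (by simpa using hn.1), hz.2 i (by simpa using hn.2), add_zero,
      Pi.zero_apply] at this
    exact hi this
  have hi' := vs_mem hx hi
  have hj' := vs_mem hx hj
  rcases key i hi with h4 | h4 <;> rcases key j hj with h5 | h5
  · exact absurd (pt_one P Q h1 i j hi' hj' h4 h5) hij
  · exact ⟨i, j, hij, hi', h4, hj', h5⟩
  · exact ⟨j, i, hij.symm, hj', h5, hi', h4⟩
  · exact absurd (pt_one P S h3 i j hi' hj' h4 h5) hij

theorem ld_dp {P Q S : Fin 13} (h1 : P ≠ Q) (h2 : Q ≠ S) (h3 : P ≠ S) {x y z} (hx : vs P x) (hy : vs Q y)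
    (hz : vs S z) (x0 : x ≠ 0) (y0 : y ≠ 0) (z0 : z ≠ 0) (h : x + y + z = 0) : dp P Q S = true := by
  obtain ⟨a, c, hac, a1, a2, c1, c2⟩ := ld_supp h1 h3 hx hy hz x0 h
  obtain ⟨a', b, hab, a1', a2', b1, b2⟩ := ld_supp h1.symm h2 hy hx hz y0 (by rw [← h]; abel)
  obtain ⟨c', b', hcb, c1', c2', b1', b2'⟩ := ld_supp h3.symm h2.symm hz hx hy z0 (by rw [← h]; abel)
  have ea := pt_one P Q h1 a a' a1 a2' a2 a1'
  have ec := pt_one P S h3 c c' c1 c2' c2 c1'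
  have eb := pt_one Q S h2 b b' b1 b2' b2 b1'
  subst ea ec eb
  exact dp_iff.2 ⟨⟨h1, h2, h3⟩, a, b, c, hab, hcb.symm, hac, a1, a2, b1, b2, c1, c2⟩

theorem TR.ex (X : GD A G) (Y : GD B G) : Nonempty (TR X Y) := by
  obtain ⟨F, h1, h2⟩ := X.trans Y
  exact ⟨⟨F, h1, h2⟩⟩

theorem TR.dp_map {X : GD A G} {Y : GD B G} (t : TR X Y) (s : Fin 13 → Fin 13) (hi : Function.Injective s)
    (h : ∀ P x, vs P x → vs (s P) (t.F x)) {P Q S} (hd : dp P Q S = true) : dp (s P) (s Q) (s S) = true := by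
  obtain ⟨⟨h1, h2, h3⟩, a, b, c, hab, hbc, hac, x1, x2, x3, x4, x5, x6⟩ := dp_iff.1 hd
  have n : ∀ {P} {a b : Fin 12}, a ≠ b → inP P a = true → inP P b = true → t.F (dl a b) ≠ 0 :=
    fun hab ha hb h0 => dl_ne hab (t.inj (dl_vs ha hb).1 h0)
  refine ld_dp (hi.ne h1) (hi.ne h2) (hi.ne h3) (h _ _ (dl_vs x5 x1)) (h _ _ (dl_vs x2 x3))
    (h _ _ (dl_vs x4 x6)) (n hac.symm x5 x1) (n hab x2 x3) (n hbc x4 x6) ?_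
  rw [← map_add, ← map_add]
  convert map_zero t.F
  simp only [dl]; abel

theorem TR.stab {X : GD A G} {Y : GD B G} (t : TR X Y) (P x) (hx : vs P x) : vs P (t.F x) := by
  obtain ⟨t'⟩ := TR.ex Y X
  choose s hs using t.sig
  choose s' hs' using t'.sig
  have key : ∀ {A B : Fin 12 → Fin 3 → ℂ} {X : GD A G} {Y : GD B G} (t : TR X Y) (t' : TR Y X)
      (s s' : Fin 13 → Fin 13) (hs : ∀ P x, vs P x → vs (s P) (t.F x))
      (hs' : ∀ P x, vs P x → vs (s' P) (t'.F x)), ∀ P, s' (s P) = P := by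
    intro A B X Y t t' s s' hs hs' P
    obtain ⟨a, b, _, hab, _, _, ha, hb, _⟩ := pt_three P
    have h1 := hs' _ _ (hs P _ (dl_vs ha hb))
    rw [t.inv t' (dl_vs ha hb).1] at h1
    exact vs_uniq h1 (dl_vs ha hb) (dl_ne hab)
  have k1 := key t t' s s' hs hs'
  have k2 := key t' t s' s hs' hs
  have h := dp_rigid ⟨s, s', k1, k2⟩ (fun P Q S => by
    rw [Bool.eq_iff_iff]
    refine ⟨fun h => ?_, fun h => t.dp_map s (Function.LeftInverse.injective k1) hs h⟩
    have := t'.dp_map s' (Function.LeftInverse.injective k2) hs' h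
    simpa [k1] using this) P
  have h' : s P = P := h
  have := hs P x hx
  rwa [h'] at this

def tri (a b c : Fin 12) : Prop := ∃ P Q S : Fin 13, P ≠ Q ∧ Q ≠ S ∧ P ≠ S ∧
  a ≠ b ∧ b ≠ c ∧ a ≠ c ∧ inP P a = true ∧ inP P b = true ∧ inP Q b = true ∧ inP Q c = true ∧
    inP S a = true ∧ inP S c = true

theorem tri_loc {a b : Fin 12} {P Q S : Fin 13} (h1 : P ≠ Q) (h3 : P ≠ S)
   (x1 : inP P a = true) (x2 : inP P b = true) (x3 : inP Q b = true) 
   (x5 : inP S a = true) {x y z} (hx : vs P x) (hy : vs Q y)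
    (hz : vs S z) (h : x + y + z = 0) (m) (ha : m ≠ a) (hb : m ≠ b) : x m = 0 := by
  by_contra h0
  have hm := vs_mem hx h0
  have h4 : inP Q m = false := by
    by_contra hn; exact hb (pt_one P Q h1 m b hm x2 (by simpa using hn) x3)
  have h5 : inP S m = false := by
    by_contra hn; exact ha (pt_one P S h3 m a hm x1 (by simpa using hn) x5)
  have := congrFun h m
  simp only [Pi.add_apply, hy.2 m h4, hz.2 m h5, add_zero, Pi.zero_apply] at this
  exact h0 this

theorem supp2 {a b : Fin 12} (hab : a ≠ b) {x : Fin 12 → ℂ} (hx : ∑ m, x m = 0)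
    (h : ∀ m, m ≠ a → m ≠ b → x m = 0) : x = x a • dl a b := by
  have h1 : x a + x b = 0 := by
    rw [← hx, ← Finset.sum_subset (Finset.subset_univ {a, b})]
    · rw [Finset.sum_pair hab]
    · intro m _ hm
      simp only [Finset.mem_insert, Finset.mem_singleton, not_or] at hm
      exact h m hm.1 hm.2
  funext m
  by_cases ha : m = a
  · subst ha; simp [dl, hab]
  · by_cases hb : m = b
    · subst hb; simp [dl, ha]; linear_combination h1
    · simp [dl, ha, hb, h m ha hb]

theorem TR.tri_sc {X : GD A G} {Y : GD B G} (t : TR X Y) {a b c : Fin 12} (h : tri a b c) :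
    ∃ s : ℂ, t.F (dl a b) = s • dl a b ∧ t.F (dl b c) = s • dl b c ∧ t.F (dl a c) = s • dl a c := by
  obtain ⟨P, Q, S, h1, h2, h3, hab, hbc, hac, x1, x2, x3, x4, x5, x6⟩ := h
  have hx := t.stab _ _ (dl_vs x1 x2)
  have hy := t.stab _ _ (dl_vs x3 x4)
  have hz := t.stab _ _ (dl_vs x6 x5)
  have h0 : t.F (dl a b) + t.F (dl b c) + t.F (dl c a) = 0 := by
    rw [← map_add, ← map_add]
    convert map_zero t.F
    simp only [dl]; abel
  have e1 := supp2 hab hx.1 (fun m => tri_loc h1 h3 x1 x2 x3 x5 hx hy hz h0 m)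
  have e2 := supp2 hbc hy.1 (fun m => tri_loc h2 h1.symm x3 x4 x6 x2 hy hz hx (by rw [← h0]; abel) m)
  have h4 := congrFun h0 b
  have h5 : t.F (dl c a) b = 0 := tri_loc h3.symm h2.symm x6 x5 x1 x4 hz hx hy (by rw [← h0]; abel) b hbc hab.symm
  have h6 : t.F (dl a b) b = - t.F (dl a b) a := by
    have := congrFun e1 b
    rw [this]; simp [dl, hab.symm]
  have h7 : t.F (dl b c) b = t.F (dl a b) a := by
    simp only [Pi.add_apply, h5, h6, Pi.zero_apply] at h4
    linear_combination h4
  rw [h7] at e2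
  refine ⟨_, e1, e2, ?_⟩
  have e3 : dl a c = dl a b + dl b c := by simp only [dl]; abel
  rw [e3, map_add, smul_add]
  conv_lhs => rw [e1, e2]

theorem smul_dl {a b : Fin 12} (h : a ≠ b) {s s' : ℂ} (e : s • dl a b = s' • dl a b) : s = s' := by
  have := congrFun e a
  simpa [dl, h] using this

instance (a b c) : Decidable (tri a b c) := by unfold tri; infer_instance

theorem tri_list : tri 0 2 3 ∧ tri 0 2 4 ∧ tri 0 2 6 ∧ tri 0 2 7 ∧ tri 0 2 8 ∧ tri 0 2 10 ∧ tri 0 2 11 ∧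
  tri 0 3 5 ∧ tri 0 3 9 ∧ tri 1 2 3 := by decide +kernel

theorem TR.scal {X : GD A G} {Y : GD B G} (t : TR X Y) : ∃ c : ℂ, ∀ x, ∑ m, x m = 0 → t.F x = c • x := by
  obtain ⟨t3, t4, t6, t7, t8, t10, t11, t5, t9, t1⟩ := tri_list
  obtain ⟨c, a2, a23, a3⟩ := t.tri_sc t3
  have k1 : ∀ m, tri 0 2 m → t.F (dl 0 m) = c • dl 0 m := by
    intro m hm
    obtain ⟨c', b1, _, b3⟩ := t.tri_sc hm
    rwa [smul_dl (by decide) (a2.symm.trans b1)]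
  have k2 : ∀ m, tri 0 3 m → t.F (dl 0 m) = c • dl 0 m := by
    intro m hm
    obtain ⟨c', b1, _, b3⟩ := t.tri_sc hm
    rwa [smul_dl (by decide) (a3.symm.trans b1)]
  have a1 : t.F (dl 0 1) = c • dl 0 1 := by
    obtain ⟨c', b1, b2, _⟩ := t.tri_sc t1
    have e := smul_dl (by decide) (a23.symm.trans b2)
    have e3 : dl 0 1 = dl 0 2 - dl 1 2 := by simp only [dl]; abel
    rw [e3, map_sub, smul_sub, a2, b1, e]
  have all : ∀ m, t.F (dl 0 m) = c • dl 0 m := by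
    intro m
    fin_cases m
    · simp [dl]
    · exact a1
    · exact a2
    · exact a3
    · exact k1 _ t4
    · exact k2 _ t5
    · exact k1 _ t6
    · exact k1 _ t7
    · exact k1 _ t8
    · exact k2 _ t9
    · exact k1 _ t10
    · exact k1 _ t11
  refine ⟨c, fun x hx => ?_⟩
  have e : x = ∑ m, (-x m) • dl 0 m := by
    funext k
    simp only [dl, Finset.sum_apply, Pi.smul_apply, Pi.sub_apply, smul_eq_mul, mul_sub,
      Finset.sum_sub_distrib, ← Finset.sum_mul, Finset.sum_neg_distrib, hx, Pi.single_apply]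
    simp
  rw [e, map_sum, Finset.smul_sum]
  refine Finset.sum_congr rfl fun m _ => ?_
  rw [map_smul, all, smul_comm]

theorem L_scal (X : GD A G) (Y : GD B G) : ∃ c : ℂ, (∃ n : ℤ, c = n) ∧
    ∀ g k, (Y.ho g).L k = c * (X.ho g).L k := by
  obtain ⟨t⟩ := TR.ex X Y
  obtain ⟨c, hc⟩ := t.scal
  have h : ∀ g k, (Y.ho g).L k = c * (X.ho g).L k := by
    intro g k
    by_cases hk : k = 0
    · subst hk; rw [X.zero, Y.zero, mul_zero]
    have h0 : ∑ m, dl k 0 m = 0 := by simp [dl, Finset.sum_sub_distrib]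
    have := t.eq (dl k 0) g
    rw [hc _ h0] at this
    have e1 : ∀ {A : Fin 12 → Fin 3 → ℂ} (X : GD A G), fn X (dl k 0) g = (X.ho g).L k := by
      intro A X
      simp [fn, dl, sub_mul, Finset.sum_sub_distrib, Pi.single_apply, X.zero]
    have e2 : fn X (c • dl k 0) g = c * fn X (dl k 0) g := by
      simp only [fn, Finset.mul_sum, Pi.smul_apply, smul_eq_mul, mul_assoc]
    rwa [e2, e1, e1] at this
  refine ⟨c, ?_, h⟩
  obtain ⟨g, hg, _⟩ := X.chi 1 (by decide)
  obtain ⟨n, hn⟩ := Y.int g 1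
  rw [h, hg, if_pos rfl] at hn
  exact ⟨n, mul_right_cancel₀ tpi hn⟩

theorem L_pm (X : GD A G) (Y : GD B G) : ∃ c : ℂ, (c = 1 ∨ c = -1) ∧
    ∀ g k, (Y.ho g).L k = c * (X.ho g).L k := by
  obtain ⟨c, ⟨n, rfl⟩, h⟩ := L_scal X Y
  obtain ⟨c', ⟨n', rfl⟩, h'⟩ := L_scal Y X
  refine ⟨n, ?_, h⟩
  obtain ⟨g, hg, _⟩ := X.chi 1 (by decide)
  have h1 := h' g 1
  rw [h, hg, if_pos rfl, ← mul_assoc] at h1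
  have h2 : (n' : ℂ) * n = 1 := mul_right_cancel₀ tpi (by rw [one_mul]; exact h1.symm)
  have h3 : n' * n = 1 := by exact_mod_cast h2
  rcases Int.eq_one_or_neg_one_of_mul_eq_one (by rw [mul_comm]; exact h3 : n * n' = 1) with e | e <;> simp [e]

end

noncomputable section
open Set Topology unitInterval

variable {A B : Fin 12 → Fin 3 → ℂ} {G : Type} [Group G]

abbrev SL := List (Fin 21 × Fin 12 × Fin 12)

def mkc (l : SL) (T : Fin 21) : Fin 12 → ℂ := (l.map fun t => if t.1 = T then dl t.2.1 t.2.2 else 0).sum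

theorem dl_sum (a b) : ∑ m, dl a b m = 0 := by simp [dl, Finset.sum_sub_distrib]
theorem dl_dot (a b) (x : Fin 12 → ℂ) : ∑ m, dl a b m * x m = x a - x b := by
  simp [dl, sub_mul, Finset.sum_sub_distrib, Pi.single_apply]

theorem mkc_sum (l : SL) (T) : ∑ m, mkc l T m = 0 := by
  induction l with
  | nil => simp [mkc]
  | cons t l ih =>
    have : mkc (t :: l) T = (if t.1 = T then dl t.2.1 t.2.2 else 0) + mkc l T := by simp [mkc]
    rw [this]
    simp only [Pi.add_apply, Finset.sum_add_distrib, ih, add_zero]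
    split_ifs
    · exact dl_sum _ _
    · simp

theorem mkc_bi (l : SL) (f : Fin 21 → (Fin 12 → ℂ) → ℂ) (h0 : ∀ T, f T 0 = 0)
    (ha : ∀ T x y, f T (x + y) = f T x + f T y) :
    ∑ T, f T (mkc l T) = (l.map fun t => f t.1 (dl t.2.1 t.2.2)).sum := by
  induction l with
  | nil => simp [mkc, h0]
  | cons t l ih =>
    have : ∀ T, mkc (t :: l) T = (if t.1 = T then dl t.2.1 t.2.2 else 0) + mkc l T := by simp [mkc]
    simp only [this, ha, Finset.sum_add_distrib, ih, List.map_cons, List.sum_cons]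
    congr 1
    rw [Finset.sum_eq_single t.1]
    · simp
    · intro b _ hb; rw [if_neg hb.symm, h0]
    · simp

theorem mkc_syz (l : SL) (h : ∀ x y z : Fin 12 → ℂ, (l.map fun t => (x t.2.1 - x t.2.2) * eta t.1 y z +
    (y t.2.1 - y t.2.2) * eta t.1 z x + (z t.2.1 - z t.2.2) * eta t.1 x y).sum = 0) : Syz (mkc l) := by
  intro x y z
  have := mkc_bi l (fun T c => (∑ k, c k * x k) * eta T y z + (∑ k, c k * y k) * eta T z x +
    (∑ k, c k * z k) * eta T x y) (by simp)
    (by intro T c c'; simp only [Pi.add_apply, add_mul, Finset.sum_add_distrib]; ring)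
  simp only [dl_dot] at this
  rw [h] at this
  exact this

theorem sS_add (k j x y) : sS k j (x + y) = sS k j x + sS k j y := by
  rw [sS, sS, sS, ← Finset.sum_add_distrib]
  refine Finset.sum_congr rfl fun m _ => ?_
  split_ifs <;> simp

def dJ (X : GD A G) (Y : GD B G) (T : Fin 21) (g : G) : ℂ := (Y.ho g).J T - (X.ho g).J T

theorem dJ_ex (X : GD A G) (Y : GD B G) (hL : ∀ g, (Y.ho g).L = (X.ho g).L) :
    ∃ d : Fin 21 → Fin 12 → ℂ, (∀ T, ∑ m, d T m = 0) ∧ ∀ T g, dJ X Y T g = fn X (d T) g := by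
  have : ∀ T, ∃ a : Fin 12 → ℂ, ∑ k, a k = 0 ∧ ∀ g, dJ X Y T g = fn X a g := fun T =>
    X.lin1 _ fun g h => by
      simp only [dJ, X.mul, Y.mul, Uni.mul_J, hL]; ring
  choose d h1 h2 using this
  exact ⟨d, h1, h2⟩

theorem dJ_row (X : GD A G) (Y : GD B G) (hL : ∀ g, (Y.ho g).L = (X.ho g).L) {d : Fin 21 → Fin 12 → ℂ}
    (hd : ∀ T, ∑ m, d T m = 0) (hJ : ∀ T g, dJ X Y T g = fn X (d T) g) (l : SL) (hl : Syz (mkc l))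
    (k j : Fin 12) (hk : k ≠ 0) (hj : k ≠ j) :
    (l.map fun t => sS k j (d t.1) * dl t.2.1 t.2.2 k - d t.1 k * sS k j (dl t.2.1 t.2.2)).sum = 0 := by
  have h := X.row d (mkc l) hd (mkc_sum l) (fun g g' hc => by
    have h1 := Uni.comm_K (g := X.ho g) (h := X.ho g') (by rw [← X.mul, ← X.mul, hc]) ⟨_, hl⟩
    have h2 := Uni.comm_K (g := Y.ho g) (h := Y.ho g') (by rw [← Y.mul, ← Y.mul, hc]) ⟨_, hl⟩
    rw [hL, hL] at h2
    have h3 := congrArg₂ (· - ·) h2 h1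
    simp only [← Finset.sum_sub_distrib, sub_zero] at h3
    refine Eq.trans ?_ h3
    refine Finset.sum_congr rfl fun T _ => ?_
    rw [← hJ, ← hJ]
    simp only [dJ]
    change _ * cc (mkc l) T _ - _ * cc (mkc l) T _ = _
    ring) k j hk hj
  rw [← h]
  exact (mkc_bi l (fun T c => sS k j (d T) * c k - d T k * sS k j c) (fun T => by simp [sS])
    (fun T x y => by rw [sS_add, Pi.add_apply]; ring)).symm

def pT : Fin 21 → Fin 13 := ![0,0,0,1,1,1,2,3,4,5,6,7,8,10,11,12,0,0,0,1,9]

theorem pT_ok : ∀ T, inP (pT T) (tr T).1 = true ∧ inP (pT T) (tr T).2.2 = true ∧ (tr T).1 ≠ (tr T).2.2 := by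
  decide +kernel

theorem dJ_loc (X : GD A G) (Y : GD B G) (hL : ∀ g, (Y.ho g).L = (X.ho g).L) {d : Fin 21 → Fin 12 → ℂ}
    (hd : ∀ T, ∑ m, d T m = 0) (hJ : ∀ T g, dJ X Y T g = fn X (d T) g) (T) : vs (pT T) (d T) := by
  obtain ⟨h1, h2, h3⟩ := pT_ok T
  have hR : Row (d T) (dl (tr T).1 (tr T).2.2) := by
    intro k j hk hj
    have := dJ_row X Y hL hd hJ [(T, (tr T).1, (tr T).2.2)] (mkc_syz _ fun x y z => by
      simp only [List.map_cons, List.map_nil, List.sum_cons, List.sum_nil, eta, uu, vv]; ring) k j hk hj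
    simp only [List.map_cons, List.map_nil, List.sum_cons, List.sum_nil, add_zero] at this
    refine Eq.trans ?_ this
    rw [sS, sS, Finset.sum_mul, Finset.mul_sum, ← Finset.sum_sub_distrib]
    refine Finset.sum_congr rfl fun m _ => ?_
    split_ifs <;> ring
  have hv := dl_vs h1 h2
  rcases resonance hR with h | ⟨Q, h⟩
  · refine ⟨hd T, fun m hm => ?_⟩
    have h4 := h (tr T).1 m
    rw [hv.2 m hm, mul_zero] at h4
    rw [show dl (tr T).1 (tr T).2.2 (tr T).1 = 1 by simp [dl, h3], mul_one] at h4
    exact h4.symm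
  · rw [vs_uniq hv ⟨hv.1, fun m hm => (h m hm).2⟩ (dl_ne h3)]
    exact ⟨hd T, fun m hm => (h m hm).1⟩

def s1 : SL := [(0, 3, 1), (10, 8, 0), (9, 0, 5), (3, 3, 0), (6, 1, 8), (14, 1, 0), (7, 5, 1)]
def s2 : SL := [(1, 2, 1), (9, 0, 10), (4, 2, 0), (11, 7, 0), (6, 1, 7), (13, 0, 1), (8, 10, 1)]
def s3 : SL := [(2, 4, 1), (11, 9, 0), (10, 0, 6), (5, 4, 0), (7, 1, 9), (15, 1, 0), (8, 6, 1)]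
def s4 : SL := [(0, 3, 1), (10, 8, 4), (10, 6, 0), (4, 2, 0), (11, 7, 2), (6, 1, 7), (6, 3, 8),
  (5, 0, 4), (7, 4, 1), (13, 4, 1), (15, 3, 1), (9, 0, 3), (14, 2, 0), (12, 1, 0), (8, 2, 6)]

theorem sy1 : Syz (mkc s1) := mkc_syz _ fun x y z => by
  simp only [s1, List.map_cons, List.map_nil, List.sum_cons, List.sum_nil, eta, uu, vv, tr]
  simp; ring
theorem sy2 : Syz (mkc s2) := mkc_syz _ fun x y z => by
  simp only [s2, List.map_cons, List.map_nil, List.sum_cons, List.sum_nil, eta, uu, vv, tr]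
  simp; ring
theorem sy3 : Syz (mkc s3) := mkc_syz _ fun x y z => by
  simp only [s3, List.map_cons, List.map_nil, List.sum_cons, List.sum_nil, eta, uu, vv, tr]
  simp; ring
theorem sy4 : Syz (mkc s4) := mkc_syz _ fun x y z => by
  simp only [s4, List.map_cons, List.map_nil, List.sum_cons, List.sum_nil, eta, uu, vv, tr]
  simp; ring

theorem sS_eq (k j : Fin 12) (l : List (Fin 12)) (hn : l.Nodup) (h : ∀ m : Fin 12, dep k j m = true ↔ m ∈ l)
    (x : Fin 12 → ℂ) : sS k j x = (l.map x).sum := by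
  simp only [sS, h]
  rw [← List.sum_toFinset _ hn, ← Finset.sum_filter]
  congr 1
  ext; simp

theorem theta (X : GD A G) (Y : GD B G) (hL : ∀ g, (Y.ho g).L = (X.ho g).L) {d : Fin 21 → Fin 12 → ℂ}
    (hd : ∀ T, ∑ m, d T m = 0) (hJ : ∀ T g, dJ X Y T g = fn X (d T) g) :
    - d 9 8 + d 11 10 + d 6 5 - d 8 7 = 0 := by
  have hv := dJ_loc X Y hL hd hJ
  obtain ⟨u, hu⟩ : ∃ u : Fin 21 → Fin 12 → ℂ, d = fun T (m : Fin 12) => if inP (pT T) m = true then u T m else 0 := by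
    refine ⟨d, funext fun T => funext fun m => ?_⟩
    split_ifs with h
    · rfl
    · exact (hv T).2 m (by simpa using h)
  have r := fun l hl => dJ_row X Y hL hd hJ l hl
  have e1 := r s3 sy3 9 0 (by decide) (by decide)
  have e2 := r s4 sy4 4 2 (by decide) (by decide)
  have e3 := r s4 sy4 2 3 (by decide) (by decide)
  have e4 := r s1 sy1 8 0 (by decide) (by decide)
  have e5 := r s2 sy2 10 0 (by decide) (by decide)
  have e6 := r s3 sy3 1 5 (by decide) (by decide)
  have e7 := r s1 sy1 1 5 (by decide) (by decide)
  have e8 := r s2 sy2 1 5 (by decide) (by decide)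
  simp only [s1, s2, s3, s4, List.map_cons, List.map_nil, List.sum_cons, List.sum_nil,
    sS_eq 9 0 [0,8,9,10,11] (by decide) (by decide +kernel),
    sS_eq 4 2 [2,3,4] (by decide) (by decide +kernel), sS_eq 2 3 [2,3,4] (by decide) (by decide +kernel),
    sS_eq 8 0 [0,8,9,10,11] (by decide) (by decide +kernel),
    sS_eq 10 0 [0,8,9,10,11] (by decide) (by decide +kernel),
    sS_eq 1 5 [1,5,6,7] (by decide) (by decide +kernel)] at e1 e2 e3 e4 e5 e6 e7 e8
  have f := hd
  have f6 := f 6; have f7 := f 7; have f8 := f 8; have f9 := f 9; have f10 := f 10; have f11 := f 11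
  have f13 := f 13; have f14 := f 14; have f15 := f 15
  clear f r hv hd hJ
  subst hu
  simp only [Fin.sum_univ_succ] at f6 f7 f8 f9 f10 f11 f13 f14 f15
  simp [dl, pT, inP, pts, Pi.single_apply] at e1 e2 e3 e4 e5 e6 e7 e8 f6 f7 f8 f9 f10 f11 f13 f14 f15 ⊢
  linear_combination (1/7) * (e1 - e2 + 2 * e3 + 2 * e4 + 3 * e5 + e6 + 2 * e7 + 3 * e8
    - (-2 * f6 - f7 + 3 * f8 + 2 * f9 + f10 - 3 * f11 - 3 * f13 + 2 * f14 + f15))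

end

noncomputable section
open Set Topology unitInterval

variable {A B : Fin 12 → Fin 3 → ℂ} {G : Type} [Group G]

def expU : Multiplicative ℂ →* ℂˣ := MonoidHom.mk'
  (fun z => Units.mk0 (Complex.exp z.toAdd) (Complex.exp_ne_zero _))
  (fun a b => Units.ext (by simp [Complex.exp_add]))

theorem expU_surj : Function.Surjective expU := fun u =>
  ⟨Multiplicative.ofAdd (Complex.log u), Units.ext (by simp [expU, Complex.exp_log])⟩


theorem exp_J_congr (Y : GD B G) (T : Fin 21) {g g' : G} (h : (Y.ho g).L = (Y.ho g').L) :
    Complex.exp ((Y.ho g).J T / (2 * Real.pi * Complex.I)) =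
      Complex.exp ((Y.ho g').J T / (2 * Real.pi * Complex.I)) := by
  let N : G → ℂ := fun g => ((Y.ho g).J T + 1 / 2 * (uu T (Y.ho g).L * vv T (Y.ho g).L)) /
    (2 * Real.pi * Complex.I)
  have hN : ∀ g h, Complex.exp (N (g * h)) = Complex.exp (N g) * Complex.exp (N h) := by
    intro g h
    rw [← Complex.exp_add, Complex.exp_eq_exp_iff_exists_int]
    obtain ⟨a, ha⟩ := Y.int h (tr T).1
    obtain ⟨b, hb⟩ := Y.int h (tr T).2.2
    obtain ⟨c, hc⟩ := Y.int g (tr T).2.1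
    obtain ⟨d, hd⟩ := Y.int g (tr T).2.2
    refine ⟨(a - b) * (c - d), ?_⟩
    have e1 : uu T (Y.ho h).L = (a - b) * (2 * Real.pi * Complex.I) := by rw [uu, ha, hb]; ring
    have e2 : vv T (Y.ho g).L = (c - d) * (2 * Real.pi * Complex.I) := by rw [vv, hc, hd]; ring
    simp only [N]
    rw [Y.mul, Uni.mul_J, Uni.mul_L, uu_add, vv_add, eta, e1, e2]
    push_cast
    have := tpi
    field_simp
    ring
  obtain ⟨a, -, ha⟩ := Y.lin expU expU_surj (MonoidHom.mk'
    (fun g => Units.mk0 (Complex.exp (N g)) (Complex.exp_ne_zero _))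
    (fun g h => Units.ext (by simp [hN])))
  have h3 := (ha g).trans ((congrArg (fun l : Fin 12 → ℂ => expU (Multiplicative.ofAdd (∑ k, a k * l k))) h).trans
    (ha g').symm)
  have h4 : Complex.exp (N g) = Complex.exp (N g') := congrArg Units.val h3
  simp only [N, add_div, Complex.exp_add, h] at h4
  exact mul_right_cancel₀ (Complex.exp_ne_zero _) h4

theorem exp_d (X : GD A G) (Y : GD B G) (hL : ∀ g, (Y.ho g).L = (X.ho g).L) {d : Fin 21 → Fin 12 → ℂ}
    (hJ : ∀ T g, dJ X Y T g = fn X (d T) g) {T k} (b r : Fin 12) (hk : k ≠ 0) (hb : b ≠ k) (hr : r ≠ k)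
    (he : ∀ x y, eta T x y = (x k - x r) * (y b - y r) - (x b - x r) * (y k - y r))
    {p q s p' q' s' : ℂ} (h : ∀ z, p * lf A k z + q * lf A b z + s * lf A r z = 0)
    (h' : ∀ z, p' * lf B k z + q' * lf B b z + s' * lf B r z = 0) :
    Complex.exp (d T k) * ((q * lf A b X.bp) * (s' * lf B r Y.bp)) =
      (q' * lf B b Y.bp) * (s * lf A r X.bp) := by
  obtain ⟨g, hg, hX⟩ := X.chi k hk
  obtain ⟨g', hg', hY⟩ := Y.chi k hk
  have e1 := hX T b r hb hr he p q s h
  have e2 := hY T b r hb hr he p' q' s' h'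
  have e3 : (Y.ho g).L = (Y.ho g').L := by funext m; rw [hL, hg, hg']
  rw [← exp_J_congr Y T e3] at e2
  have e4 : (Y.ho g).J T = (X.ho g).J T + 2 * Real.pi * Complex.I * d T k := by
    have := hJ T g
    simp only [fn, dJ, hg, mul_ite, mul_zero, Finset.sum_ite_eq', Finset.mem_univ, if_true] at this
    linear_combination this
  rw [e4, add_div, mul_div_cancel_left₀ _ tpi, Complex.exp_add] at e2
  set E := Complex.exp ((X.ho g).J T / (2 * Real.pi * Complex.I))
  linear_combination (Complex.exp (d T k) * s' * lf B r Y.bp) * e1 - s * lf A r X.bp * e2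

def Av (α : ℂ) : Fin 12 → Fin 3 → ℂ := ![![0,0,1], ![α,-1,1], ![α^2+α,-α,α+1], ![1,0,0],
  ![1,α,-(α+1)], ![α+1,-1,0], ![1,0,-1], ![α,α^2,-(α^3+α^2+α)], ![0,1,0], ![0,1,-1],
  ![0,α^2+1,-(α^2+α+1)], ![0,α,-((α+1)^2)]]

theorem eta9 (x y : Fin 12 → ℂ) : eta 9 x y = (x 8 - x 2) * (y 1 - y 2) - (x 1 - x 2) * (y 8 - y 2) := by
  simp only [eta, uu, vv, show tr 9 = (1,2,8) from rfl]; ring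
theorem eta11 (x y : Fin 12 → ℂ) : eta 11 x y = (x 10 - x 4) * (y 1 - y 4) - (x 1 - x 4) * (y 10 - y 4) := by
  simp only [eta, uu, vv, show tr 11 = (1,4,10) from rfl]; ring
theorem eta6 (x y : Fin 12 → ℂ) : eta 6 x y = (x 5 - x 2) * (y 0 - y 2) - (x 0 - x 2) * (y 5 - y 2) := by
  simp only [eta, uu, vv, show tr 6 = (2,5,0) from rfl]; ring
theorem eta8 (x y : Fin 12 → ℂ) : eta 8 x y = (x 7 - x 4) * (y 0 - y 4) - (x 0 - x 4) * (y 7 - y 4) := by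
  simp only [eta, uu, vv, show tr 8 = (4,7,0) from rfl]; ring

theorem rel9 (α : ℂ) (z) : -1 * lf (Av α) 8 z + (-(α+1)) * lf (Av α) 1 z + 1 * lf (Av α) 2 z = 0 := by
  change -1 * (0 * z.1 + 1 * z.2 + 0) + (-(α+1)) * (α * z.1 + -1 * z.2 + 1) +
    1 * ((α^2+α) * z.1 + -α * z.2 + (α+1)) = 0
  ring
theorem rel11 (α : ℂ) (z) : 1 * lf (Av α) 10 z + 1 * lf (Av α) 1 z + (-α) * lf (Av α) 4 z = 0 := by
  change 1 * (0 * z.1 + (α^2+1) * z.2 + -(α^2+α+1)) + 1 * (α * z.1 + -1 * z.2 + 1) +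
    (-α) * (1 * z.1 + α * z.2 + -(α+1)) = 0
  ring
theorem rel6 (α : ℂ) (z) : (-α) * lf (Av α) 5 z + (-(α+1)) * lf (Av α) 0 z + 1 * lf (Av α) 2 z = 0 := by
  change -α * ((α+1) * z.1 + -1 * z.2 + 0) + (-(α+1)) * (0 * z.1 + 0 * z.2 + 1) +
    1 * ((α^2+α) * z.1 + -α * z.2 + (α+1)) = 0
  ring
theorem rel8 (α : ℂ) (z) : 1 * lf (Av α) 7 z + α^3 * lf (Av α) 0 z + (-α) * lf (Av α) 4 z = 0 := by
  change 1 * (α * z.1 + α^2 * z.2 + -(α^3+α^2+α)) + α^3 * (0 * z.1 + 0 * z.2 + 1) +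
    (-α) * (1 * z.1 + α * z.2 + -(α+1)) = 0
  ring

theorem lf0 (α : ℂ) (z) : lf (Av α) 0 z = 1 := by
  change 0 * z.1 + 0 * z.2 + 1 = 1
  ring

theorem cubes {α β : ℂ} (X : GD (Av α) G) (Y : GD (Av β) G) (hL : ∀ g, (Y.ho g).L = (X.ho g).L)
    (ha : α ≠ 0) (hb : β ≠ 0) (ha1 : α + 1 ≠ 0) (hb1 : β + 1 ≠ 0) : α ^ 3 = β ^ 3 := by
  obtain ⟨d, hd, hJ⟩ := dJ_ex X Y hL
  have ht := theta X Y hL hd hJ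
  have h9 := exp_d X Y hL hJ 1 2 (by decide) (by decide) (by decide) eta9 (rel9 α) (rel9 β)
  have h11 := exp_d X Y hL hJ 1 4 (by decide) (by decide) (by decide) eta11 (rel11 α) (rel11 β)
  have h6 := exp_d X Y hL hJ 0 2 (by decide) (by decide) (by decide) eta6 (rel6 α) (rel6 β)
  have h8 := exp_d X Y hL hJ 0 4 (by decide) (by decide) (by decide) eta8 (rel8 α) (rel8 β)
  rw [lf0, lf0] at h6 h8
  have hE : Complex.exp (d 11 10) * Complex.exp (d 6 5) = Complex.exp (d 9 8) * Complex.exp (d 8 7) := by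
    rw [← Complex.exp_add, ← Complex.exp_add]
    congr 1
    linear_combination ht
  have a1 := X.mem 1
  have a2 := X.mem 2
  have a4 := X.mem 4
  have b1 := Y.mem 1
  have b2 := Y.mem 2
  have b4 := Y.mem 4
  generalize lf (Av α) 1 X.bp = l1 at *
  generalize lf (Av α) 2 X.bp = l2 at *
  generalize lf (Av α) 4 X.bp = l4 at *
  generalize lf (Av β) 1 Y.bp = m1 at *
  generalize lf (Av β) 2 Y.bp = m2 at *
  generalize lf (Av β) 4 Y.bp = m4 at *
  have r9 : Complex.exp (d 9 8) = ((β+1) * m1 * l2) / ((α+1) * l1 * m2) := by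
    rw [eq_div_iff (by positivity)]; linear_combination - h9
  have r11 : Complex.exp (d 11 10) = (m1 * α * l4) / (l1 * β * m4) := by
    rw [eq_div_iff (by positivity)]; linear_combination - h11
  have r6 : Complex.exp (d 6 5) = ((β+1) * l2) / ((α+1) * m2) := by
    rw [eq_div_iff (by positivity)]; linear_combination - h6
  have r8 : Complex.exp (d 8 7) = (β^3 * α * l4) / (α^3 * β * m4) := by
    rw [eq_div_iff (by positivity)]; linear_combination - h8
  rw [r9, r11, r6, r8] at hE
  field_simp at hE
  exact hE

end

noncomputable section
open Set Topology unitInterval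

variable {A B : Fin 12 → Fin 3 → ℂ} {G : Type} [Group G]

theorem homotopic_cast {X : Type*} [TopologicalSpace X] {a b a' b' : X} {γ γ' : Path a b}
    (h : γ.Homotopic γ') (ha : a' = a) (hb : b' = b) : (γ.cast ha hb).Homotopic (γ'.cast ha hb) := by
  subst ha hb; exact h

theorem map_cls {X Y : Type*} [TopologicalSpace X] [TopologicalSpace Y] (f : C(X, Y)) {x : X}
    (γ : Path x x) : FundamentalGroup.map f x (cls γ) = cls (γ.map f.continuous) := rfl

def piIso {X Y : Type*} [TopologicalSpace X] [TopologicalSpace Y] (f : X ≃ₜ Y) (x : X) :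
    FundamentalGroup X x ≃* FundamentalGroup Y (f x) :=
  MulEquiv.ofBijective (FundamentalGroup.map (f : C(X, Y)) x) (by
    constructor
    · intro g g' h
      obtain ⟨γ, rfl⟩ := cls_surj g
      obtain ⟨γ', rfl⟩ := cls_surj g'
      rw [map_cls, map_cls] at h
      have h1 : (γ.map f.continuous).Homotopic (γ'.map f.continuous) := Path.Homotopic.Quotient.eq.1 h
      have h2 := homotopic_cast (h1.map (f.symm : C(Y, X))) (f.symm_apply_apply x).symm
        (f.symm_apply_apply x).symm
      apply cls_eq
      convert h2 using 1
      · ext t; simp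
      · ext t; simp
    · intro g
      obtain ⟨γ, rfl⟩ := cls_surj g
      refine ⟨cls ((γ.map f.symm.continuous).cast (f.symm_apply_apply x).symm
        (f.symm_apply_apply x).symm), ?_⟩
      rw [map_cls]
      congr 1
      ext t
      simp)

theorem piIso_cls {X Y : Type*} [TopologicalSpace X] [TopologicalSpace Y] (f : X ≃ₜ Y) {x : X}
    (γ : Path x x) : piIso f x (cls γ) = cls (γ.map f.continuous) := rfl

def cjH (A : Fin 12 → Fin 3 → ℂ) : XA A ≃ₜ XA (cjA A) where
  toFun := cjX A
  invFun p := ⟨star p.1, fun k h => p.2 k (by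
    rw [← star_star p.1, lf_cj, h, star_zero])⟩
  left_inv p := Subtype.ext (star_star p.1)
  right_inv p := Subtype.ext (star_star p.1)
  continuous_toFun := (cjX A).continuous
  continuous_invFun := by fun_prop

theorem conj_ex (h : DepOK A) (h' : DepOK (cjA A)) (h0 : A 0 = ![0, 0, 1]) (h0' : cjA A 0 = ![0, 0, 1])
    (b : XA A) (e : G ≃* FundamentalGroup (XA A) b) : ∃ Y : GD (cjA A) G, ∀ g k,
      (Y.ho g).L k = star (((GD.of h h0 b e).ho g).L k) := by
  refine ⟨GD.of h' h0' (cjH A b) (e.trans (piIso (cjH A) b)), fun g k => ?_⟩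
  change ((Hol h'.tr).onG (piIso (cjH A) b (e g))).L k = star (((Hol h.tr).onG (e g)).L k)
  obtain ⟨γ, hγ⟩ := cls_surj (e g)
  rw [← hγ, piIso_cls, PF.onG_cls, PF.onG_cls]
  exact L_conj h.tr h'.tr γ k

theorem cjA_Av (β : ℂ) : cjA (Av β) = Av (star β) := by
  funext k i
  fin_cases k <;> fin_cases i <;> simp [cjA, Av]

theorem cubes2 {α β : ℂ} (ha : α ≠ 0) (hb : β ≠ 0) (ha1 : α + 1 ≠ 0) (hb1 : β + 1 ≠ 0)
    (dA : DepOK (Av α)) (dB : DepOK (Av β)) (dB' : DepOK (Av (star β)))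
    (a : XA (Av α)) (b : XA (Av β))
    (e : FundamentalGroup (XA (Av α)) a ≃* FundamentalGroup (XA (Av β)) b) :
    α ^ 3 = β ^ 3 ∨ α ^ 3 = (star β) ^ 3 := by
  let X : GD (Av α) _ := GD.of dA rfl a (MulEquiv.refl _)
  let Y : GD (Av β) _ := GD.of dB rfl b e
  obtain ⟨c, hc, h⟩ := L_pm X Y
  rcases hc with rfl | rfl
  · left
    exact cubes X Y (fun g => funext fun k => by rw [h, one_mul]) ha hb ha1 hb1
  · right
    have hex : ∃ Z : GD (Av (star β)) (FundamentalGroup (XA (Av α)) a), ∀ g k,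
        (Z.ho g).L k = star ((Y.ho g).L k) := by
      rw [← cjA_Av]
      exact conj_ex dB (by rw [cjA_Av]; exact dB') rfl (by rw [cjA_Av]; rfl) b e
    obtain ⟨Z, hZ⟩ := hex
    refine cubes X Z (fun g => funext fun k => ?_) ha (star_ne_zero.2 hb) ha1 ?_
    · obtain ⟨n, hn⟩ := X.int g k
      rw [hZ, h, hn]
      simp
    · intro h1
      apply hb1
      have := congrArg star h1
      simpa using this

end

noncomputable section
open Set Topology unitInterval

def AvR {R : Type*} [CommRing R] (α : R) : Fin 12 → Fin 3 → R := ![![0,0,1], ![α,-1,1], ![α^2+α,-α,α+1], ![1,0,0],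
  ![1,α,-(α+1)], ![α+1,-1,0], ![1,0,-1], ![α,α^2,-(α^3+α^2+α)], ![0,1,0], ![0,1,-1],
  ![0,α^2+1,-(α^2+α+1)], ![0,α,-((α+1)^2)]]

theorem AvR_map {R S : Type*} [CommRing R] [CommRing S] (f : R →+* S) (α : R) (k i) :
    AvR (f α) k i = f (AvR α k i) := by
  fin_cases k <;> fin_cases i <;> simp [AvR]

theorem det3_map {R S : Type*} [CommRing R] [CommRing S] (f : R →+* S) (α : R) (i j m) :
    det3 (AvR (f α) i) (AvR (f α) j) (AvR (f α) m) = f (det3 (AvR α i) (AvR α j) (AvR α m)) := by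
  simp only [det3, AvR_map, map_add, map_sub, map_mul]

theorem nondep : ∀ i j m : Fin 12, i ≠ j → det3 (AvR (7 : ZMod 29) i) (AvR (7 : ZMod 29) j) (AvR (7 : ZMod 29) m) = 0 →
    dep i j m = true := by
  decide +kernel

def vP (α : ℂ) : Fin 13 → Fin 3 → ℂ := ![![1,0,0], ![1,α+1,1], ![1,α+1,0], ![0,1,0], ![α,-1,0],
  ![1,0,-α], ![0,1,1], ![1,α^2+α+1,α^2+1], ![0,α+1,α], ![α,(α+1)^2,α],
  ![-1,(α^2+α)*(α^2+α+1),(α^2+α)*(α^2+1)], ![0,0,1], ![1,1,1]]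

theorem vP_ne {α : ℂ} (ha : α ≠ 0) (P) : vP α P ≠ 0 := by
  intro h
  have e0 := congrFun h 0
  have e1 := congrFun h 1
  have e2 := congrFun h 2
  fin_cases P <;> simp_all [vP]

theorem vP_inc {α : ℂ} (h : α^6 + α^5 + α^4 + α^3 + α^2 + α + 1 = 0) (P : Fin 13) (k : Fin 12)
    (hk : inP P k = true) : Av α k 0 * vP α P 0 + Av α k 1 * vP α P 1 + Av α k 2 * vP α P 2 = 0 := by
  fin_cases P <;> fin_cases k <;> first
    | exact absurd hk (by decide)
    | (simp only [Av, vP]; simp; done)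
    | (simp only [Av, vP]; simp; ring1)
    | (simp only [Av, vP]; simp; linear_combination (-α) * h)

theorem det3_ker {a b c v : Fin 3 → ℂ} (hv : v ≠ 0) (ha : a 0 * v 0 + a 1 * v 1 + a 2 * v 2 = 0)
    (hb : b 0 * v 0 + b 1 * v 1 + b 2 * v 2 = 0) (hc : c 0 * v 0 + c 1 * v 1 + c 2 * v 2 = 0) :
    det3 a b c = 0 := by
  by_contra hd
  apply hv
  have h0 : det3 a b c * v 0 = 0 := by
    rw [det3]
    linear_combination (b 1 * c 2 - b 2 * c 1) * ha - (a 1 * c 2 - a 2 * c 1) * hb + (a 1 * b 2 - a 2 * b 1) * hc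
  have h1 : det3 a b c * v 1 = 0 := by
    rw [det3]
    linear_combination (-(b 0 * c 2 - b 2 * c 0)) * ha + (a 0 * c 2 - a 2 * c 0) * hb - (a 0 * b 2 - a 2 * b 0) * hc
  have h2 : det3 a b c * v 2 = 0 := by
    rw [det3]
    linear_combination (b 0 * c 1 - b 1 * c 0) * ha - (a 0 * c 1 - a 1 * c 0) * hb + (a 0 * b 1 - a 1 * b 0) * hc
  funext k
  fin_cases k
  · exact (mul_eq_zero.1 h0).resolve_left hd
  · exact (mul_eq_zero.1 h1).resolve_left hd
  · exact (mul_eq_zero.1 h2).resolve_left hd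

theorem phi_prim {α : ℂ} (h : α^6 + α^5 + α^4 + α^3 + α^2 + α + 1 = 0) : IsPrimitiveRoot α 7 := by
  have : Fact (Nat.Prime 7) := ⟨by norm_num⟩
  rw [← Polynomial.isRoot_cyclotomic_iff, Polynomial.cyclotomic_prime]
  simp [Finset.sum_range_succ]
  linear_combination h

theorem prim_phi {α : ℂ} (h : IsPrimitiveRoot α 7) : α^6 + α^5 + α^4 + α^3 + α^2 + α + 1 = 0 := by
  have : Fact (Nat.Prime 7) := ⟨by norm_num⟩
  rw [← Polynomial.isRoot_cyclotomic_iff, Polynomial.cyclotomic_prime] at h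
  simp [Finset.sum_range_succ] at h
  linear_combination h

theorem Av_dep {α : ℂ} (h : α^6 + α^5 + α^4 + α^3 + α^2 + α + 1 = 0) : DepOK (Av α) := by
  have ha : α ≠ 0 := by rintro rfl; simp at h
  intro i j m hij
  constructor
  · intro hd
    apply nondep i j m hij
    let D : Polynomial ℤ := det3 (AvR Polynomial.X i) (AvR Polynomial.X j) (AvR Polynomial.X m)
    have e1 : Polynomial.aeval α D = 0 := by
      have := det3_map (Polynomial.aeval (R := ℤ) α).toRingHom Polynomial.X i j m
      rw [AlgHom.toRingHom_eq_coe, RingHom.coe_coe, Polynomial.aeval_X] at this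
      exact this.symm.trans hd
    have e2 : Polynomial.cyclotomic 7 ℤ ∣ D := by
      rw [Polynomial.cyclotomic_eq_minpoly (phi_prim h) (by norm_num)]
      exact minpoly.isIntegrallyClosed_dvd ((phi_prim h).isIntegral (by norm_num)) e1
    obtain ⟨Q, hQ⟩ := e2
    have e3 : Polynomial.aeval (7 : ZMod 29) D = 0 := by
      have : Fact (Nat.Prime 7) := ⟨by norm_num⟩
      rw [hQ, map_mul, Polynomial.cyclotomic_prime]
      have : Polynomial.aeval (7 : ZMod 29) (∑ i ∈ Finset.range 7, (Polynomial.X : Polynomial ℤ) ^ i) = 0 := by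
        simp [Finset.sum_range_succ]
        decide
      rw [this, zero_mul]
    have := det3_map (Polynomial.aeval (R := ℤ) (7 : ZMod 29)).toRingHom Polynomial.X i j m
    rw [AlgHom.toRingHom_eq_coe, RingHom.coe_coe, Polynomial.aeval_X] at this
    exact this.trans e3
  · intro hd
    simp only [dep, Bool.or_eq_true, beq_iff_eq, List.any_eq_true, Bool.and_eq_true] at hd
    rcases hd with (hd | hd) | ⟨P, -, ⟨h1, h2⟩, h3⟩
    · rw [Fin.ext hd]; simp only [det3]; ring
    · rw [Fin.ext hd]; simp only [det3]; ring
    · exact det3_ker (vP_ne ha P) (vP_inc h P i h1) (vP_inc h P j h2) (vP_inc h P m h3)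

end

section
open Set Topology unitInterval

theorem mk_mem (v : Fin 3 → ℂ) (hv : v ≠ 0) (a b c : ℂ) :
    Projectivization.mk ℂ v hv ∈ projLine a b c ↔ a * v 0 + b * v 1 + c * v 2 = 0 := by
  obtain ⟨u, hu⟩ := exists_smul_eq_mk_rep ℂ v hv
  change a * (Projectivization.mk ℂ v hv).rep 0 + b * (Projectivization.mk ℂ v hv).rep 1 +
    c * (Projectivization.mk ℂ v hv).rep 2 = 0 ↔ _
  rw [← hu]
  have e : a * (u • v) 0 + b * (u • v) 1 + c * (u • v) 2 = u * (a * v 0 + b * v 1 + c * v 2) := by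
    simp only [Pi.smul_apply, Units.smul_def, smul_eq_mul]; ring
  rw [e, mul_eq_zero, or_iff_right u.ne_zero]

theorem NN_eq (α : ℂ) (k : Fin 12) : NNline α k = projLine (Av α k 0) (Av α k 1) (Av α k 2) := by
  fin_cases k <;> rfl

theorem mk_mem_M (α : ℂ) (v : Fin 3 → ℂ) (hv : v ≠ 0) :
    Projectivization.mk ℂ v hv ∈ (⋃ k, NNline α k)ᶜ ↔
      ∀ k, Av α k 0 * v 0 + Av α k 1 * v 1 + Av α k 2 * v 2 ≠ 0 := by
  simp only [mem_compl_iff, mem_iUnion, not_exists, NN_eq, mk_mem, ne_eq]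

theorem aff_ne (p : ℂ × ℂ) : (![p.1, p.2, 1] : Fin 3 → ℂ) ≠ 0 := fun h => by
  have := congrFun h 2
  simp at this

def aff (p : ℂ × ℂ) : CP2 := Projectivization.mk ℂ ![p.1, p.2, 1] (aff_ne p)

def unaff (p : CP2) : ℂ × ℂ := (p.rep 0 / p.rep 2, p.rep 1 / p.rep 2)

theorem unaff_mk (v : Fin 3 → ℂ) (hv : v ≠ 0) :
    unaff (Projectivization.mk ℂ v hv) = (v 0 / v 2, v 1 / v 2) := by
  obtain ⟨u, hu⟩ := exists_smul_eq_mk_rep ℂ v hv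
  rw [unaff, ← hu]
  simp only [Pi.smul_apply, Units.smul_def, smul_eq_mul]
  rw [mul_div_mul_left _ _ u.ne_zero, mul_div_mul_left _ _ u.ne_zero]

theorem mk_quot : IsQuotientMap (fun v : {v : Fin 3 → ℂ // v ≠ 0} =>
    (Projectivization.mk ℂ v.1 v.2 : CP2)) := isQuotientMap_quotient_mk'

theorem cv (k : Fin 3) : Continuous (fun v : {v : Fin 3 → ℂ // v ≠ 0} => v.1 k) :=
  (continuous_apply k).comp continuous_subtype_val

theorem M_open (α : ℂ) : IsOpen (⋃ k, NNline α k)ᶜ := by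
  rw [← mk_quot.isOpen_preimage]
  have : (fun v : {v : Fin 3 → ℂ // v ≠ 0} => (Projectivization.mk ℂ v.1 v.2 : CP2)) ⁻¹'
      (⋃ k, NNline α k)ᶜ = ⋂ k, {v | Av α k 0 * v.1 0 + Av α k 1 * v.1 1 + Av α k 2 * v.1 2 ≠ 0} := by
    ext v
    rw [mem_preimage, mk_mem_M, mem_iInter]
    rfl
  rw [this]
  refine isOpen_iInter_of_finite fun k => ?_
  exact isOpen_ne_fun (((continuous_const.mul (cv 0)).add (continuous_const.mul (cv 1))).add
    (continuous_const.mul (cv 2))) continuous_const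

theorem unaff_cont (α : ℂ) : ContinuousOn unaff (⋃ k, NNline α k)ᶜ := by
  rw [mk_quot.continuousOn_isOpen_iff (M_open α)]
  have e : unaff ∘ (fun v : {v : Fin 3 → ℂ // v ≠ 0} => (Projectivization.mk ℂ v.1 v.2 : CP2)) =
      fun v => (v.1 0 / v.1 2, v.1 1 / v.1 2) := funext fun v => unaff_mk v.1 v.2
  rw [e]
  have h : ∀ v ∈ (fun v : {v : Fin 3 → ℂ // v ≠ 0} => (Projectivization.mk ℂ v.1 v.2 : CP2)) ⁻¹'
      (⋃ k, NNline α k)ᶜ, v.1 2 ≠ 0 := by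
    intro v hv
    rw [mem_preimage, mk_mem_M] at hv
    have := hv 0
    simpa [Av] using this
  refine ContinuousOn.prodMk ?_ ?_
  · exact ContinuousOn.div (cv 0).continuousOn (cv 2).continuousOn h
  · exact ContinuousOn.div (cv 1).continuousOn (cv 2).continuousOn h

theorem aff_cont : Continuous aff :=
  mk_quot.continuous.comp (f := fun p : ℂ × ℂ => (⟨![p.1, p.2, 1], aff_ne p⟩ : {v : Fin 3 → ℂ // v ≠ 0})) (by
    refine Continuous.subtype_mk ?_ _
    refine continuous_pi fun k => ?_
    fin_cases k
    · exact continuous_fst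
    · exact continuous_snd
    · exact continuous_const)

theorem aff_mem (α : ℂ) (p : ℂ × ℂ) : aff p ∈ (⋃ k, NNline α k)ᶜ ↔ p ∈ XA (Av α) := by
  rw [aff, mk_mem_M]
  change _ ↔ ∀ k, lf (Av α) k p ≠ 0
  refine forall_congr' fun k => ?_
  simp [lf]

theorem unaff_aff (p : ℂ × ℂ) : unaff (aff p) = p := by
  rw [aff, unaff_mk]
  simp

theorem aff_unaff (α : ℂ) (p : CP2) (hp : p ∈ (⋃ k, NNline α k)ᶜ) : aff (unaff p) = p := by
  induction p using Projectivization.ind with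
  | h v hv =>
    rw [unaff_mk, aff, mk_eq_mk_iff']
    rw [mk_mem_M] at hp
    have h2 : v 2 ≠ 0 := by
      have := hp 0
      simpa [Av] using this
    refine ⟨(v 2)⁻¹, ?_⟩
    funext k
    fin_cases k
    · simp [div_eq_inv_mul]
    · simp [div_eq_inv_mul]
    · simp [h2]

def affH (α : ℂ) : ↥((⋃ k, NNline α k)ᶜ) ≃ₜ XA (Av α) where
  toFun p := ⟨unaff p.1, by rw [← aff_mem, aff_unaff α p.1 p.2]; exact p.2⟩
  invFun p := ⟨aff p.1, (aff_mem α p.1).2 p.2⟩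
  left_inv p := Subtype.ext (aff_unaff α p.1 p.2)
  right_inv p := Subtype.ext (unaff_aff p.1)
  continuous_toFun := by
    refine Continuous.subtype_mk ?_ _
    exact continuousOn_iff_continuous_domRestrict.1 (unaff_cont α)
  continuous_invFun := by
    refine Continuous.subtype_mk ?_ _
    exact aff_cont.comp continuous_subtype_val

theorem prim_star {β : ℂ} (h : IsPrimitiveRoot β 7) : star β = β⁻¹ := by
  have h1 : ‖β‖ = 1 := h.norm'_eq_one (by norm_num)
  exact (Complex.inv_eq_conj h1).symm

theorem prim_add_one {α : ℂ} (h : α^6 + α^5 + α^4 + α^3 + α^2 + α + 1 = 0) : α + 1 ≠ 0 := by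
  intro h1
  have : α = -1 := eq_neg_of_add_eq_zero_left h1
  subst this
  norm_num at h

theorem cube_inj {α β : ℂ} (ha : α ^ 7 = 1) (hb : β ^ 7 = 1) (h : α ^ 3 = β ^ 3) : α = β := by
  have e1 : α = (α ^ 3) ^ 5 := by
    rw [← pow_mul, show 3 * 5 = 7 * 2 + 1 by norm_num, pow_add, pow_mul, ha]; simp
  have e2 : β = (β ^ 3) ^ 5 := by
    rw [← pow_mul, show 3 * 5 = 7 * 2 + 1 by norm_num, pow_add, pow_mul, hb]; simp
  rw [e1, e2, h]

end

/-- For `i ≠ j ∈ {1,…,6}` with `i + j ≢ 0 (mod 7)`, the fundamental groups of the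
complements `M(𝔑_i)` and `M(𝔑_j)` are not isomorphic (for any basepoints). -/
theorem statement11 (ξ : ℂ) (hξ : ξ^6 + ξ^5 + ξ^4 + ξ^3 + ξ^2 + ξ + 1 = 0)
    (i j : ℕ) (hi : i ∈ Finset.Icc 1 6) (hj : j ∈ Finset.Icc 1 6)
    (hij : i ≠ j) (hmod : ¬ (7 ∣ i + j))
    (p : ↥((⋃ k, NNline (ξ^i) k)ᶜ)) (q : ↥((⋃ k, NNline (ξ^j) k)ᶜ)) :
    ¬ Nonempty (FundamentalGroup (↥((⋃ k, NNline (ξ^i) k)ᶜ)) p ≃*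
      FundamentalGroup (↥((⋃ k, NNline (ξ^j) k)ᶜ)) q) := by
  rintro ⟨e⟩
  have hp := phi_prim hξ
  have cop : ∀ i ∈ Finset.Icc 1 6, Nat.Coprime i 7 := by decide
  have pi' := hp.pow_of_coprime i (cop i hi)
  have pj := hp.pow_of_coprime j (cop j hj)
  have fi := prim_phi pi'
  have fj := prim_phi pj
  have sj : IsPrimitiveRoot (star (ξ ^ j)) 7 := by rw [prim_star pj]; exact pj.inv
  have e' := ((piIso (affH (ξ ^ i)) p).symm.trans e).trans (piIso (affH (ξ ^ j)) q)
  rw [Finset.mem_Icc] at hi hj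
  rcases cubes2 (pi'.ne_zero (by norm_num)) (pj.ne_zero (by norm_num)) (prim_add_one fi) (prim_add_one fj)
    (Av_dep fi) (Av_dep fj) (Av_dep (prim_phi sj)) _ _ e' with h | h
  · exact hij (hp.pow_inj (by omega) (by omega) (cube_inj pi'.pow_eq_one pj.pow_eq_one h))
  · have h3 := cube_inj pi'.pow_eq_one sj.pow_eq_one h
    rw [prim_star pj] at h3
    apply hmod
    rw [← hp.pow_eq_one_iff_dvd, pow_add, h3, inv_mul_cancel₀ (pj.ne_zero (by norm_num))]
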